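/- arXiv:2410.22341 — 3 statements merged into one kernel-verified Lean document; each statement's English description precedes it below -/
import Mathlib

section
/- There is an absolute constant c > 0 such that for every n ≥ 2, ρ ∈ (0,1/2], m with 1 ≤ m ≤ n−1, and all sufficiently small ε > 0, the maximum number of timesteps at which an averaging system has an embedded edge of length at least ε satisfies T_{m,ε} ≤ c·(1/ρ)^{n−1}·(m·n·log(1/ε))^m. -/
open scoped BigOperators ENNReal

/-- An averaging system on `n` agents with weight threshold `ρ`: a sequence of
row-stochastic matrices `P t` whose positive entries (the edges of the graph `G t`,
including a self-loop at every vertex) are at least `ρ`, with symmetric support,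
together with the orbit `x (t+1) = P t * x t`. -/
structure AvgSystem (n : ℕ) (ρ : ℝ) where
  P : ℕ → Matrix (Fin n) (Fin n) ℝ
  x : ℕ → Fin n → ℝ
  nonneg : ∀ t i j, 0 ≤ P t i j
  rowSum : ∀ t i, ∑ j, P t i j = 1
  diagPos : ∀ t i, 0 < P t i i
  symm : ∀ t i j, P t i j = 0 ↔ P t j i = 0
  threshold : ∀ t i j, P t i j ≠ 0 → ρ ≤ P t i j
  update : ∀ t, x (t + 1) = (P t).mulVec (x t)

/-- The union of the embedded edges of `G t` on the real line. -/
def AvgSystem.edgeUnion {n : ℕ} {ρ : ℝ} (S : AvgSystem n ρ) (t : ℕ) : Set ℝ :=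
  ⋃ (i : Fin n) (j : Fin n) (_ : S.P t i j ≠ 0), Set.uIcc (S.x t i) (S.x t j)

/-- The blocks of a union of embedded edges: its connected components. -/
def blockSet (U : Set ℝ) : Set (Set ℝ) :=
  {C | ∃ a ∈ U, C = connectedComponentIn U a}

/-- `E_{s,t}`: the sum of the `s`-th powers of the block lengths. -/
noncomputable def stepEnergy (s : ℝ) (U : Set ℝ) : ℝ≥0∞ :=
  ∑' C : blockSet U, ENNReal.ofReal (Metric.diam (C : Set ℝ) ^ s)

/-- The `s`-energy of an averaging system. -/
noncomputable def AvgSystem.energy {n : ℕ} {ρ : ℝ} (S : AvgSystem n ρ) (s : ℝ) : ℝ≥0∞ :=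
  ∑' t : ℕ, stepEnergy s (S.edgeUnion t)

/-- Every graph `G t` of the system has at most `m` connected components. -/
def AvgSystem.componentsLE {n : ℕ} {ρ : ℝ} (S : AvgSystem n ρ) (m : ℕ) : Prop :=
  ∀ t : ℕ, ∃ c : Fin n → Fin m,
    (∀ i j, S.P t i j ≠ 0 → c i = c j) ∧
    (∀ i j, c i = c j → Relation.ReflTransGen (fun a b => S.P t a b ≠ 0) i j)

/-- The set of timesteps at which `G t` has an embedded edge of length at least `ε`. -/
def AvgSystem.longTimes {n : ℕ} {ρ : ℝ} (S : AvgSystem n ρ) (ε : ℝ) : Set ℕ :=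
  {t | ∃ i j, S.P t i j ≠ 0 ∧ ε ≤ |S.x t i - S.x t j|}

structure Twist (ρ : ℝ) (x : ℕ → ℤ → ℝ) (cr : ℕ → ℤ → Prop) : Prop where
  mono : ∀ t, Monotone (x t)
  up : ∀ t k, ¬ cr t k → x (t + 1) k ≤ x t k
  dn : ∀ t k, ¬ cr t k → x t (k + 1) ≤ x (t + 1) (k + 1)
  lo : ∀ t k M, cr t k → ¬ cr t M → k < M →
    x (t + 1) (k + 1) ≤ ρ * x t k + (1 - ρ) * x t M
  hi : ∀ t k M, cr t k → ¬ cr t M → M < k →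
    ρ * x t (k + 1) + (1 - ρ) * x t (M + 1) ≤ x (t + 1) k

theorem Twist.refl {ρ : ℝ} {x : ℕ → ℤ → ℝ} {cr : ℕ → ℤ → Prop} (h : Twist ρ x cr) :
    Twist ρ (fun t k => - x t (1 - k)) (fun t k => cr t (-k)) where
  mono := fun t a b hab => by
    have := h.mono t (show 1 - b ≤ 1 - a by omega)
    simpa using this
  up := fun t k hk => by
    have := h.dn t (-k) hk
    rw [show -k + 1 = 1 - k by ring] at this
    simpa using this
  dn := fun t k hk => by
    have := h.up t (-k) hk
    rw [show 1 - (k + 1) = -k by ring]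
    simpa using this
  lo := fun t k M hk hM hkM => by
    have := h.hi t (-k) (-M) hk hM (by omega)
    rw [show -k + 1 = 1 - k by ring, show -M + 1 = 1 - M by ring] at this
    rw [show 1 - (k + 1) = -k by ring]
    linarith
  hi := fun t k M hk hM hkM => by
    have := h.lo t (-k) (-M) hk hM (by omega)
    rw [show -k + 1 = 1 - k by ring] at this
    rw [show 1 - (k + 1) = -k by ring, show 1 - (M + 1) = -M by ring]
    linarith

def Lng (x : ℕ → ℤ → ℝ) (cr : ℕ → ℤ → Prop) (ε : ℝ) (t : ℕ) (l h : ℤ) : Prop :=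
  ∃ u v, l < u ∧ u ≤ v ∧ v ≤ h ∧ (∀ k, u ≤ k → k < v → cr t k) ∧ ε ≤ x t v - x t u

theorem Lng.lt {x : ℕ → ℤ → ℝ} {cr : ℕ → ℤ → Prop} {ε : ℝ} {t : ℕ} {l h : ℤ}
    (H : Lng x cr ε t l h) : l < h := by
  obtain ⟨u, v, h1, h2, h3, -⟩ := H
  omega

theorem Lng.split {x : ℕ → ℤ → ℝ} {cr : ℕ → ℤ → Prop} {ε : ℝ} {t : ℕ} {l h i : ℤ}
    (H : Lng x cr ε t l h) (hi : ¬ cr t i) : Lng x cr ε t l i ∨ Lng x cr ε t i h := by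
  obtain ⟨u, v, h1, h2, h3, h4, h5⟩ := H
  by_cases hv : v ≤ i
  · exact Or.inl ⟨u, v, h1, h2, hv, h4, h5⟩
  · by_cases hu : i < u
    · exact Or.inr ⟨u, v, hu, h2, h3, h4, h5⟩
    · exact absurd (h4 i (by omega) (by omega)) hi

theorem Lng.diam {x : ℕ → ℤ → ℝ} {cr : ℕ → ℤ → Prop} {ε : ℝ} {t : ℕ} {l h : ℤ}
    (hm : Monotone (x t)) (H : Lng x cr ε t l h) : ε ≤ x t h - x t (l + 1) := by
  obtain ⟨u, v, h1, h2, h3, h4, h5⟩ := H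
  have a := hm h3
  have b := hm (show l + 1 ≤ u by omega)
  linarith

theorem Lng.refl {x : ℕ → ℤ → ℝ} {cr : ℕ → ℤ → Prop} {ε : ℝ} {t : ℕ} {l h : ℤ}
    (H : Lng x cr ε t l h) :
    Lng (fun t k => - x t (1 - k)) (fun t k => cr t (-k)) ε t (-h) (-l) := by
  obtain ⟨u, v, h1, h2, h3, h4, h5⟩ := H
  refine ⟨1 - v, 1 - u, by omega, by omega, by omega, ?_, ?_⟩
  · intro k hk1 hk2
    exact h4 (-k) (by omega) (by omega)
  · simp only [sub_sub_cancel]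
    linarith

theorem top_anti {ρ : ℝ} {x : ℕ → ℤ → ℝ} {cr : ℕ → ℤ → Prop} (h : Twist ρ x cr)
    {a b : ℕ} {k : ℤ} (hk : ∀ t, a ≤ t → t < b → ¬ cr t k) :
    ∀ s, a ≤ s → ∀ t, s ≤ t → t ≤ b → x t k ≤ x s k := by
  intro s hs t hst
  induction t, hst using Nat.le_induction with
  | base => intro _; exact le_rfl
  | succ t hst ih =>
    intro htb
    exact (h.up t k (hk t (by omega) (by omega))).trans (ih (by omega))

theorem bot_mono {ρ : ℝ} {x : ℕ → ℤ → ℝ} {cr : ℕ → ℤ → Prop} (h : Twist ρ x cr)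
    {a b : ℕ} {k : ℤ} (hk : ∀ t, a ≤ t → t < b → ¬ cr t k) :
    ∀ s, a ≤ s → ∀ t, s ≤ t → t ≤ b → x s (k + 1) ≤ x t (k + 1) := by
  intro s hs t hst
  induction t, hst using Nat.le_induction with
  | base => intro _; exact le_rfl
  | succ t hst ih =>
    intro htb
    exact (ih (by omega)).trans (h.dn t k (hk t (by omega) (by omega)))

/-- One step of the waiting machine. -/
def MStep (cr : ℕ → ℤ → Prop) (γ : ℕ → ℤ) (c : ℕ → ℕ) (t : ℕ) : Prop :=
  (cr t (γ (c t)) ∧ c (t + 1) = c t + 1) ∨ (¬ cr t (γ (c t)) ∧ c (t + 1) = c t)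

theorem exists_mach (cr : ℕ → ℤ → Prop) (γ : ℕ → ℤ) (a : ℕ) :
    ∃ c : ℕ → ℕ, c a = 0 ∧ ∀ t, a ≤ t → MStep cr γ c t := by
  classical
  let d : ℕ → ℕ := fun j => Nat.rec 0 (fun j v => if cr (a + j) (γ v) then v + 1 else v) j
  refine ⟨fun t => d (t - a), by simp [d], ?_⟩
  intro t ht
  obtain ⟨j, rfl⟩ := Nat.exists_eq_add_of_le ht
  have e1 : a + j - a = j := by omega
  have e2 : a + j + 1 - a = j + 1 := by omega
  have e3 : d (j + 1) = if cr (a + j) (γ (d j)) then d j + 1 else d j := rfl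
  unfold MStep
  simp only [e1, e2, e3]
  by_cases hh : cr (a + j) (γ (d j))
  · left; simp [hh]
  · right; simp [hh]

theorem mach_mono {cr : ℕ → ℤ → Prop} {γ : ℕ → ℤ} {c : ℕ → ℕ} {a b : ℕ}
    (hc : ∀ t, a ≤ t → t < b → MStep cr γ c t) :
    ∀ s, a ≤ s → ∀ t, s ≤ t → t ≤ b → c s ≤ c t := by
  intro s hs t hst
  induction t, hst using Nat.le_induction with
  | base => intro _; exact le_rfl
  | succ t hst ih =>
    intro htb
    have := ih (by omega)
    rcases hc t (by omega) (by omega) with h | h <;> omega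

theorem infect {ρ : ℝ} {x : ℕ → ℤ → ℝ} {cr : ℕ → ℤ → Prop} (hT : Twist ρ x cr)
    (h0 : 0 < ρ) (h1 : ρ ≤ 1) {l : ℤ} {g s f : ℕ} {c : ℕ → ℕ}
    (hb : ∀ t, s ≤ t → t < f → ¬ cr t (l + (g + 1 : ℕ)))
    (hc : ∀ t, s ≤ t → t < f → MStep cr (fun e => l + 1 + ((e % g : ℕ) : ℤ)) c t)
    (hcs : c s % g = 0) (hlt : ∀ t, s ≤ t → t < f → c t < c s + g)
    {t0 e0 : ℕ} {Q : ℝ} (hst : s ≤ t0) (hct : c t0 = c s + e0) (hQ0 : 0 ≤ Q)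
    (hQ : Q ≤ x s (l + (g + 1 : ℕ)) - x t0 (l + 1 + e0)) :
    ∀ t, t0 ≤ t → t ≤ f → ∃ e, c t = c s + e ∧ e0 ≤ e ∧
      ρ ^ (e - e0) * Q ≤ x s (l + (g + 1 : ℕ)) - x t (l + 1 + e) := by
  intro t ht
  induction t, ht using Nat.le_induction with
  | base => intro _; exact ⟨e0, hct, le_rfl, by simpa using hQ⟩
  | succ t ht ih =>
    intro htf
    obtain ⟨e, he, hee, hq⟩ := ih (by omega)
    have hl := hlt t (by omega) (by omega)
    have hmod : c t % g = e := by
      rw [he, Nat.add_mod, hcs, zero_add, Nat.mod_mod, Nat.mod_eq_of_lt (by omega)]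
    rcases hc t (by omega) (by omega) with ⟨hcr, hn⟩ | ⟨hcr, hn⟩
    · refine ⟨e + 1, by omega, by omega, ?_⟩
      simp only [hmod] at hcr
      have k1 := hT.lo t _ _ hcr (hb t (by omega) (by omega)) (by push_cast; omega)
      have k2 := top_anti hT hb s le_rfl t (by omega) (by omega)
      rw [show e + 1 - e0 = (e - e0) + 1 by omega, pow_succ]
      push_cast at *
      rw [show l + 1 + ((e : ℤ) + 1) = l + 1 + e + 1 by ring]
      nlinarith
    · refine ⟨e, by omega, hee, ?_⟩
      simp only [hmod] at hcr
      have k1 := hT.up t _ hcr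
      linarith

theorem fiber_interval {c : ℕ → ℕ} {s f : ℕ} {A Q : ℕ → Prop} [DecidablePred A] [DecidablePred Q]
    (hmono : ∀ p, s ≤ p → ∀ q, p ≤ q → q ≤ f → c p ≤ c q)
    (hA : ∀ t, s ≤ t → t + 1 ≤ f → c (t + 1) = c t → A t) (v : ℕ) :
    ((Finset.Ico s f).filter (fun t => c t = v ∧ A t ∧ Q t)) = ∅ ∨
    ∃ p q, s ≤ p ∧ p < q ∧ q ≤ f ∧ (∀ t, p ≤ t → t < q → c t = v ∧ A t) ∧
      ((Finset.Ico s f).filter (fun t => c t = v ∧ A t ∧ Q t)) ⊆ (Finset.Ico p q).filter Q := by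
  rcases Finset.eq_empty_or_nonempty
    ((Finset.Ico s f).filter (fun t => c t = v ∧ A t ∧ Q t)) with h | h
  · exact Or.inl h
  right
  set E := ((Finset.Ico s f).filter (fun t => c t = v ∧ A t ∧ Q t)) with hE
  have hmin := Finset.min'_mem E h
  have hmax := Finset.max'_mem E h
  have hmm : E.min' h ≤ E.max' h := Finset.min'_le _ _ hmax
  set p := E.min' h
  set q := E.max' h
  have hmin' := hmin
  have hmax' := hmax
  rw [hE, Finset.mem_filter, Finset.mem_Ico] at hmin' hmax'
  refine ⟨p, q + 1, by omega, by omega, by omega, ?_, ?_⟩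
  · have hconst : ∀ t, p ≤ t → t ≤ q → c t = v := by
      intro t h1 h2
      have a1 := hmono p (by omega) t h1 (by omega)
      have a2 := hmono t (by omega) q h2 (by omega)
      omega
    intro t h1 h2
    refine ⟨hconst t h1 (by omega), ?_⟩
    by_cases htq : t = q
    · rw [htq]; exact hmax'.2.2.1
    · refine hA t (by omega) (by omega) ?_
      rw [hconst t h1 (by omega), hconst (t + 1) (by omega) (by omega)]
  · intro t ht
    have b1 := Finset.min'_le _ _ ht
    have b2 := Finset.le_max' _ _ ht
    rw [hE, Finset.mem_filter] at ht
    rw [Finset.mem_filter, Finset.mem_Ico]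
    exact ⟨⟨b1, by omega⟩, ht.2.2.2⟩


section
open scoped Classical

noncomputable def Nc (x : ℕ → ℤ → ℝ) (cr : ℕ → ℤ → Prop) (ε : ℝ) (a b : ℕ) (l h : ℤ) : ℕ :=
  ((Finset.Ico a b).filter (fun t => Lng x cr ε t l h)).card

noncomputable def Cnt (cr : ℕ → ℤ → Prop) (t : ℕ) (l h : ℤ) : ℕ :=
  ((Finset.Ioc l h).filter (fun k => ¬ cr t k)).card

noncomputable def co (ρ : ℝ) (m n : ℕ) : ℝ := (10 * (n : ℝ)) ^ m * (1 / ρ) ^ (n - 1)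

noncomputable def psi (ε d : ℝ) : ℝ := Real.log (max d ε)

theorem psi_mono {ε d d' : ℝ} (hε : 0 < ε) (h : d ≤ d') : psi ε d ≤ psi ε d' :=
  Real.log_le_log (lt_max_of_lt_right hε) (max_le_max_right ε h)

theorem psi_lower {ε d : ℝ} (hε : 0 < ε) : Real.log ε ≤ psi ε d :=
  Real.log_le_log hε (le_max_right _ _)

theorem psi_upper {ε d : ℝ} (hε : 0 < ε) (hl : Real.log ε ≤ 0) (h : d ≤ 1) : psi ε d ≤ 0 := by
  have : ε ≤ 1 := by
    by_contra hh
    push Not at hh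
    have := Real.log_pos hh
    linarith
  exact Real.log_nonpos (le_max_of_le_right hε.le) (max_le h this)

theorem psi_four {ε d d' : ℝ} (hε : 0 < ε) (h : d ≤ 4 * d') : psi ε d - psi ε d' ≤ 2 := by
  have h1 : psi ε d ≤ Real.log (4 * max d' ε) := by
    refine Real.log_le_log (lt_max_of_lt_right hε) (max_le ?_ ?_)
    · have := le_max_left d' ε
      linarith
    · have := le_max_right d' ε
      linarith
  rw [Real.log_mul (by norm_num) (lt_max_of_lt_right hε).ne'] at h1
  have h2 : Real.log 4 ≤ 2 := by
    rw [show (4 : ℝ) = 2 * 2 by norm_num, Real.log_mul (by norm_num) (by norm_num)]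
    have := Real.log_two_lt_d9
    linarith
  unfold psi at *
  linarith

def UU (ρ : ℝ) (N m : ℕ) (K : ℝ) : Prop :=
  ∀ ε L : ℝ, 0 < ε → 1 ≤ L → Real.log ε = -L → ∀ x cr, Twist ρ x cr →
    ∀ (a b : ℕ) (l : ℤ) (n : ℕ), a ≤ b → 1 ≤ n → n ≤ N →
    (∀ t, a ≤ t → t < b → ¬ cr t l ∧ ¬ cr t (l + n) ∧ Cnt cr t l (l + n) ≤ m) →
    x a (l + n) - x a (l + 1) ≤ 1 →
    (Nc x cr ε a b l (l + n) : ℝ) * L ≤ L ^ m * (co ρ m n *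
      (psi ε (x a (l + n) - x a (l + 1)) - psi ε (x b (l + n) - x b (l + 1))) + K)

def VV (ρ : ℝ) (N m : ℕ) (K : ℝ) : Prop :=
  ∀ ε L : ℝ, 0 < ε → 1 ≤ L → Real.log ε = -L → ∀ x cr, Twist ρ x cr →
    ∀ (a b : ℕ) (l : ℤ) (n : ℕ), a ≤ b → 1 ≤ n → n ≤ N →
    (∀ t, a ≤ t → t < b → ¬ cr t l ∧ ¬ cr t (l + n) ∧ Cnt cr t l (l + n) + 1 ≤ m) →
    x a (l + n) - x a (l + 1) ≤ 1 →
    (Nc x cr ε a b l (l + n) : ℝ) * L ≤ K * L ^ m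

theorem Cnt_left {cr : ℕ → ℤ → Prop} {t : ℕ} {l i h : ℤ} (hih : i < h) (hli : l < h)
    (hh : ¬ cr t h) : Cnt cr t l i + 1 ≤ Cnt cr t l h := by
  unfold Cnt
  have hn : h ∉ (Finset.Ioc l i).filter (fun k => ¬ cr t k) := by
    simp; omega
  rw [← Finset.card_insert_of_notMem hn]
  apply Finset.card_le_card
  intro k hk
  simp only [Finset.mem_insert, Finset.mem_filter, Finset.mem_Ioc] at hk ⊢
  rcases hk with rfl | hk
  · exact ⟨⟨hli, le_rfl⟩, hh⟩
  · exact ⟨by omega, hk.2⟩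

theorem Cnt_mid {cr : ℕ → ℤ → Prop} {t : ℕ} {l i h : ℤ} (hli : l < i) (hih : i ≤ h)
    (hi : ¬ cr t i) : Cnt cr t i h + 1 ≤ Cnt cr t l h := by
  unfold Cnt
  have hn : i ∉ (Finset.Ioc i h).filter (fun k => ¬ cr t k) := by
    simp
  rw [← Finset.card_insert_of_notMem hn]
  apply Finset.card_le_card
  intro k hk
  simp only [Finset.mem_insert, Finset.mem_filter, Finset.mem_Ioc] at hk ⊢
  rcases hk with rfl | hk
  · exact ⟨⟨hli, hih⟩, hi⟩
  · exact ⟨by omega, hk.2⟩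

theorem Cnt_refl {cr : ℕ → ℤ → Prop} {t : ℕ} {l h : ℤ} (hlh : l < h)
    (hl : ¬ cr t l) (hh : ¬ cr t h) :
    Cnt (fun t k => cr t (-k)) t (-h) (-l) ≤ Cnt cr t l h := by
  have e1 : Cnt (fun t k => cr t (-k)) t (-h) (-l) =
      ((Finset.Ico l h).filter (fun k => ¬ cr t k)).card := by
    unfold Cnt
    apply Finset.card_bij (fun k _ => -k)
    · intro k hk
      simp only [Finset.mem_filter, Finset.mem_Ioc, Finset.mem_Ico] at hk ⊢
      exact ⟨by omega, hk.2⟩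
    · intro a _ b _ hab
      omega
    · intro k hk
      simp only [Finset.mem_filter, Finset.mem_Ioc, Finset.mem_Ico] at hk ⊢
      exact ⟨-k, ⟨by omega, by simpa using hk.2⟩, by omega⟩
  have e2 : ((Finset.Ico l h).filter (fun k => ¬ cr t k)).card =
      ((Finset.Ioo l h).filter (fun k => ¬ cr t k)).card + 1 := by
    rw [← Finset.card_insert_of_notMem
      (show l ∉ (Finset.Ioo l h).filter (fun k => ¬ cr t k) by simp)]
    congr 1
    ext k
    simp only [Finset.mem_insert, Finset.mem_filter, Finset.mem_Ioo, Finset.mem_Ico]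
    constructor
    · rintro ⟨h1, h2⟩
      by_cases hk : k = l
      · exact Or.inl hk
      · exact Or.inr ⟨by omega, h2⟩
    · rintro (rfl | ⟨h1, h2⟩)
      · exact ⟨by omega, hl⟩
      · exact ⟨by omega, h2⟩
  have e3 : Cnt cr t l h =
      ((Finset.Ioo l h).filter (fun k => ¬ cr t k)).card + 1 := by
    unfold Cnt
    rw [← Finset.card_insert_of_notMem
      (show h ∉ (Finset.Ioo l h).filter (fun k => ¬ cr t k) by simp)]
    congr 1
    ext k
    simp only [Finset.mem_insert, Finset.mem_filter, Finset.mem_Ioo, Finset.mem_Ioc]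
    constructor
    · rintro ⟨h1, h2⟩
      by_cases hk : k = h
      · exact Or.inl hk
      · exact Or.inr ⟨by omega, h2⟩
    · rintro (rfl | ⟨h1, h2⟩)
      · exact ⟨by omega, hh⟩
      · exact ⟨by omega, h2⟩
  omega

/-- Hypotheses of the left machine. -/
structure LCtx (ρ : ℝ) (N m : ℕ) (K ε L : ℝ) (x : ℕ → ℤ → ℝ) (cr : ℕ → ℤ → Prop)
    (a b : ℕ) (l : ℤ) (g : ℕ) (c : ℕ → ℕ) : Prop where
  hρ : 0 < ρ
  hρ1 : ρ ≤ 1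
  hε : 0 < ε
  hL : 1 ≤ L
  hlog : Real.log ε = -L
  T : Twist ρ x cr
  hU : UU ρ N m K
  hK : 0 ≤ K
  hN : g + 1 ≤ N
  hg : 1 ≤ g
  hl : ∀ t, a ≤ t → t < b → ¬ cr t l
  hh : ∀ t, a ≤ t → t < b → ¬ cr t (l + (g + 1 : ℕ))
  hm : ∀ t, a ≤ t → t < b → Cnt cr t l (l + (g + 1 : ℕ)) ≤ m + 1
  diam : x a (l + (g + 1 : ℕ)) - x a (l + 1) ≤ 1
  mach : ∀ t, a ≤ t → t < b → MStep cr (fun e => l + 1 + ((e % g : ℕ) : ℤ)) c t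

noncomputable def Epi (x : ℕ → ℤ → ℝ) (cr : ℕ → ℤ → Prop) (ε : ℝ) (l : ℤ) (g : ℕ) (c : ℕ → ℕ)
    (s f v : ℕ) : Finset ℕ :=
  (Finset.Ico s f).filter (fun t => c t = v ∧ ¬ cr t (l + 1 + ((c t % g : ℕ) : ℤ)) ∧
    Lng x cr ε t l (l + 1 + ((c t % g : ℕ) : ℤ)))

theorem co_nonneg {ρ : ℝ} (h : 0 < ρ) (m n : ℕ) : 0 ≤ co ρ m n := by
  unfold co; positivity

theorem LCtx.D_le {ρ : ℝ} {N m : ℕ} {K ε L : ℝ} {x : ℕ → ℤ → ℝ} {cr : ℕ → ℤ → Prop}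
    {a b : ℕ} {l : ℤ} {g : ℕ} {c : ℕ → ℕ} (C : LCtx ρ N m K ε L x cr a b l g c)
    {s t : ℕ} (has : a ≤ s) (hst : s ≤ t) (htb : t ≤ b) :
    x t (l + (g + 1 : ℕ)) - x t (l + 1) ≤ x s (l + (g + 1 : ℕ)) - x s (l + 1) := by
  have h1 := top_anti C.T C.hh s has t hst htb
  have h2 := bot_mono C.T C.hl s has t hst htb
  linarith

theorem episode {ρ : ℝ} {N m : ℕ} {K ε L : ℝ} {x : ℕ → ℤ → ℝ} {cr : ℕ → ℤ → Prop}
    {a b : ℕ} {l : ℤ} {g : ℕ} {c : ℕ → ℕ} (C : LCtx ρ N m K ε L x cr a b l g c)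
    {s f e : ℕ} (has : a ≤ s) (hfb : f ≤ b) (he : e < g) (hcs : c s % g = 0) :
    Epi x cr ε l g c s f (c s + e) = ∅ ∨ ∃ p q, s ≤ p ∧ p < q ∧ q ≤ f ∧ c q = c s + e ∧
      ((Epi x cr ε l g c s f (c s + e)).card : ℝ) * L ≤ L ^ m * (co ρ m (e + 1) *
      (psi ε (x p (l + 1 + e) - x p (l + 1)) - psi ε (x q (l + 1 + e) - x q (l + 1))) + K) := by
  have hmod : (c s + e) % g = e := by
    rw [Nat.add_mod, hcs, zero_add, Nat.mod_mod, Nat.mod_eq_of_lt he]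
  have hmach : ∀ t, s ≤ t → t < f → MStep cr (fun e => l + 1 + ((e % g : ℕ) : ℤ)) c t :=
    fun t h1 h2 => C.mach t (by omega) (by omega)
  have hA : ∀ t, s ≤ t → t + 1 ≤ f → c (t + 1) = c t →
      ¬ cr t (l + 1 + ((c t % g : ℕ) : ℤ)) := by
    intro t h1 h2 h3
    rcases hmach t h1 (by omega) with h | h
    · omega
    · exact h.1
  rcases fiber_interval (Q := fun t => Lng x cr ε t l (l + 1 + ((c t % g : ℕ) : ℤ)))
    (mach_mono hmach) hA (c s + e) with h | ⟨p, q, h1, h2, h3, h4, h5⟩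
  · exact Or.inl h
  right
  have hlast : c q = c s + e := by
    obtain ⟨q', rfl⟩ : ∃ q', q = q' + 1 := ⟨q - 1, by omega⟩
    obtain ⟨k1, k2⟩ := h4 q' (by omega) (by omega)
    rcases hmach q' (by omega) (by omega) with h | h
    · exact absurd h.1 k2
    · omega
  refine ⟨p, q, h1, h2, h3, hlast, ?_⟩
  have heq : l + ((e + 1 : ℕ) : ℤ) = l + 1 + e := by push_cast; ring
  have hunc : ∀ t, p ≤ t → t < q → ¬ cr t (l + 1 + e) := by
    intro t k1 k2
    have := h4 t k1 k2
    rw [this.1, hmod] at this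
    exact this.2
  have key := C.hU ε L C.hε C.hL C.hlog x cr C.T p q l (e + 1) h2.le (by omega)
    (by have := C.hN; omega) (by
      intro t k1 k2
      rw [heq]
      refine ⟨C.hl t (by omega) (by omega), hunc t k1 k2, ?_⟩
      have w1 := C.hm t (by omega) (by omega)
      have w2 := @Cnt_left cr t l (l + 1 + e) (l + (g + 1 : ℕ)) (by push_cast; omega)
        (by push_cast; omega) (C.hh t (by omega) (by omega))
      omega) (by
      have w1 := C.D_le le_rfl (show a ≤ p by omega) (by omega)
      have w2 := C.T.mono p (show l + ((e + 1 : ℕ) : ℤ) ≤ l + (g + 1 : ℕ) by push_cast; omega)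
      have := C.diam
      linarith)
  rw [heq] at key
  refine le_trans ?_ key
  have hL := C.hL
  apply mul_le_mul_of_nonneg_right _ (by linarith)
  norm_cast
  unfold Nc
  apply Finset.card_le_card
  refine h5.trans ?_
  intro t ht
  rw [Finset.mem_filter, Finset.mem_Ico] at ht ⊢
  refine ⟨ht.1, ?_⟩
  have := (h4 t ht.1.1 ht.1.2).1
  rw [this, hmod] at ht
  exact ht.2
end


section
open scoped Classical

theorem co_le {ρ : ℝ} (h : 0 < ρ) (h1 : ρ ≤ 1) {m n N : ℕ} (hn : n ≤ N) :
    co ρ m n ≤ (10 * (N : ℝ)) ^ m * (1 / ρ) ^ N := by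
  unfold co
  have hr : 1 ≤ 1 / ρ := by rw [le_div_iff₀ h]; linarith
  have hnN : (n : ℝ) ≤ N := by exact_mod_cast hn
  apply mul_le_mul
  · gcongr
  · exact pow_le_pow_right₀ hr (by omega)
  · positivity
  · positivity

theorem contr_base {ρ : ℝ} {N m : ℕ} {K ε L : ℝ} {x : ℕ → ℤ → ℝ} {cr : ℕ → ℤ → Prop}
    {a b : ℕ} {l : ℤ} {g : ℕ} {c : ℕ → ℕ} (C : LCtx ρ N m K ε L x cr a b l g c)
    {s f : ℕ} (has : a ≤ s) (hsf : s ≤ f) (hfb : f ≤ b) (hcs : c s % g = 0)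
    (hlt : ∀ t, s ≤ t → t < f → c t < c s + g) (hcf : c f = c s + g)
    {q e : ℕ} (hsq : s ≤ q) (hqf : q ≤ f) (hcq : c q = c s + e) :
    x f (l + (g + 1 : ℕ)) - x f (l + 1) ≤ x s (l + (g + 1 : ℕ)) - x s (l + 1)
      - ρ ^ (g - e) * (x s (l + (g + 1 : ℕ)) - x q (l + 1 + e)) := by
  have heg : e ≤ g := by
    have := mach_mono C.mach q (by omega) f hqf hfb
    omega
  have hQ0 : 0 ≤ x s (l + (g + 1 : ℕ)) - x q (l + 1 + e) := by
    have h1 := top_anti C.T C.hh s has q hsq (by omega)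
    have h2 := C.T.mono q (show l + 1 + (e : ℤ) ≤ l + (g + 1 : ℕ) by push_cast; omega)
    linarith
  obtain ⟨e', k1, k2, k3⟩ := infect C.T C.hρ C.hρ1 (l := l) (g := g) (s := s) (f := f) (c := c)
    (fun t h1 h2 => C.hh t (by omega) (by omega)) (fun t h1 h2 => C.mach t (by omega) (by omega))
    hcs hlt hsq hcq hQ0 le_rfl f hqf le_rfl
  obtain rfl : e' = g := by omega
  have h3 := bot_mono C.T C.hl s has f hsf hfb
  rw [show l + 1 + (e' : ℤ) = l + (e' + 1 : ℕ) by push_cast; ring] at k3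
  linarith

theorem log_base {ρ : ℝ} {N m : ℕ} {K ε L : ℝ} {x : ℕ → ℤ → ℝ} {cr : ℕ → ℤ → Prop}
    {a b : ℕ} {l : ℤ} {g : ℕ} {c : ℕ → ℕ} (C : LCtx ρ N m K ε L x cr a b l g c)
    {s f : ℕ} (has : a ≤ s) (hsf : s ≤ f) (hfb : f ≤ b) (hcs : c s % g = 0)
    (hlt : ∀ t, s ≤ t → t < f → c t < c s + g) (hcf : c f = c s + g)
    (hD : 0 < x f (l + (g + 1 : ℕ)) - x f (l + 1)) :
    1 ≤ (1 / ρ) ^ g * (Real.log (x s (l + (g + 1 : ℕ)) - x s (l + 1)) -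
      Real.log (x f (l + (g + 1 : ℕ)) - x f (l + 1))) := by
  have h := contr_base C has hsf hfb hcs hlt hcf le_rfl hsf (e := 0) rfl
  have hDs := C.D_le has hsf hfb
  simp only [Nat.cast_zero, add_zero, Nat.sub_zero] at h
  set A := x s (l + (g + 1 : ℕ)) - x s (l + 1)
  set B := x f (l + (g + 1 : ℕ)) - x f (l + 1)
  have hA : 0 < A := by linarith
  have h2 : Real.log (B / A) ≤ B / A - 1 := Real.log_le_sub_one_of_pos (by positivity)
  rw [Real.log_div hD.ne' hA.ne'] at h2
  have h3 : B / A ≤ 1 - ρ ^ g := by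
    rw [div_le_iff₀ hA]; linarith
  have hp : 0 < ρ ^ g := pow_pos C.hρ g
  rw [one_div, inv_pow, ← div_eq_inv_mul, le_div_iff₀ hp]
  linarith

theorem log_contr {ρ : ℝ} {N m : ℕ} {K ε L : ℝ} {x : ℕ → ℤ → ℝ} {cr : ℕ → ℤ → Prop}
    {a b : ℕ} {l : ℤ} {g : ℕ} {c : ℕ → ℕ} (C : LCtx ρ N m K ε L x cr a b l g c)
    {s f : ℕ} (has : a ≤ s) (hsf : s ≤ f) (hfb : f ≤ b) (hcs : c s % g = 0)
    (hlt : ∀ t, s ≤ t → t < f → c t < c s + g) (hcf : c f = c s + g)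
    (hD : 0 < x f (l + (g + 1 : ℕ)) - x f (l + 1))
    {q e : ℕ} (hsq : s ≤ q) (hqf : q ≤ f) (hcq : c q = c s + e)
    (hsmall : x q (l + 1 + e) - x q (l + 1) ≤ (x s (l + (g + 1 : ℕ)) - x s (l + 1)) / 4) :
    1 ≤ 4 * (1 / ρ) ^ (g - e) * (Real.log (x s (l + (g + 1 : ℕ)) - x s (l + 1)) -
      Real.log (x f (l + (g + 1 : ℕ)) - x f (l + 1))) := by
  have h := contr_base C has hsf hfb hcs hlt hcf hsq hqf hcq
  have hDs := C.D_le has hsf hfb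
  have b1 := bot_mono C.T C.hl q (by omega) f hqf hfb
  have b2 := top_anti C.T C.hh s has f hsf hfb
  set A := x s (l + (g + 1 : ℕ)) - x s (l + 1) with hA'
  set B := x f (l + (g + 1 : ℕ)) - x f (l + 1) with hB'
  have hA : 0 < A := by linarith
  have hp : 0 < ρ ^ (g - e) := pow_pos C.hρ _
  have hp1 : ρ ^ (g - e) ≤ 1 := pow_le_one₀ C.hρ.le C.hρ1
  set r := ρ ^ (g - e)
  have hQ : B - A / 4 ≤ x s (l + (g + 1 : ℕ)) - x q (l + 1 + e) := by linarith
  have h' : B ≤ A - r * (B - A / 4) := by nlinarith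
  have h2 : Real.log (B / A) ≤ B / A - 1 := Real.log_le_sub_one_of_pos (by positivity)
  rw [Real.log_div hD.ne' hA.ne'] at h2
  have h3 : B / A ≤ 1 - r / 4 := by
    rw [div_le_iff₀ hA]
    by_contra hcon
    push Not at hcon
    nlinarith [mul_pos hp hA, mul_nonneg hp.le (sub_nonneg.2 hp1), mul_pos hp hp, mul_nonneg (mul_nonneg hp.le (sub_nonneg.2 hp1)) hA.le]
  rw [one_div, inv_pow, mul_assoc, ← div_eq_inv_mul, ← mul_div_assoc, le_div_iff₀ hp]
  linarith

theorem epi_any {ρ : ℝ} {N m : ℕ} {K ε L : ℝ} {x : ℕ → ℤ → ℝ} {cr : ℕ → ℤ → Prop}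
    {a b : ℕ} {l : ℤ} {g : ℕ} {c : ℕ → ℕ} (C : LCtx ρ N m K ε L x cr a b l g c)
    {s f e : ℕ} (has : a ≤ s) (hfb : f ≤ b) (he : e < g) (hcs : c s % g = 0) :
    ((Epi x cr ε l g c s f (c s + e)).card : ℝ) * L ≤ L ^ m * (co ρ m (e + 1) * L + K) := by
  have hL := C.hL
  have hco := co_nonneg C.hρ m (e + 1)
  have hK := C.hK
  rcases episode C has hfb he hcs with h | ⟨p, q, h1, h2, h3, h4, h5⟩
  · rw [h]
    simp only [Finset.card_empty, Nat.cast_zero, zero_mul]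
    positivity
  · refine h5.trans ?_
    have w1 := psi_lower (d := x q (l + 1 + e) - x q (l + 1)) C.hε
    have w2 : psi ε (x p (l + 1 + e) - x p (l + 1)) ≤ 0 := by
      refine psi_upper C.hε (by rw [C.hlog]; linarith) ?_
      have w1 := C.D_le le_rfl (show a ≤ p by omega) (by omega)
      have w2 := C.T.mono p (show l + 1 + (e : ℤ) ≤ l + (g + 1 : ℕ) by push_cast; omega)
      have := C.diam
      linarith
    rw [C.hlog] at w1
    gcongr
    linarith

theorem epi_full {ρ : ℝ} {N m : ℕ} {K ε L : ℝ} {x : ℕ → ℤ → ℝ} {cr : ℕ → ℤ → Prop}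
    {a b : ℕ} {l : ℤ} {g : ℕ} {c : ℕ → ℕ} (C : LCtx ρ N m K ε L x cr a b l g c)
    {s f e : ℕ} (has : a ≤ s) (hsf : s ≤ f) (hfb : f ≤ b) (he : e < g) (hcs : c s % g = 0)
    (hlt : ∀ t, s ≤ t → t < f → c t < c s + g) (hcf : c f = c s + g)
    (hD : 0 < x f (l + (g + 1 : ℕ)) - x f (l + 1)) {Λ : ℝ}
    (hΛ : Λ = Real.log (x s (l + (g + 1 : ℕ)) - x s (l + 1)) -
      Real.log (x f (l + (g + 1 : ℕ)) - x f (l + 1))) :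
    ((Epi x cr ε l g c s f (c s + e)).card : ℝ) * L ≤ L ^ m *
      (co ρ m (e + 1) * L * (4 * (1 / ρ) ^ (g - e) * Λ) + (2 * co ρ m (e + 1) + K)) := by
  have hL := C.hL
  have hρ := C.hρ
  have hco := co_nonneg C.hρ m (e + 1)
  have hK := C.hK
  have hΛ0 : 0 ≤ Λ := by
    rw [hΛ]
    have := Real.log_le_log hD (C.D_le has hsf hfb)
    linarith
  have hany := epi_any C has hfb he hcs
  rcases episode C has hfb he hcs with h | ⟨p, q, h1, h2, h3, h4, h5⟩
  · rw [h]
    simp only [Finset.card_empty, Nat.cast_zero, zero_mul]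
    positivity
  · by_cases hsm : x q (l + 1 + e) - x q (l + 1) ≤ (x s (l + (g + 1 : ℕ)) - x s (l + 1)) / 4
    · have := log_contr C has hsf hfb hcs hlt hcf hD (by omega) h3 h4 hsm
      rw [← hΛ] at this
      refine hany.trans ?_
      have : co ρ m (e + 1) * L * 1 ≤ co ρ m (e + 1) * L * (4 * (1 / ρ) ^ (g - e) * Λ) := by
        gcongr
      refine mul_le_mul_of_nonneg_left ?_ (by positivity)
      linarith
    · push Not at hsm
      refine h5.trans ?_
      have w1 := C.D_le has h1 (by omega)
      have w2 := C.T.mono p (show l + 1 + (e : ℤ) ≤ l + (g + 1 : ℕ) by push_cast; omega)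
      have w := psi_four (d := x p (l + 1 + e) - x p (l + 1)) (d' := x q (l + 1 + e) - x q (l + 1))
        C.hε (by linarith)
      have w' := mul_le_mul_of_nonneg_left w hco
      have : 0 ≤ co ρ m (e + 1) * L * (4 * (1 / ρ) ^ (g - e) * Λ) := by positivity
      refine mul_le_mul_of_nonneg_left ?_ (by positivity)
      linarith

noncomputable def AL (x : ℕ → ℤ → ℝ) (cr : ℕ → ℤ → Prop) (ε : ℝ) (l : ℤ) (g : ℕ) (c : ℕ → ℕ)
    (s f : ℕ) : Finset ℕ :=
  (Finset.Ico s f).filter (fun t => ¬ cr t (l + 1 + ((c t % g : ℕ) : ℤ)) ∧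
    Lng x cr ε t l (l + 1 + ((c t % g : ℕ) : ℤ)))

theorem AL_le {x : ℕ → ℤ → ℝ} {cr : ℕ → ℤ → Prop} {ε : ℝ} {l : ℤ} {g : ℕ} {c : ℕ → ℕ}
    {s f : ℕ} (hlt : ∀ t, s ≤ t → t < f → c s ≤ c t ∧ c t < c s + g) :
    (AL x cr ε l g c s f).card ≤ ∑ e ∈ Finset.range g, (Epi x cr ε l g c s f (c s + e)).card := by
  refine le_trans (Finset.card_le_card ?_) Finset.card_biUnion_le
  intro t ht
  unfold AL at ht
  rw [Finset.mem_filter, Finset.mem_Ico] at ht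
  obtain ⟨h1, h2⟩ := hlt t ht.1.1 ht.1.2
  rw [Finset.mem_biUnion]
  refine ⟨c t - c s, Finset.mem_range.2 (by omega), ?_⟩
  unfold Epi
  rw [Finset.mem_filter, Finset.mem_Ico]
  exact ⟨ht.1, by omega, ht.2⟩

theorem left_main {ρ : ℝ} {N m : ℕ} {K ε L : ℝ} {x : ℕ → ℤ → ℝ} {cr : ℕ → ℤ → Prop}
    {a b : ℕ} {l : ℤ} {g : ℕ} {c : ℕ → ℕ} (C : LCtx ρ N m K ε L x cr a b l g c)
    (hD : 0 < x b (l + (g + 1 : ℕ)) - x b (l + 1)) {CO : ℝ}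
    (hCO : CO = (10 * (N : ℝ)) ^ m * (1 / ρ) ^ N) :
    ∀ k s, b - s = k → a ≤ s → s ≤ b → c s % g = 0 →
    ((AL x cr ε l g c s b).card : ℝ) * L ≤ L ^ m *
      ((4 * g * (10 * (g + 1 : ℕ)) ^ m * (1 / ρ) ^ g * L + g * (2 * CO + K) * (1 / ρ) ^ g) *
        (Real.log (x s (l + (g + 1 : ℕ)) - x s (l + 1)) -
          Real.log (x b (l + (g + 1 : ℕ)) - x b (l + 1))) + g * (CO * L + K)) ∧
    (c b : ℝ) - c s ≤ g * (1 / ρ) ^ g * (Real.log (x s (l + (g + 1 : ℕ)) - x s (l + 1)) -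
          Real.log (x b (l + (g + 1 : ℕ)) - x b (l + 1))) + g := by
  intro k
  induction k using Nat.strong_induction_on with
  | _ k ih =>
  intro s hk has hsb hcs
  have hL := C.hL
  have hρ := C.hρ
  have hK := C.hK
  have hN := C.hN
  have hCO0 : 0 ≤ CO := by rw [hCO]; positivity
  have hcole : ∀ e, e < g → co ρ m (e + 1) ≤ CO := by
    intro e he
    rw [hCO]
    exact co_le C.hρ C.hρ1 (by omega)
  have hmn := mach_mono C.mach
  by_cases hex : ∃ f, s ≤ f ∧ f ≤ b ∧ c s + g ≤ c f
  · have hf := Nat.find_spec hex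
    have hfm : ∀ t, t < Nat.find hex → ¬ (s ≤ t ∧ t ≤ b ∧ c s + g ≤ c t) :=
      fun t ht => Nat.find_min hex ht
    set f := Nat.find hex
    obtain ⟨f1, f2, f3⟩ := hf
    have hg := C.hg
    have hsf : s < f := by
      rcases Nat.lt_or_ge s f with h | h
      · exact h
      · have : f = s := by omega
        rw [this] at f3
        omega
    have hlt : ∀ t, s ≤ t → t < f → c t < c s + g := by
      intro t h1 h2
      have := hfm t h2
      by_contra hh
      exact this ⟨h1, by omega, by omega⟩
    have hcf : c f = c s + g := by
      obtain ⟨f', hf'⟩ : ∃ f', f = f' + 1 := ⟨f - 1, by omega⟩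
      have w := hlt f' (by omega) (by omega)
      rw [hf'] at f3 ⊢
      rcases C.mach f' (by omega) (by omega) with h | h <;> omega
    have hDf : 0 < x f (l + (g + 1 : ℕ)) - x f (l + 1) :=
      lt_of_lt_of_le hD (C.D_le (by omega) f2 le_rfl)
    obtain ⟨i1, i2⟩ := ih (b - f) (by omega) f rfl (by omega) f2 (by
      rw [hcf, Nat.add_mod_right, hcs])
    have hbase := log_base C has hsf.le f2 hcs hlt hcf hDf
    have hfull := fun e (he : e < g) => epi_full C has hsf.le f2 he hcs hlt hcf hDf rfl
    set Ds := Real.log (x s (l + (g + 1 : ℕ)) - x s (l + 1))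
    set Df := Real.log (x f (l + (g + 1 : ℕ)) - x f (l + 1))
    set Db := Real.log (x b (l + (g + 1 : ℕ)) - x b (l + 1))
    have hΛ0 : 0 ≤ Ds - Df := by
      have := Real.log_le_log hDf (C.D_le has hsf.le f2)
      linarith
    constructor
    · have hcard : (AL x cr ε l g c s b).card ≤
          (AL x cr ε l g c s f).card + (AL x cr ε l g c f b).card := by
        refine le_trans (Finset.card_le_card ?_) (Finset.card_union_le _ _)
        intro t ht
        simp only [AL, Finset.mem_filter, Finset.mem_Ico, Finset.mem_union] at ht ⊢
        by_cases htf : t < f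
        · exact Or.inl ⟨⟨ht.1.1, htf⟩, ht.2⟩
        · exact Or.inr ⟨⟨by omega, ht.1.2⟩, ht.2⟩
      have hcard' : ((AL x cr ε l g c s b).card : ℝ) ≤
          (AL x cr ε l g c s f).card + (AL x cr ε l g c f b).card := by exact_mod_cast hcard
      have hsum : ((AL x cr ε l g c s f).card : ℝ) ≤
          ∑ e ∈ Finset.range g, ((Epi x cr ε l g c s f (c s + e)).card : ℝ) := by
        exact_mod_cast AL_le (fun t h1 h2 => ⟨hmn s has t h1 (by omega), hlt t h1 h2⟩)
      have hterm : ∀ e ∈ Finset.range g, ((Epi x cr ε l g c s f (c s + e)).card : ℝ) * L ≤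
          L ^ m * ((4 * (10 * (g + 1 : ℕ)) ^ m * (1 / ρ) ^ g * L +
            (2 * CO + K) * (1 / ρ) ^ g) * (Ds - Df)) := by
        intro e he
        rw [Finset.mem_range] at he
        refine (hfull e he).trans ?_
        have e1 : co ρ m (e + 1) * (1 / ρ) ^ (g - e) ≤ (10 * (g + 1 : ℕ)) ^ m * (1 / ρ) ^ g := by
          unfold co
          rw [mul_assoc, ← pow_add, show e + 1 - 1 + (g - e) = g by omega]
          have : ((e + 1 : ℕ) : ℝ) ≤ (g + 1 : ℕ) := by exact_mod_cast (by omega)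
          gcongr
        have e2 := hcole e he
        have e3 : (2 * CO + K) * 1 ≤ (2 * CO + K) * ((1 / ρ) ^ g * (Ds - Df)) := by gcongr
        have e4 : co ρ m (e + 1) * (1 / ρ) ^ (g - e) * (4 * L * (Ds - Df)) ≤
          (10 * (g + 1 : ℕ)) ^ m * (1 / ρ) ^ g * (4 * L * (Ds - Df)) := by gcongr
        have hLm : 0 ≤ L ^ m := by positivity
        apply mul_le_mul_of_nonneg_left _ hLm
        linarith
      have htot : ((AL x cr ε l g c s f).card : ℝ) * L ≤ g *
          (L ^ m * ((4 * (10 * (g + 1 : ℕ)) ^ m * (1 / ρ) ^ g * L +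
            (2 * CO + K) * (1 / ρ) ^ g) * (Ds - Df))) := by
        calc ((AL x cr ε l g c s f).card : ℝ) * L ≤
            (∑ e ∈ Finset.range g, ((Epi x cr ε l g c s f (c s + e)).card : ℝ)) * L := by gcongr
          _ = ∑ e ∈ Finset.range g, ((Epi x cr ε l g c s f (c s + e)).card : ℝ) * L := by
            rw [Finset.sum_mul]
          _ ≤ _ := by
            have := Finset.sum_le_sum hterm
            simpa using this
      have := mul_le_mul_of_nonneg_right hcard' (show 0 ≤ L by linarith)
      rw [add_mul] at this
      refine this.trans ((add_le_add htot i1).trans (le_of_eq ?_))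
      ring
    · have hcf' : (c f : ℝ) = c s + g := by exact_mod_cast hcf
      have : (g : ℝ) * 1 ≤ g * ((1 / ρ) ^ g * (Ds - Df)) := by gcongr
      linarith
  · push Not at hex
    have hlt : ∀ t, s ≤ t → t ≤ b → c t < c s + g := hex
    have hΛ0 : 0 ≤ Real.log (x s (l + (g + 1 : ℕ)) - x s (l + 1)) -
        Real.log (x b (l + (g + 1 : ℕ)) - x b (l + 1)) := by
      have := Real.log_le_log hD (C.D_le has hsb le_rfl)
      linarith
    set Λ := Real.log (x s (l + (g + 1 : ℕ)) - x s (l + 1)) -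
        Real.log (x b (l + (g + 1 : ℕ)) - x b (l + 1))
    constructor
    · have hsum : ((AL x cr ε l g c s b).card : ℝ) ≤
          ∑ e ∈ Finset.range g, ((Epi x cr ε l g c s b (c s + e)).card : ℝ) := by
        exact_mod_cast AL_le (fun t h1 h2 => ⟨hmn s has t h1 (by omega), hlt t h1 (by omega)⟩)
      have hterm : ∀ e ∈ Finset.range g, ((Epi x cr ε l g c s b (c s + e)).card : ℝ) * L ≤
          L ^ m * (CO * L + K) := by
        intro e he
        rw [Finset.mem_range] at he
        refine (epi_any C has le_rfl he hcs).trans ?_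
        have := hcole e he
        gcongr
      have htot : ((AL x cr ε l g c s b).card : ℝ) * L ≤ g * (L ^ m * (CO * L + K)) := by
        calc ((AL x cr ε l g c s b).card : ℝ) * L ≤
            (∑ e ∈ Finset.range g, ((Epi x cr ε l g c s b (c s + e)).card : ℝ)) * L := by gcongr
          _ = ∑ e ∈ Finset.range g, ((Epi x cr ε l g c s b (c s + e)).card : ℝ) * L := by
            rw [Finset.sum_mul]
          _ ≤ _ := by
            have := Finset.sum_le_sum hterm
            simpa using this
      refine htot.trans ?_
      have : 0 ≤ L ^ m * ((4 * g * (10 * (g + 1 : ℕ)) ^ m * (1 / ρ) ^ g * L +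
        g * (2 * CO + K) * (1 / ρ) ^ g) * Λ) := by positivity
      linarith
    · have h1 : (c b : ℝ) < c s + g := by exact_mod_cast hlt b hsb le_rfl
      have : 0 ≤ g * (1 / ρ) ^ g * Λ := by positivity
      linarith
end


section
open scoped Classical

theorem cross_card {cr : ℕ → ℤ → Prop} {γ : ℕ → ℤ} {c : ℕ → ℕ} {a b : ℕ} (hab : a ≤ b)
    (hc : ∀ t, a ≤ t → t < b → MStep cr γ c t) :
    ((Finset.Ico a b).filter (fun t => cr t (γ (c t)))).card + c a ≤ c b := by
  induction b, hab using Nat.le_induction with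
  | base => simp
  | succ b hab ih =>
    have h := ih (fun t h1 h2 => hc t h1 (by omega))
    rw [show Finset.Ico a (b + 1) = insert b (Finset.Ico a b) from Nat.Ico_succ_right_eq_insert_Ico hab, Finset.filter_insert]
    rcases hc b hab (by omega) with ⟨h1, h2⟩ | ⟨h1, h2⟩
    · rw [if_pos h1]
      have := Finset.card_insert_le b ((Finset.Ico a b).filter (fun t => cr t (γ (c t))))
      omega
    · rw [if_neg h1]
      omega

theorem mid_main {ρ : ℝ} {N m : ℕ} {Kv ε L : ℝ} {x : ℕ → ℤ → ℝ} {cr cr' : ℕ → ℤ → Prop}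
    {a b : ℕ} {l : ℤ} {g : ℕ} {c c' : ℕ → ℕ} {γ γ' : ℕ → ℤ}
    (hε : 0 < ε) (hL : 1 ≤ L) (hlog : Real.log ε = -L)
    (hT : Twist ρ x cr) (hV : VV ρ N m Kv) (hKv : 0 ≤ Kv) (hN : g + 1 ≤ N)
    (hl : ∀ t, a ≤ t → t < b → ¬ cr t l)
    (hh : ∀ t, a ≤ t → t < b → ¬ cr t (l + (g + 1 : ℕ)))
    (hm : ∀ t, a ≤ t → t < b → Cnt cr t l (l + (g + 1 : ℕ)) ≤ m + 1)
    (diam : x a (l + (g + 1 : ℕ)) - x a (l + 1) ≤ 1)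
    (hmach : ∀ t, a ≤ t → t < b → MStep cr γ c t)
    (hmach' : ∀ t, a ≤ t → t < b → MStep cr' γ' c' t)
    (hcr' : ∀ t k, cr' t k ↔ cr t (-k))
    (hγ : ∀ e, l < γ e) (hγ' : ∀ e, - γ' e < l + (g + 1 : ℕ)) :
    (((Finset.Ico a b).filter (fun t => (¬ cr t (γ (c t)) ∧ ¬ cr' t (γ' (c' t))) ∧
      Lng x cr ε t (γ (c t)) (- γ' (c' t)))).card : ℝ) * L ≤ (c b + c' b + 1) * (Kv * L ^ m) := by
  have mono1 := mach_mono hmach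
  have mono2 := mach_mono hmach'
  have hmono : ∀ p, a ≤ p → ∀ q, p ≤ q → q ≤ b → c p + c' p ≤ c q + c' q := by
    intro p h1 q h2 h3
    exact add_le_add (mono1 p h1 q h2 h3) (mono2 p h1 q h2 h3)
  have hfib : ∀ v, (((Finset.Ico a b).filter (fun t => c t + c' t = v ∧
      (¬ cr t (γ (c t)) ∧ ¬ cr' t (γ' (c' t))) ∧
      Lng x cr ε t (γ (c t)) (- γ' (c' t)))).card : ℝ) * L ≤ Kv * L ^ m := by
    intro v
    rcases fiber_interval (c := fun t => c t + c' t)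
      (A := fun t => ¬ cr t (γ (c t)) ∧ ¬ cr' t (γ' (c' t)))
      (Q := fun t => Lng x cr ε t (γ (c t)) (- γ' (c' t))) hmono (by
        intro t h1 h2 h3
        rcases hmach t h1 (by omega) with h | h
        · rcases hmach' t h1 (by omega) with h' | h'
          · omega
          · omega
        · rcases hmach' t h1 (by omega) with h' | h'
          · omega
          · exact ⟨h.1, h'.1⟩) v with h | ⟨p, q, h1, h2, h3, h4, h5⟩
    · rw [h]
      simp only [Finset.card_empty, Nat.cast_zero, zero_mul]
      positivity
    · have hcc : ∀ t, p ≤ t → t < q → c t = c p ∧ c' t = c' p := by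
        intro t k1 k2
        have w1 := mono1 p h1 t k1 (by omega)
        have w2 := mono2 p h1 t k1 (by omega)
        have w3 := (h4 t k1 k2).1
        have w4 := (h4 p le_rfl h2).1
        omega
      have hsub : ((Finset.Ico a b).filter (fun t => c t + c' t = v ∧
          (¬ cr t (γ (c t)) ∧ ¬ cr' t (γ' (c' t))) ∧
          Lng x cr ε t (γ (c t)) (- γ' (c' t)))) ⊆ (Finset.Ico p q).filter
          (fun t => Lng x cr ε t (γ (c p)) (- γ' (c' p))) := by
        refine h5.trans ?_
        intro t ht
        rw [Finset.mem_filter, Finset.mem_Ico] at ht ⊢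
        obtain ⟨w1, w2⟩ := hcc t ht.1.1 ht.1.2
        rw [w1, w2] at ht
        exact ht
      by_cases hik : γ (c p) < - γ' (c' p)
      · obtain ⟨n, hn⟩ := Int.eq_ofNat_of_zero_le (show 0 ≤ - γ' (c' p) - γ (c p) by omega)
        have hn' : - γ' (c' p) = γ (c p) + n := by omega
        have g1 := hγ (c p)
        have g2 := hγ' (c' p)
        rw [hn'] at hsub
        have key := hV ε L hε hL hlog x cr hT p q (γ (c p)) n h2.le (by omega)
          (by push_cast at g2; omega) (by
            intro t k1 k2
            obtain ⟨w1, w2⟩ := hcc t k1 k2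
            have w3 := (h4 t k1 k2).2
            rw [w1, w2, hcr', hn'] at w3
            refine ⟨w3.1, w3.2, ?_⟩
            have u1 := hm t (by omega) (by omega)
            have u2 := @Cnt_left cr t (γ (c p)) (γ (c p) + n) (l + (g + 1 : ℕ)) (by omega)
              (by omega) (hh t (by omega) (by omega))
            have u3 := @Cnt_mid cr t l (γ (c p)) (l + (g + 1 : ℕ)) g1 (by omega) w3.1
            omega) (by
            have w1 := top_anti hT hh a le_rfl p h1 (by omega)
            have w2 := bot_mono hT hl a le_rfl p h1 (by omega)
            have w3 := hT.mono p (show γ (c p) + n ≤ l + (g + 1 : ℕ) by omega)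
            have w4 := hT.mono p (show l + 1 ≤ γ (c p) + 1 by omega)
            linarith)
        refine le_trans ?_ key
        apply mul_le_mul_of_nonneg_right _ (by linarith)
        norm_cast
        exact Finset.card_le_card hsub
      · have : ((Finset.Ico p q).filter
          (fun t => Lng x cr ε t (γ (c p)) (- γ' (c' p)))) = ∅ := by
          apply Finset.filter_eq_empty_iff.2
          intro t _ H
          exact hik H.lt
        rw [this, Finset.subset_empty] at hsub
        rw [hsub]
        simp only [Finset.card_empty, Nat.cast_zero, zero_mul]
        positivity
  have hle : ((Finset.Ico a b).filter (fun t => (¬ cr t (γ (c t)) ∧ ¬ cr' t (γ' (c' t))) ∧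
      Lng x cr ε t (γ (c t)) (- γ' (c' t)))).card ≤
      ∑ v ∈ Finset.range (c b + c' b + 1), ((Finset.Ico a b).filter (fun t => c t + c' t = v ∧
      (¬ cr t (γ (c t)) ∧ ¬ cr' t (γ' (c' t))) ∧
      Lng x cr ε t (γ (c t)) (- γ' (c' t)))).card := by
    refine le_trans (Finset.card_le_card ?_) Finset.card_biUnion_le
    intro t ht
    rw [Finset.mem_filter, Finset.mem_Ico] at ht
    rw [Finset.mem_biUnion]
    refine ⟨c t + c' t, ?_, ?_⟩
    · have := hmono t ht.1.1 b (by omega) le_rfl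
      rw [Finset.mem_range]
      omega
    · rw [Finset.mem_filter, Finset.mem_Ico]
      exact ⟨ht.1, rfl, ht.2⟩
  have hle' : ((((Finset.Ico a b).filter (fun t => (¬ cr t (γ (c t)) ∧ ¬ cr' t (γ' (c' t))) ∧
      Lng x cr ε t (γ (c t)) (- γ' (c' t)))).card : ℕ) : ℝ) ≤
      ∑ v ∈ Finset.range (c b + c' b + 1), (((Finset.Ico a b).filter (fun t => c t + c' t = v ∧
      (¬ cr t (γ (c t)) ∧ ¬ cr' t (γ' (c' t))) ∧
      Lng x cr ε t (γ (c t)) (- γ' (c' t)))).card : ℝ) := by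
    exact_mod_cast hle
  refine (mul_le_mul_of_nonneg_right hle' (show 0 ≤ L by linarith)).trans ?_
  rw [Finset.sum_mul]
  refine (Finset.sum_le_sum (fun v _ => hfib v)).trans (le_of_eq ?_)
  rw [Finset.sum_const, Finset.card_range, nsmul_eq_mul]
  push_cast
  ring

theorem arith_step {N m g : ℕ} {ρ L Λ K Kv CO n1 n2 n3 n4 n5 c1 c2 T : ℝ}
    (hρ : 0 < ρ) (hρ1 : ρ ≤ 1) (hL : 1 ≤ L) (hΛ : 0 ≤ Λ) (hΛL : Λ ≤ L)
    (hK : 0 ≤ K) (hKv : 0 ≤ Kv) (hCO : 0 ≤ CO) (hgN : g ≤ N)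
    (hT : T ≤ n1 + n2 + n3 + n4 + n5)
    (h1 : n1 ≤ c1) (h2 : n2 ≤ c2)
    (hc1 : c1 ≤ g * (1 / ρ) ^ g * Λ + g) (hc2 : c2 ≤ g * (1 / ρ) ^ g * Λ + g)
    (h3 : n3 * L ≤ L ^ m *
      ((4 * g * (10 * (g + 1 : ℕ)) ^ m * (1 / ρ) ^ g * L + g * (2 * CO + K) * (1 / ρ) ^ g) * Λ
        + g * (CO * L + K)))
    (h4 : n4 * L ≤ L ^ m *
      ((4 * g * (10 * (g + 1 : ℕ)) ^ m * (1 / ρ) ^ g * L + g * (2 * CO + K) * (1 / ρ) ^ g) * Λ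
        + g * (CO * L + K)))
    (h5 : n5 * L ≤ (c1 + c2 + 1) * (Kv * L ^ m)) :
    T * L ≤ L ^ (m + 1) * (co ρ (m + 1) (g + 1) * Λ + (2 * N + 2 * N * (2 * CO + K) * (1 / ρ) ^ N
      + 2 * N * (CO + K) + (2 * N * (1 / ρ) ^ N + 2 * N + 1) * Kv)) := by
  have hr : 1 ≤ 1 / ρ := by rw [le_div_iff₀ hρ]; linarith
  have hgN' : (g : ℝ) ≤ N := by exact_mod_cast hgN
  have hR : (1 / ρ) ^ g ≤ (1 / ρ) ^ N := pow_le_pow_right₀ hr hgN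
  have hR0 : 1 ≤ (1 / ρ) ^ g := one_le_pow₀ hr
  have hLm : 1 ≤ L ^ m := one_le_pow₀ hL
  unfold co
  rw [Nat.add_sub_cancel, pow_succ (10 * ((g + 1 : ℕ) : ℝ)) m, pow_succ L m]
  set P := (10 * ((g + 1 : ℕ) : ℝ)) ^ m with hP
  have hP1 : 1 ≤ P := by
    apply one_le_pow₀
    push_cast
    have : (0 : ℝ) ≤ g := by positivity
    linarith
  set R := (1 / ρ) ^ g
  set RN := (1 / ρ) ^ N
  set M := L ^ m
  have hg0 : (0 : ℝ) ≤ g := by positivity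
  have hL0 : 0 ≤ L := by linarith
  -- crossings
  have s1 : (n1 + n2) * L ≤ M * L * (2 * g * R * Λ * P + 2 * N) := by
    have t1 : n1 + n2 ≤ 2 * g * R * Λ + 2 * g := by linarith
    have t2 : 2 * g * R * Λ + 2 * g ≤ 2 * g * R * Λ * P + 2 * N := by
      have : 2 * g * R * Λ * 1 ≤ 2 * g * R * Λ * P := by gcongr
      linarith
    have t3 : 0 ≤ 2 * g * R * Λ * P + 2 * N := by positivity
    calc (n1 + n2) * L ≤ (2 * g * R * Λ * P + 2 * N) * L :=
          mul_le_mul_of_nonneg_right (by linarith) hL0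
      _ = 1 * ((2 * g * R * Λ * P + 2 * N) * L) := by ring
      _ ≤ M * ((2 * g * R * Λ * P + 2 * N) * L) := by gcongr
      _ = _ := by ring
  have s2 : M * ((4 * g * P * R * L + g * (2 * CO + K) * R) * Λ + g * (CO * L + K)) ≤
      M * L * (4 * g * P * R * Λ + N * (2 * CO + K) * RN + N * (CO + K)) := by
    have t1 : g * (2 * CO + K) * R * Λ ≤ N * (2 * CO + K) * RN * L := by gcongr
    have t2 : g * (CO * L + K) ≤ N * (CO * L + K * L) := by
      gcongr
      exact le_mul_of_one_le_right hK hL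
    have t3 : ((4 * g * P * R * L + g * (2 * CO + K) * R) * Λ + g * (CO * L + K)) ≤
        L * (4 * g * P * R * Λ + N * (2 * CO + K) * RN + N * (CO + K)) := by linarith
    have t4 := mul_le_mul_of_nonneg_left t3 (show 0 ≤ M by linarith)
    linarith
  have s3 : (c1 + c2 + 1) * (Kv * M) ≤ M * L * ((2 * N * RN + 2 * N + 1) * Kv) := by
    have t1 : c1 + c2 + 1 ≤ 2 * (N * RN * L) + 2 * N + 1 := by
      have : g * R * Λ ≤ N * RN * L := by gcongr
      linarith
    have t2 : 2 * (N * RN * L) + 2 * N + 1 ≤ (2 * N * RN + 2 * N + 1) * L := by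
      have : (2 * (N : ℝ) + 1) * 1 ≤ (2 * N + 1) * L := by gcongr
      linarith
    calc (c1 + c2 + 1) * (Kv * M) ≤ ((2 * N * RN + 2 * N + 1) * L) * (Kv * M) := by
          gcongr; linarith
      _ = _ := by ring
  have s4 : M * L * ((2 * g + 8 * g) * P * R * Λ) ≤ M * L * (P * (10 * ((g + 1 : ℕ) : ℝ)) * R * Λ) := by
    have : (2 * (g : ℝ) + 8 * g) ≤ 10 * ((g + 1 : ℕ) : ℝ) := by push_cast; linarith
    calc M * L * ((2 * g + 8 * g) * P * R * Λ) ≤ M * L * ((10 * ((g + 1 : ℕ) : ℝ)) * P * R * Λ) := by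
          gcongr
      _ = _ := by ring
  have s0 := mul_le_mul_of_nonneg_right hT hL0
  linarith

theorem step0 {ρ : ℝ} {N m : ℕ} {K Kv ε L : ℝ} {x : ℕ → ℤ → ℝ} {cr : ℕ → ℤ → Prop}
    {a b : ℕ} {l : ℤ} {g : ℕ}
    (hρ : 0 < ρ) (hρ1 : ρ ≤ 1)
    (hε : 0 < ε) (hL : 1 ≤ L) (hlog : Real.log ε = -L)
    (hT : Twist ρ x cr) (hU : UU ρ N m K) (hK : 0 ≤ K) (hV : VV ρ N m Kv) (hKv : 0 ≤ Kv)
    (hg : 1 ≤ g) (hN : g + 1 ≤ N) (hab : a ≤ b)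
    (hw : ∀ t, a ≤ t → t < b → ¬ cr t l ∧ ¬ cr t (l + (g + 1 : ℕ)) ∧
      Cnt cr t l (l + (g + 1 : ℕ)) ≤ m + 1)
    (diam : x a (l + (g + 1 : ℕ)) - x a (l + 1) ≤ 1)
    (hD : ε ≤ x b (l + (g + 1 : ℕ)) - x b (l + 1)) {CO : ℝ}
    (hCO : CO = (10 * (N : ℝ)) ^ m * (1 / ρ) ^ N) :
    (Nc x cr ε a b l (l + (g + 1 : ℕ)) : ℝ) * L ≤ L ^ (m + 1) * (co ρ (m + 1) (g + 1) *
      (Real.log (x a (l + (g + 1 : ℕ)) - x a (l + 1)) -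
        Real.log (x b (l + (g + 1 : ℕ)) - x b (l + 1))) +
      (2 * N + 2 * N * (2 * CO + K) * (1 / ρ) ^ N
      + 2 * N * (CO + K) + (2 * N * (1 / ρ) ^ N + 2 * N + 1) * Kv)) := by
  have hD0 : 0 < x b (l + (g + 1 : ℕ)) - x b (l + 1) := lt_of_lt_of_le hε hD
  set x' : ℕ → ℤ → ℝ := fun t k => - x t (1 - k) with hx'
  set cr' : ℕ → ℤ → Prop := fun t k => cr t (-k) with hcr'
  set l' : ℤ := - (l + (g + 1 : ℕ)) with hl'
  have hT' : Twist ρ x' cr' := hT.refl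
  obtain ⟨c, hc0, hcm⟩ := exists_mach cr (fun e => l + 1 + ((e % g : ℕ) : ℤ)) a
  obtain ⟨c', hc0', hcm'⟩ := exists_mach cr' (fun e => l' + 1 + ((e % g : ℕ) : ℤ)) a
  have C : LCtx ρ N m K ε L x cr a b l g c :=
    ⟨hρ, hρ1, hε, hL, hlog, hT, hU, hK, hN, hg, fun t h1 h2 => (hw t h1 h2).1,
      fun t h1 h2 => (hw t h1 h2).2.1, fun t h1 h2 => (hw t h1 h2).2.2, diam,
      fun t h1 _ => hcm t h1⟩
  have el : l' + (g + 1 : ℕ) = -l := by rw [hl']; ring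
  have hdx : ∀ t, x' t (l' + (g + 1 : ℕ)) - x' t (l' + 1) =
      x t (l + (g + 1 : ℕ)) - x t (l + 1) := by
    intro t
    rw [el]
    simp only [hx', hl']
    rw [show (1 : ℤ) - -l = l + 1 by ring,
      show (1 : ℤ) - (-(l + (g + 1 : ℕ)) + 1) = l + (g + 1 : ℕ) by ring]
    ring
  have C' : LCtx ρ N m K ε L x' cr' a b l' g c' := by
    refine ⟨hρ, hρ1, hε, hL, hlog, hT', hU, hK, hN, hg, ?_, ?_, ?_, ?_, fun t h1 _ => hcm' t h1⟩
    · intro t h1 h2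
      simpa [hcr', hl'] using (hw t h1 h2).2.1
    · intro t h1 h2
      rw [el]
      simpa [hcr'] using (hw t h1 h2).1
    · intro t h1 h2
      rw [el]
      obtain ⟨w1, w2, w3⟩ := hw t h1 h2
      exact (Cnt_refl (by push_cast; omega) w1 w2).trans w3
    · rw [hdx]; exact diam
  have r1 := left_main C hD0 hCO _ a rfl le_rfl hab (by rw [hc0]; simp)
  have r2 := left_main C' (by rw [hdx]; exact hD0) hCO _ a rfl le_rfl hab (by rw [hc0']; simp)
  have r3 := mid_main hε hL hlog hT hV hKv hN C.hl C.hh C.hm diam C.mach C'.mach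
    (fun t k => Iff.rfl) (by intro e; omega) (by intro e; rw [hl']; omega)
  have k1 := cross_card hab C.mach
  have k2 := cross_card hab C'.mach
  simp only [hdx] at r2
  rw [hc0, Nat.cast_zero, sub_zero] at r1
  rw [hc0', Nat.cast_zero, sub_zero] at r2
  rw [hc0] at k1
  rw [hc0'] at k2
  have hDa : x b (l + (g + 1 : ℕ)) - x b (l + 1) ≤ x a (l + (g + 1 : ℕ)) - x a (l + 1) :=
    C.D_le le_rfl hab le_rfl
  have q1 := Real.log_le_log hD0 hDa
  have q2 := Real.log_le_log hε hD
  have q3 := Real.log_nonpos (hD0.le.trans hDa) diam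
  rw [hlog] at q2
  refine arith_step (N := N) (m := m) (g := g) hρ hρ1 hL (by linarith) (by linarith) hK hKv
    (by rw [hCO]; positivity) (by omega) ?_ (c1 := c b) (c2 := c' b)
    (n1 := (((Finset.Ico a b).filter
      (fun t => cr t (l + 1 + ((c t % g : ℕ) : ℤ)))).card : ℝ))
    (n2 := (((Finset.Ico a b).filter
      (fun t => cr' t (l' + 1 + ((c' t % g : ℕ) : ℤ)))).card : ℝ))
    (by exact_mod_cast (by simpa using k1)) (by exact_mod_cast (by simpa using k2))
    r1.2 r2.2 r1.1 r2.1 r3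
  norm_cast
  unfold Nc
  refine le_trans (Finset.card_le_card (t := ((((_ ∪ _) ∪ _) ∪ _) ∪ _)) ?_)
    ((Finset.card_union_le _ _).trans (add_le_add_left ((Finset.card_union_le _ _).trans
      (add_le_add_left ((Finset.card_union_le _ _).trans (add_le_add_left
        (Finset.card_union_le _ _) _)) _)) _))
  intro t ht
  simp only [AL, Finset.mem_union, Finset.mem_filter] at ht ⊢
  obtain ⟨h1, h2⟩ := ht
  simp only [h1, true_and]
  by_cases a1 : cr t (l + 1 + ((c t % g : ℕ) : ℤ))
  · exact Or.inl (Or.inl (Or.inl (Or.inl a1)))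
  by_cases a2 : cr' t (l' + 1 + ((c' t % g : ℕ) : ℤ))
  · exact Or.inl (Or.inl (Or.inl (Or.inr a2)))
  simp only [a1, a2, not_false_eq_true, true_and, false_or, and_true]
  rcases h2.split a1 with h | h
  · exact Or.inl (Or.inl h)
  · rcases h.split a2 with h | h
    · exact Or.inr h
    · left; right
      have := h.refl
      rw [neg_neg] at this
      exact this
end


section
open scoped Classical

theorem Nc_zero {x : ℕ → ℤ → ℝ} {cr : ℕ → ℤ → Prop} {ε : ℝ} {a b : ℕ} {l h : ℤ}
    (H : ∀ t, a ≤ t → t < b → ¬ Lng x cr ε t l h) : Nc x cr ε a b l h = 0 := by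
  unfold Nc
  rw [Finset.card_eq_zero, Finset.filter_eq_empty_iff]
  intro t ht
  rw [Finset.mem_Ico] at ht
  exact H t ht.1 ht.2

theorem stepU {ρ : ℝ} {N m : ℕ} {K Kv : ℝ} (hρ : 0 < ρ) (hρ1 : ρ ≤ 1)
    (hU : UU ρ N m K) (hK : 0 ≤ K) (hV : VV ρ N m Kv) (hKv : 0 ≤ Kv) :
    ∃ K', 0 ≤ K' ∧ UU ρ N (m + 1) K' := by
  obtain ⟨CO, hCO⟩ : ∃ CO, CO = (10 * (N : ℝ)) ^ m * (1 / ρ) ^ N := ⟨_, rfl⟩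
  have hCO0 : 0 ≤ CO := by rw [hCO]; positivity
  obtain ⟨Q, hQ⟩ : ∃ Q, Q = (2 * N + 2 * N * (2 * CO + K) * (1 / ρ) ^ N
      + 2 * N * (CO + K) + (2 * N * (1 / ρ) ^ N + 2 * N + 1) * Kv) := ⟨_, rfl⟩
  have hQ0 : 0 ≤ Q := by rw [hQ]; positivity
  refine ⟨Q + 1, by linarith, ?_⟩
  intro ε L hε hL hlog x cr hT a b l n hab hn hnN hw diam
  have hl : ∀ t, a ≤ t → t < b → ¬ cr t l := fun t h1 h2 => (hw t h1 h2).1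
  have hh : ∀ t, a ≤ t → t < b → ¬ cr t (l + n) := fun t h1 h2 => (hw t h1 h2).2.1
  have hD : ∀ s, a ≤ s → ∀ t, s ≤ t → t ≤ b →
      x t (l + n) - x t (l + 1) ≤ x s (l + n) - x s (l + 1) := by
    intro s h1 t h2 h3
    have := top_anti hT hh s h1 t h2 h3
    have := bot_mono hT hl s h1 t h2 h3
    linarith
  have hco := co_nonneg hρ (m + 1) n
  have hLm : (1 : ℝ) ≤ L ^ m := one_le_pow₀ hL
  have hLm' : (1 : ℝ) ≤ L ^ (m + 1) := one_le_pow₀ hL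
  by_cases h0 : ε ≤ x a (l + n) - x a (l + 1)
  swap
  · rw [Nc_zero]
    · have := psi_mono hε (hD a le_rfl b hab le_rfl)
      simp only [Nat.cast_zero, zero_mul]
      have : 0 ≤ co ρ (m + 1) n *
        (psi ε (x a (l + n) - x a (l + 1)) - psi ε (x b (l + n) - x b (l + 1))) :=
        mul_nonneg hco (by linarith)
      positivity
    · intro t h1 h2 H
      have := H.diam (hT.mono t)
      have := hD a le_rfl t h1 h2.le
      linarith
  obtain ⟨g, rfl⟩ : ∃ g, n = g + 1 := ⟨n - 1, by omega⟩
  have hg : 1 ≤ g := by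
    by_contra hg
    have : g = 0 := by omega
    subst this
    simp at h0
    linarith
  set p : ℕ → Prop := fun t => a ≤ t ∧ ε ≤ x t (l + (g + 1 : ℕ)) - x t (l + 1) with hp
  obtain ⟨b', hb'⟩ : ∃ b', b' = Nat.findGreatest p b := ⟨_, rfl⟩
  have pb : p b' := by
    rw [hb']
    exact Nat.findGreatest_spec hab (show p a from ⟨le_rfl, h0⟩)
  have hbb : b' ≤ b := by rw [hb']; exact Nat.findGreatest_le b
  have hmax : ∀ t, a ≤ t → t < b → Lng x cr ε t l (l + (g + 1 : ℕ)) → t ≤ b' := by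
    intro t h1 h2 h3
    rw [hb']
    exact Nat.le_findGreatest h2.le ⟨h1, h3.diam (hT.mono t)⟩
  have key := step0 hρ hρ1 hε hL hlog hT hU hK hV hKv hg hnN pb.1
    (fun t h1 h2 => hw t h1 (by omega)) diam pb.2 hCO
  rw [← hQ] at key
  have e1 : psi ε (x a (l + (g + 1 : ℕ)) - x a (l + 1)) =
      Real.log (x a (l + (g + 1 : ℕ)) - x a (l + 1)) := by
    unfold psi; rw [max_eq_left h0]
  have e2 : psi ε (x b' (l + (g + 1 : ℕ)) - x b' (l + 1)) =
      Real.log (x b' (l + (g + 1 : ℕ)) - x b' (l + 1)) := by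
    unfold psi; rw [max_eq_left pb.2]
  rw [← e1, ← e2] at key
  have q := psi_mono hε (hD b' pb.1 b hbb le_rfl)
  have hN1 : Nc x cr ε a b l (l + (g + 1 : ℕ)) ≤ Nc x cr ε a b' l (l + (g + 1 : ℕ)) + 1 := by
    unfold Nc
    refine le_trans (Finset.card_le_card ?_) (Finset.card_insert_le b' _)
    intro t ht
    rw [Finset.mem_filter, Finset.mem_Ico] at ht
    rw [Finset.mem_insert, Finset.mem_filter, Finset.mem_Ico]
    have := hmax t ht.1.1 ht.1.2 ht.2
    rcases Nat.lt_or_ge t b' with h | h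
    · exact Or.inr ⟨⟨ht.1.1, h⟩, ht.2⟩
    · exact Or.inl (by omega)
  have hN2 : (Nc x cr ε a b l (l + (g + 1 : ℕ)) : ℝ) ≤
      Nc x cr ε a b' l (l + (g + 1 : ℕ)) + 1 := by exact_mod_cast hN1
  have hN3 := mul_le_mul_of_nonneg_right hN2 (show 0 ≤ L by linarith)
  have hLL : L ≤ L ^ (m + 1) := by
    rw [pow_succ]
    exact le_mul_of_one_le_left (by linarith) hLm
  have z1 := mul_le_mul_of_nonneg_left (sub_le_sub_left q
    (psi ε (x a (l + (g + 1 : ℕ)) - x a (l + 1)))) hco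
  have z2 := mul_le_mul_of_nonneg_left z1 (show 0 ≤ L ^ (m + 1) by linarith)
  linarith

theorem stepV {ρ : ℝ} {N m : ℕ} {K : ℝ} (hρ : 0 < ρ) (hρ1 : ρ ≤ 1)
    (hU : UU ρ N m K) (hK : 0 ≤ K) :
    ∃ K', 0 ≤ K' ∧ VV ρ N (m + 1) K' := by
  obtain ⟨CO, hCO⟩ : ∃ CO, CO = (10 * (N : ℝ)) ^ m * (1 / ρ) ^ N := ⟨_, rfl⟩
  have hCO0 : 0 ≤ CO := by rw [hCO]; positivity
  have hr : 1 ≤ 1 / ρ := by rw [le_div_iff₀ hρ]; linarith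
  refine ⟨CO + K, by linarith, ?_⟩
  intro ε L hε hL hlog x cr hT a b l n hab hn hnN hw diam
  have key := hU ε L hε hL hlog x cr hT a b l n hab hn hnN
    (fun t h1 h2 => ⟨(hw t h1 h2).1, (hw t h1 h2).2.1, by have := (hw t h1 h2).2.2; omega⟩) diam
  have h1 := psi_upper hε (by linarith) diam
  have h2 := @psi_lower ε (x b (l + n) - x b (l + 1)) hε
  have h3 : co ρ m n ≤ CO := by
    rw [hCO]; unfold co
    have : (n : ℝ) ≤ N := by exact_mod_cast hnN
    have : (1 / ρ) ^ (n - 1) ≤ (1 / ρ) ^ N := pow_le_pow_right₀ hr (by omega)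
    gcongr
  have hco := co_nonneg hρ m n
  have h4 : co ρ m n * (psi ε (x a (l + n) - x a (l + 1)) - psi ε (x b (l + n) - x b (l + 1)))
      ≤ CO * L := by
    calc _ ≤ co ρ m n * L := mul_le_mul_of_nonneg_left (by linarith) hco
      _ ≤ _ := mul_le_mul_of_nonneg_right h3 (by linarith)
  have h5 : K ≤ K * L := le_mul_of_one_le_right hK hL
  have hLm : (0 : ℝ) ≤ L ^ m := by positivity
  calc _ ≤ _ := key
    _ ≤ L ^ m * ((CO + K) * L) := mul_le_mul_of_nonneg_left (by linarith) hLm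
    _ = _ := by ring

theorem allU {ρ : ℝ} (N : ℕ) (hρ : 0 < ρ) (hρ1 : ρ ≤ 1) (m : ℕ) :
    (∃ K, 0 ≤ K ∧ UU ρ N m K) ∧ (∃ K, 0 ≤ K ∧ VV ρ N m K) := by
  induction m with
  | zero =>
    refine ⟨⟨0, le_rfl, ?_⟩, ⟨0, le_rfl, ?_⟩⟩
    · intro ε L hε hL hlog x cr hT a b l n hab hn hnN hw diam
      rcases hab.eq_or_lt with h | h
      · subst h
        simp [Nc]
      · exfalso
        obtain ⟨h1, h2, h3⟩ := hw a le_rfl h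
        have := @Cnt_mid cr a l (l + n) (l + n) (by omega) le_rfl h2
        omega
    · intro ε L hε hL hlog x cr hT a b l n hab hn hnN hw diam
      rcases hab.eq_or_lt with h | h
      · subst h
        simp [Nc]
      · exfalso
        obtain ⟨h1, h2, h3⟩ := hw a le_rfl h
        omega
  | succ m ih =>
    obtain ⟨⟨K, hK, hU⟩, ⟨Kv, hKv, hV⟩⟩ := ih
    exact ⟨stepU hρ hρ1 hU hK hV hKv, stepV hρ hρ1 hU hK⟩
end


section
open scoped Classical

noncomputable def rk {n : ℕ} (y : Fin n → ℝ) (i : Fin n) : ℕ := ((Tuple.sort y).symm i : Fin n)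

theorem rk_lt {n : ℕ} (y : Fin n → ℝ) (i : Fin n) : rk y i < n := Fin.is_lt _

theorem rk_inj {n : ℕ} {y : Fin n → ℝ} {i j : Fin n} (h : rk y i = rk y j) : i = j :=
  (Tuple.sort y).symm.injective (Fin.ext h)

theorem rk_sort {n : ℕ} (y : Fin n → ℝ) (r : Fin n) : rk y (Tuple.sort y r) = r := by
  simp [rk]

theorem rk_mono {n : ℕ} {y : Fin n → ℝ} {i j : Fin n} (h : rk y i ≤ rk y j) : y i ≤ y j := by
  have := Tuple.monotone_sort y (show (Tuple.sort y).symm i ≤ (Tuple.sort y).symm j from h)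
  simpa using this

noncomputable def YY {n : ℕ} (y : Fin n → ℝ) (k : ℤ) : ℝ :=
  if h : 1 ≤ k ∧ k ≤ n then y (Tuple.sort y ⟨(k - 1).toNat, by omega⟩)
  else if k ≤ 0 then 0 else 1

theorem YY_ex {n : ℕ} (y : Fin n → ℝ) {k : ℤ} (h1 : 1 ≤ k) (h2 : k ≤ n) :
    ∃ i, YY y k = y i ∧ (rk y i : ℤ) + 1 = k := by
  refine ⟨Tuple.sort y ⟨(k - 1).toNat, by omega⟩, ?_, ?_⟩
  · unfold YY; rw [dif_pos ⟨h1, h2⟩]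
  · rw [rk_sort]; simp; omega

theorem YY_rk {n : ℕ} (y : Fin n → ℝ) (i : Fin n) : YY y ((rk y i : ℤ) + 1) = y i := by
  have := rk_lt y i
  obtain ⟨j, h1, h2⟩ := YY_ex y (k := (rk y i : ℤ) + 1) (by omega) (by omega)
  rw [h1, rk_inj (show rk y j = rk y i by omega)]

theorem YY_lo {n : ℕ} (y : Fin n → ℝ) {k : ℤ} (h : k ≤ 0) : YY y k = 0 := by
  unfold YY; rw [dif_neg (by omega), if_pos h]

theorem YY_hi {n : ℕ} (y : Fin n → ℝ) {k : ℤ} (h : (n : ℤ) < k) : YY y k = 1 := by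
  unfold YY; rw [dif_neg (by omega), if_neg (by omega)]

theorem le_YY {n : ℕ} {y : Fin n → ℝ} (hy : ∀ i, y i ≤ 1) {i : Fin n} {k : ℤ}
    (h : (rk y i : ℤ) < k) : y i ≤ YY y k := by
  by_cases hk : k ≤ n
  · obtain ⟨j, h1, h2⟩ := YY_ex y (k := k) (by omega) hk
    rw [h1]; exact rk_mono (by omega)
  · rw [YY_hi y (by omega)]; exact hy i

theorem YY_le {n : ℕ} {y : Fin n → ℝ} (hy : ∀ i, 0 ≤ y i) {i : Fin n} {k : ℤ}
    (h : k ≤ (rk y i : ℤ) + 1) : YY y k ≤ y i := by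
  by_cases hk : 1 ≤ k
  · have := rk_lt y i
    obtain ⟨j, h1, h2⟩ := YY_ex y (k := k) hk (by omega)
    rw [h1]; exact rk_mono (by omega)
  · rw [YY_lo y (by omega)]; exact hy i

theorem YY_mono {n : ℕ} {y : Fin n → ℝ} (hy : ∀ i, 0 ≤ y i) (hy1 : ∀ i, y i ≤ 1) :
    Monotone (YY y) := by
  intro a b hab
  by_cases ha : a ≤ 0
  · rw [YY_lo y ha]
    by_cases hb : b ≤ 0
    · rw [YY_lo y hb]
    by_cases hb' : b ≤ n
    · obtain ⟨j, h1, h2⟩ := YY_ex y (k := b) (by omega) hb'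
      rw [h1]; exact hy j
    · rw [YY_hi y (by omega)]; exact zero_le_one
  by_cases ha' : a ≤ n
  · obtain ⟨j, h1, h2⟩ := YY_ex y (k := a) (by omega) ha'
    rw [h1]; exact le_YY hy1 (by omega)
  · rw [YY_hi y (k := a) (by omega), YY_hi y (k := b) (by omega)]

theorem card_low {n : ℕ} (y : Fin n → ℝ) (k : ℕ) :
    (Finset.univ.filter (fun i => rk y i < k)).card = min n k := by
  rw [← Fin.card_filter_val_lt (n := n) (m := k)]
  apply Finset.card_bij (fun i _ => (Tuple.sort y).symm i)
  · intro i hi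
    rw [Finset.mem_filter] at hi ⊢
    exact ⟨Finset.mem_univ _, hi.2⟩
  · intro i _ j _ h; exact (Tuple.sort y).symm.injective h
  · intro r hr; exact ⟨Tuple.sort y r, by
      rw [Finset.mem_filter] at hr ⊢
      exact ⟨Finset.mem_univ _, by rw [rk_sort]; exact hr.2⟩, by simp⟩

theorem card_high {n : ℕ} (y : Fin n → ℝ) (k : ℕ) (hk : k ≤ n) :
    (Finset.univ.filter (fun i => k ≤ rk y i)).card = n - k := by
  have h1 := card_low y k
  have h2 := Finset.card_filter_add_card_filter_not (s := (Finset.univ : Finset (Fin n)))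
    (fun i => rk y i < k)
  simp only [not_lt, Finset.card_univ, Fintype.card_fin] at h2
  omega

theorem pig_le {n : ℕ} {y : Fin n → ℝ} (hy : ∀ i, 0 ≤ y i) {s : Finset (Fin n)} {k : ℕ} {v : ℝ}
    (hk : 1 ≤ k) (hs : k ≤ s.card) (hv : ∀ i ∈ s, y i ≤ v) : YY y k ≤ v := by
  by_contra hc
  have hsub : s ⊆ Finset.univ.filter (fun i => rk y i < k - 1) := by
    intro i hi
    rw [Finset.mem_filter]
    refine ⟨Finset.mem_univ _, ?_⟩
    by_contra h
    have := YY_le hy (i := i) (k := k) (by omega)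
    have := hv i hi
    linarith
  have := Finset.card_le_card hsub
  rw [card_low] at this
  omega

theorem pig_ge {n : ℕ} {y : Fin n → ℝ} (hy : ∀ i, y i ≤ 1) {s : Finset (Fin n)} {k : ℕ} {v : ℝ}
    (hk : k ≤ n) (hs : n - k + 1 ≤ s.card) (hv : ∀ i ∈ s, v ≤ y i) : v ≤ YY y k := by
  by_contra hc
  have hsub : s ⊆ Finset.univ.filter (fun i => k ≤ rk y i) := by
    intro i hi
    rw [Finset.mem_filter]
    refine ⟨Finset.mem_univ _, ?_⟩
    by_contra h
    have := le_YY hy (i := i) (k := k) (by omega)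
    have := hv i hi
    linarith
  have := Finset.card_le_card hsub
  rw [card_high y k hk] at this
  omega

theorem avg_le {n : ℕ} {ρ : ℝ} {p y : Fin n → ℝ} (h0 : ∀ j, 0 ≤ p j) (h1 : ∑ j, p j = 1)
    {H w : ℝ} (hH : ∀ j, p j ≠ 0 → y j ≤ H) {q : Fin n} (hq : ρ ≤ p q) (hq0 : p q ≠ 0)
    (hρ : 0 ≤ ρ) (hw : y q ≤ w) : ∑ j, p j * y j ≤ ρ * w + (1 - ρ) * H := by
  have e : ∑ j, p j * y j = H + ∑ j, p j * (y j - H) := by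
    simp only [mul_sub, Finset.sum_sub_distrib, ← Finset.sum_mul, h1]
    ring
  have hneg : ∀ j, p j * (y j - H) ≤ 0 := by
    intro j
    by_cases h : p j = 0
    · rw [h, zero_mul]
    · exact mul_nonpos_of_nonneg_of_nonpos (h0 j) (by linarith [hH j h])
  have hs : ∑ j, p j * (y j - H) ≤ p q * (y q - H) := by
    rw [← Finset.add_sum_erase _ _ (Finset.mem_univ q)]
    have := Finset.sum_nonpos (s := Finset.univ.erase q) (fun j _ => hneg j)
    linarith
  have h2 : p q * (y q - H) ≤ ρ * (y q - H) :=
    mul_le_mul_of_nonpos_right hq (by linarith [hH q hq0])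
  have h3 : ρ * (y q - H) ≤ ρ * (w - H) := mul_le_mul_of_nonneg_left (by linarith) hρ
  rw [e]; linarith

theorem avg_ge {n : ℕ} {ρ : ℝ} {p y : Fin n → ℝ} (h0 : ∀ j, 0 ≤ p j) (h1 : ∑ j, p j = 1)
    {H w : ℝ} (hH : ∀ j, p j ≠ 0 → H ≤ y j) {q : Fin n} (hq : ρ ≤ p q) (hq0 : p q ≠ 0)
    (hρ : 0 ≤ ρ) (hw : w ≤ y q) : ρ * w + (1 - ρ) * H ≤ ∑ j, p j * y j := by
  have := avg_le (y := fun j => - y j) h0 h1 (H := -H) (w := -w)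
    (fun j h => neg_le_neg (hH j h)) hq hq0 hρ (neg_le_neg hw)
  simp only [mul_neg, Finset.sum_neg_distrib] at this
  linarith

theorem S_le {n : ℕ} {ρ : ℝ} (S : AvgSystem n ρ) (hρ : 0 ≤ ρ) {t : ℕ} {i q : Fin n} {H w : ℝ}
    (hH : ∀ j, S.P t i j ≠ 0 → S.x t j ≤ H) (hq : S.P t i q ≠ 0) (hw : S.x t q ≤ w) :
    S.x (t + 1) i ≤ ρ * w + (1 - ρ) * H := by
  rw [S.update]
  exact avg_le (S.nonneg t i) (S.rowSum t i) hH (S.threshold t i q hq) hq hρ hw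

theorem S_ge {n : ℕ} {ρ : ℝ} (S : AvgSystem n ρ) (hρ : 0 ≤ ρ) {t : ℕ} {i q : Fin n} {H w : ℝ}
    (hH : ∀ j, S.P t i j ≠ 0 → H ≤ S.x t j) (hq : S.P t i q ≠ 0) (hw : w ≤ S.x t q) :
    ρ * w + (1 - ρ) * H ≤ S.x (t + 1) i := by
  rw [S.update]
  exact avg_ge (S.nonneg t i) (S.rowSum t i) hH (S.threshold t i q hq) hq hρ hw

theorem S_Icc {n : ℕ} {ρ : ℝ} (S : AvgSystem n ρ) (hρ : 0 ≤ ρ)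
    (h : ∀ i, S.x 0 i ∈ Set.Icc (0 : ℝ) 1) (t : ℕ) : (∀ i, 0 ≤ S.x t i) ∧ ∀ i, S.x t i ≤ 1 := by
  induction t with
  | zero => exact ⟨fun i => (h i).1, fun i => (h i).2⟩
  | succ t ih =>
    constructor
    · intro i
      have := S_ge S hρ (t := t) (i := i) (q := i) (H := 0) (w := 0) (fun j _ => ih.1 j)
        (S.diagPos t i).ne' (ih.1 i)
      linarith
    · intro i
      have := S_le S hρ (t := t) (i := i) (q := i) (H := 1) (w := 1) (fun j _ => ih.2 j)
        (S.diagPos t i).ne' (ih.2 i)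
      linarith

def SC {n : ℕ} {ρ : ℝ} (S : AvgSystem n ρ) (t : ℕ) (k : ℤ) : Prop :=
  ∃ i j, S.P t i j ≠ 0 ∧ (rk (S.x t) i : ℤ) < k ∧ k ≤ rk (S.x t) j

theorem SC_lt {n : ℕ} {ρ : ℝ} {S : AvgSystem n ρ} {t : ℕ} {k : ℤ} (h : ¬ SC S t k)
    {i j : Fin n} (hij : S.P t i j ≠ 0) (hi : (rk (S.x t) i : ℤ) < k) :
    (rk (S.x t) j : ℤ) < k := by
  by_contra hc
  exact h ⟨i, j, hij, hi, by omega⟩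

theorem SC_ge {n : ℕ} {ρ : ℝ} {S : AvgSystem n ρ} {t : ℕ} {k : ℤ} (h : ¬ SC S t k)
    {i j : Fin n} (hij : S.P t i j ≠ 0) (hi : k ≤ (rk (S.x t) i : ℤ)) :
    k ≤ (rk (S.x t) j : ℤ) := by
  by_contra hc
  exact h ⟨j, i, fun e => hij ((S.symm t j i).1 e), by omega, hi⟩

theorem S_twist {n : ℕ} {ρ : ℝ} (S : AvgSystem n ρ) (hρ : 0 ≤ ρ)
    (h : ∀ i, S.x 0 i ∈ Set.Icc (0 : ℝ) 1) : Twist ρ (fun t => YY (S.x t)) (SC S) := by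
  have b0 := fun t => (S_Icc S hρ h t).1
  have b1 := fun t => (S_Icc S hρ h t).2
  refine ⟨fun t => YY_mono (b0 t) (b1 t), ?_, ?_, ?_, ?_⟩
  · intro t k hk
    by_cases k0 : k ≤ 0
    · rw [YY_lo _ k0, YY_lo _ k0]
    by_cases k1 : k ≤ n
    swap
    · rw [YY_hi _ (by omega), YY_hi _ (by omega)]
    obtain ⟨K, rfl⟩ := Int.eq_ofNat_of_zero_le (show 0 ≤ k by omega)
    refine pig_le (b0 (t + 1)) (s := Finset.univ.filter (fun i => rk (S.x t) i < K)) (by omega)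
      (by rw [card_low]; omega) ?_
    intro i hi
    rw [Finset.mem_filter] at hi
    have := S_le S hρ (t := t) (i := i) (q := i) (H := YY (S.x t) K) (w := YY (S.x t) K)
      (fun j hj => le_YY (b1 t) (SC_lt hk hj (by omega))) (S.diagPos t i).ne'
      (le_YY (b1 t) (by omega))
    linarith
  · intro t k hk
    by_cases k0 : k + 1 ≤ 0
    · rw [YY_lo _ k0, YY_lo _ k0]
    by_cases k1 : k + 1 ≤ n
    swap
    · rw [YY_hi _ (by omega), YY_hi _ (by omega)]
    obtain ⟨K, hK⟩ := Int.eq_ofNat_of_zero_le (show 0 ≤ k + 1 by omega)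
    by_cases hK1 : K = 0
    · rw [YY_lo _ (by omega), YY_lo _ (by omega)]
    obtain ⟨K, rfl⟩ := Nat.exists_eq_succ_of_ne_zero hK1
    have hkK : k = K := by push_cast at hK; omega
    show YY (S.x t) (k + 1) ≤ YY (S.x (t + 1)) (k + 1)
    rw [hK]
    refine pig_ge (b1 (t + 1)) (s := Finset.univ.filter (fun i => K ≤ rk (S.x t) i)) (by omega)
      (by rw [card_high _ _ (by omega)]; omega) ?_
    intro i hi
    rw [Finset.mem_filter] at hi
    rw [← hK]
    have := S_ge S hρ (t := t) (i := i) (q := i) (H := YY (S.x t) (k + 1)) (w := YY (S.x t) (k + 1))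
      (fun j hj => YY_le (b0 t) (by have := SC_ge hk hj (by omega); omega)) (S.diagPos t i).ne'
      (YY_le (b0 t) (by omega))
    linarith
  · rintro t k M ⟨i, j, hij, hi, hj⟩ hM hkM
    have hjn := rk_lt (S.x t) j
    obtain ⟨K, rfl⟩ := Int.eq_ofNat_of_zero_le (show 0 ≤ k by omega)
    have hnot : j ∉ Finset.univ.filter (fun i => rk (S.x t) i < K) := by
      simp; omega
    have := pig_le (b0 (t + 1)) (k := K + 1) (v := ρ * YY (S.x t) K + (1 - ρ) * YY (S.x t) M)
      (s := insert j (Finset.univ.filter (fun i => rk (S.x t) i < K)))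
      (by omega) (by rw [Finset.card_insert_of_notMem hnot, card_low]; omega) (by
        intro r hr
        rw [Finset.mem_insert, Finset.mem_filter] at hr
        have hrM : (rk (S.x t) r : ℤ) < M := by
          rcases hr with rfl | hr
          · exact SC_lt hM hij (by omega)
          · omega
        have hq : ∃ q, S.P t r q ≠ 0 ∧ (rk (S.x t) q : ℤ) < K := by
          rcases hr with rfl | hr
          · exact ⟨i, fun e => hij ((S.symm t _ _).1 e), hi⟩
          · exact ⟨r, (S.diagPos t r).ne', by omega⟩
        obtain ⟨q, hq1, hq2⟩ := hq
        exact S_le S hρ (fun p hp => le_YY (b1 t) (SC_lt hM hp hrM)) hq1 (le_YY (b1 t) hq2))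
    simpa using this
  · rintro t k M ⟨i, j, hij, hi, hj⟩ hM hkM
    have hjn := rk_lt (S.x t) j
    obtain ⟨K, rfl⟩ := Int.eq_ofNat_of_zero_le (show 0 ≤ k by omega)
    have hnot : i ∉ Finset.univ.filter (fun i => K ≤ rk (S.x t) i) := by
      simp; omega
    refine pig_ge (b1 (t + 1)) (k := K)
      (s := insert i (Finset.univ.filter (fun i => K ≤ rk (S.x t) i)))
      (by omega) (by rw [Finset.card_insert_of_notMem hnot, card_high _ _ (by omega)]) (by
        intro r hr
        rw [Finset.mem_insert, Finset.mem_filter] at hr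
        have hrM : M ≤ (rk (S.x t) r : ℤ) := by
          rcases hr with rfl | hr
          · exact SC_ge hM (fun e => hij ((S.symm t _ _).1 e)) (show M ≤ (rk (S.x t) j : ℤ) by omega)
          · omega
        have hq : ∃ q, S.P t r q ≠ 0 ∧ (K : ℤ) ≤ (rk (S.x t) q : ℤ) := by
          rcases hr with rfl | hr
          · exact ⟨j, hij, hj⟩
          · exact ⟨r, (S.diagPos t r).ne', by omega⟩
        obtain ⟨q, hq1, hq2⟩ := hq
        exact S_ge S hρ (fun p hp => YY_le (b0 t) (by have := SC_ge hM hp hrM; omega)) hq1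
          (YY_le (b0 t) (by omega)))

theorem S_cnt {n m : ℕ} {ρ : ℝ} (S : AvgSystem n ρ) (hc : S.componentsLE m) (t : ℕ) :
    Cnt (SC S) t 0 n ≤ m := by
  obtain ⟨c, -, hc⟩ := hc t
  have hex : ∀ k : ℤ, k ∈ (Finset.Ioc (0 : ℤ) n).filter (fun k => ¬ SC S t k) →
      ∃ i, (rk (S.x t) i : ℤ) + 1 = k := by
    intro k hk
    rw [Finset.mem_filter, Finset.mem_Ioc] at hk
    obtain ⟨i, -, hi⟩ := YY_ex (S.x t) (k := k) (by omega) (by omega)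
    exact ⟨i, hi⟩
  choose f hf using hex
  have key : ∀ k hk k' hk', c (f k hk) = c (f k' hk') → k' ≤ k := by
    intro k hk k' hk' he
    have hp := hc _ _ he
    have hk2 := (Finset.mem_filter.1 hk).2
    have h0 := hf k hk
    have h1 := hf k' hk'
    have aux : ∀ i, Relation.ReflTransGen (fun a b => S.P t a b ≠ 0) (f k hk) i →
        (rk (S.x t) i : ℤ) < k := by
      intro i hi
      induction hi with
      | refl => omega
      | tail _ hab ih => exact SC_lt hk2 hab ih
    have := aux _ hp
    omega
  unfold Cnt
  calc _ = ((Finset.Ioc (0 : ℤ) n).filter (fun k => ¬ SC S t k)).attach.card :=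
        Finset.card_attach.symm
    _ ≤ (Finset.univ : Finset (Fin m)).card := by
      refine Finset.card_le_card_of_injOn (fun k => c (f k.1 k.2)) (fun _ _ => Finset.mem_univ _) ?_
      intro k _ k' _ he
      exact Subtype.ext (le_antisymm (key _ _ _ _ he.symm) (key _ _ _ _ he))
    _ = m := by simp

theorem S_lng {n : ℕ} {ρ ε : ℝ} (S : AvgSystem n ρ) {t : ℕ} (h : t ∈ S.longTimes ε) :
    Lng (fun t => YY (S.x t)) (SC S) ε t 0 n := by
  obtain ⟨i, j, hij, he⟩ := h
  have main : ∀ i j, S.P t i j ≠ 0 → ε ≤ |S.x t i - S.x t j| → rk (S.x t) i ≤ rk (S.x t) j →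
      Lng (fun t => YY (S.x t)) (SC S) ε t 0 n := by
    intro i j hij he hr
    have hjn := rk_lt (S.x t) j
    refine ⟨(rk (S.x t) i : ℤ) + 1, (rk (S.x t) j : ℤ) + 1, by omega, by omega, by omega,
      fun k h1 h2 => ⟨i, j, hij, by omega, by omega⟩, ?_⟩
    have := rk_mono hr
    rw [abs_sub_comm, abs_of_nonneg (by linarith)] at he
    simpa only [YY_rk] using he
  rcases le_total (rk (S.x t) i) (rk (S.x t) j) with hr | hr
  · exact main i j hij he hr
  · exact main j i (fun e => hij ((S.symm t _ _).1 e)) (by rwa [abs_sub_comm]) hr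
end


section
open scoped Classical

theorem encard_bound {A : Set ℕ} {B : ℝ}
    (h : ∀ b : ℕ, (((Finset.Ico 0 b).filter (fun t => t ∈ A)).card : ℝ) ≤ B) :
    ((A.encard : ℕ∞) : ℝ≥0∞) ≤ ENNReal.ofReal B := by
  have hB : 0 ≤ B := by simpa using h 0
  have h1 : A.encard ≤ (⌊B⌋₊ : ℕ∞) := by
    by_contra hc
    have h2 : ((⌊B⌋₊ + 1 : ℕ) : ℕ∞) ≤ A.encard := by
      push_cast
      exact Order.add_one_le_of_lt (not_le.1 hc)
    obtain ⟨T, hT, hc⟩ := Set.exists_subset_encard_eq h2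
    have hfin : T.Finite := Set.finite_of_encard_eq_coe hc
    have hcard : hfin.toFinset.card = ⌊B⌋₊ + 1 := by
      rw [hfin.encard_eq_coe_toFinset_card] at hc
      exact_mod_cast hc
    obtain ⟨b, hb⟩ := hfin.toFinset.exists_nat_subset_range
    have h3 : hfin.toFinset ⊆ (Finset.Ico 0 b).filter (fun t => t ∈ A) := by
      intro t ht
      have := hb ht
      rw [Finset.mem_range] at this
      rw [Finset.mem_filter, Finset.mem_Ico]
      exact ⟨⟨by omega, this⟩, hT (hfin.mem_toFinset.1 ht)⟩
    have h4 := Finset.card_le_card h3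
    rw [hcard] at h4
    have h5 := h b
    have h6 := Nat.lt_floor_add_one B
    have h7 : ((⌊B⌋₊ + 1 : ℕ) : ℝ) ≤ B := le_trans (by exact_mod_cast h4) h5
    push_cast at h7
    linarith
  calc ((A.encard : ℕ∞) : ℝ≥0∞) ≤ (((⌊B⌋₊ : ℕ) : ℕ∞) : ℝ≥0∞) := ENat.toENNReal_le.2 h1
    _ = ENNReal.ofReal (⌊B⌋₊ : ℝ) := by simp
    _ ≤ ENNReal.ofReal B := ENNReal.ofReal_le_ofReal (Nat.floor_le hB)

theorem ten_pow (m : ℕ) (hm : 1 ≤ m) : (10 : ℝ) ^ m ≤ 10 ^ 10 * (m : ℝ) ^ m := by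
  have hm1 : (1 : ℝ) ≤ m := by exact_mod_cast hm
  have hmm : (1 : ℝ) ≤ (m : ℝ) ^ m := one_le_pow₀ hm1
  rcases Nat.lt_or_ge m 10 with h | h
  · have : (10 : ℝ) ^ m ≤ 10 ^ 10 := pow_le_pow_right₀ (by norm_num) h.le
    calc (10 : ℝ) ^ m ≤ 10 ^ 10 * 1 := by linarith
      _ ≤ _ := mul_le_mul_of_nonneg_left hmm (by positivity)
  · have h10 : (10 : ℝ) ≤ m := by exact_mod_cast h
    have : (10 : ℝ) ^ m ≤ (m : ℝ) ^ m := pow_le_pow_left₀ (by norm_num) h10 m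
    linarith

theorem S_final {n m : ℕ} {ρ ε L K : ℝ} (hn : 2 ≤ n) (hm : 1 ≤ m) (hρ : 0 < ρ) (hρ1 : ρ ≤ 1)
    (hU : UU ρ n m K) (hε : 0 < ε) (hL : 1 ≤ L) (hKL : K ≤ L) (hlog : Real.log ε = -L)
    (S : AvgSystem n ρ) (hx : ∀ i, S.x 0 i ∈ Set.Icc (0 : ℝ) 1) (hc : S.componentsLE m) (b : ℕ) :
    (((Finset.Ico 0 b).filter (fun t => t ∈ S.longTimes ε)).card : ℝ) ≤
      2 * 10 ^ 10 * (1 / ρ) ^ (n - 1) * (m * n * L) ^ m := by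
  have hT := S_twist S hρ.le hx
  have b0 := fun t => (S_Icc S hρ.le hx t).1
  have b1 := fun t => (S_Icc S hρ.le hx t).2
  have diam : YY (S.x 0) (0 + (n : ℤ)) - YY (S.x 0) (0 + 1) ≤ 1 := by
    have h1 := YY_mono (b0 0) (b1 0) (show (0 : ℤ) + n ≤ n + 1 by omega)
    have h2 := YY_mono (b0 0) (b1 0) (show (0 : ℤ) ≤ 0 + 1 by omega)
    rw [YY_hi (k := n + 1) _ (by omega)] at h1
    rw [YY_lo (k := 0) _ le_rfl] at h2
    linarith
  have key := hU ε L hε hL hlog _ _ hT 0 b 0 n (Nat.zero_le _) (by omega) le_rfl (by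
    intro t _ _
    refine ⟨?_, ?_, ?_⟩
    · rintro ⟨i, j, -, h1, -⟩
      omega
    · rintro ⟨i, j, -, -, h1⟩
      have := rk_lt (S.x t) j
      omega
    · rw [zero_add]
      exact S_cnt S hc t) diam
  have hle : (((Finset.Ico 0 b).filter (fun t => t ∈ S.longTimes ε)).card : ℝ) ≤
      Nc (fun t => YY (S.x t)) (SC S) ε 0 b 0 (0 + n) := by
    unfold Nc
    norm_cast
    apply Finset.card_le_card
    intro t ht
    rw [Finset.mem_filter] at ht ⊢
    refine ⟨ht.1, ?_⟩
    rw [zero_add]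
    exact S_lng S ht.2
  refine hle.trans ?_
  have h1 := psi_upper hε (by linarith) diam
  have h2 := @psi_lower ε (YY (S.x b) (0 + (n : ℤ)) - YY (S.x b) (0 + 1)) hε
  have hco := co_nonneg hρ m n
  have hr : 1 ≤ 1 / ρ := by rw [le_div_iff₀ hρ]; linarith
  have hn1 : (1 : ℝ) ≤ n := by exact_mod_cast (by omega : 1 ≤ n)
  have hco1 : 1 ≤ co ρ m n := by
    unfold co
    exact one_le_mul_of_one_le_of_one_le (one_le_pow₀ (by linarith)) (one_le_pow₀ hr)
  have hLm : (0 : ℝ) ≤ L ^ m := by positivity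
  have k1 : co ρ m n * (psi ε (YY (S.x 0) (0 + (n : ℤ)) - YY (S.x 0) (0 + 1)) -
      psi ε (YY (S.x b) (0 + (n : ℤ)) - YY (S.x b) (0 + 1))) ≤ co ρ m n * L :=
    mul_le_mul_of_nonneg_left (by linarith) hco
  have k2 : L ≤ co ρ m n * L := le_mul_of_one_le_left (by linarith) hco1
  have k3 : (Nc (fun t => YY (S.x t)) (SC S) ε 0 b 0 (0 + n) : ℝ) * L ≤
      (L ^ m * (2 * co ρ m n)) * L := by
    refine key.trans ?_
    rw [mul_assoc]
    exact mul_le_mul_of_nonneg_left (by linarith) hLm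
  have k4 := le_of_mul_le_mul_right k3 (by linarith : 0 < L)
  refine k4.trans ?_
  unfold co
  have k5 := ten_pow m hm
  calc L ^ m * (2 * ((10 * (n : ℝ)) ^ m * (1 / ρ) ^ (n - 1)))
      = 10 ^ m * (2 * (n : ℝ) ^ m * (1 / ρ) ^ (n - 1) * L ^ m) := by rw [mul_pow]; ring
    _ ≤ (10 ^ 10 * (m : ℝ) ^ m) * (2 * (n : ℝ) ^ m * (1 / ρ) ^ (n - 1) * L ^ m) :=
        mul_le_mul_of_nonneg_right k5 (by positivity)
    _ = _ := by rw [mul_pow, mul_pow]; ring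
end

/-- There is an absolute constant `c > 0` such that for every `n ≥ 2`,
`ρ ∈ (0,1/2]`, `m` with `1 ≤ m ≤ n−1`, and all sufficiently small `ε > 0`, the number of
timesteps at which an averaging system (with at most `m` connected components at any
time and `x(0) ∈ [0,1]^n`) has an embedded edge of length at least `ε` satisfies
`T_{m,ε} ≤ c·(1/ρ)^(n−1)·(m·n·log(1/ε))^m`. -/
theorem convergenceTime_le :
    ∃ c : ℝ, 0 < c ∧
      ∀ (n m : ℕ) (ρ : ℝ), 2 ≤ n → 0 < ρ → ρ ≤ 1 / 2 → 1 ≤ m → m ≤ n - 1 →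
        ∃ ε₀ : ℝ, 0 < ε₀ ∧
          ∀ ε : ℝ, 0 < ε → ε ≤ ε₀ →
            ∀ S : AvgSystem n ρ, (∀ i, S.x 0 i ∈ Set.Icc (0 : ℝ) 1) →
              S.componentsLE m →
              ((S.longTimes ε).encard : ℝ≥0∞) ≤
                ENNReal.ofReal
                  (c * (1 / ρ) ^ (n - 1) * (m * n * Real.log (1 / ε)) ^ m) := by
  refine ⟨2 * 10 ^ 10, by norm_num, ?_⟩
  intro n m ρ hn hρ hρ2 hm _
  obtain ⟨⟨K, hK, hU⟩, -⟩ := allU (ρ := ρ) n hρ (by linarith) m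
  refine ⟨Real.exp (-(1 + K)), Real.exp_pos _, ?_⟩
  intro ε hε hε0 S hx hc
  have hl : Real.log ε ≤ -(1 + K) := by
    have := Real.log_le_log hε hε0
    rwa [Real.log_exp] at this
  have e : Real.log (1 / ε) = - Real.log ε := by
    rw [one_div, Real.log_inv]
  rw [e]
  apply encard_bound
  intro b
  exact S_final hn hm hρ (by linarith) hU hε (by linarith) (by linarith) (by ring) S hx hc b
end

section
/- There is an absolute constant c > 0 such that for every n ≥ 2, ρ ∈ (0,1/2], m with 1 ≤ m ≤ n−1, and all sufficiently small ε > 0, reversible averaging systems satisfy T^rev_{m,ε} ≤ c·((n²/ρ)·log(1/ε))^m. -/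
open scoped BigOperators ENNReal

/-- A reversible averaging system: `P t = diag(q)⁻¹ · M t`, where each `M t` is a
symmetric nonnegative matrix whose nonzero entries are at least `1`, and
`q = M t · 𝟏` is the same vector for all `t`, with `q i ≤ 1/ρ`. -/
structure RevAvgSystem (n : ℕ) (ρ : ℝ) extends AvgSystem n ρ where
  q : Fin n → ℝ
  M : ℕ → Matrix (Fin n) (Fin n) ℝ
  M_symm : ∀ t i j, M t i j = M t j i
  M_nonneg : ∀ t i j, 0 ≤ M t i j
  M_ge_one : ∀ t i j, M t i j ≠ 0 → 1 ≤ M t i j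
  q_def : ∀ t i, q i = ∑ j, M t i j
  q_le : ∀ i, q i ≤ 1 / ρ
  P_eq : ∀ t i j, P t i j = M t i j / q i

/-- The initial scaled variance `∑ i, q i (x i − μ)² ≤ 1`, where
`μ = (∑ i, q i x i)/(∑ i, q i)`. -/
def initVarLEOne {n : ℕ} (q x : Fin n → ℝ) : Prop :=
  ∑ i, q i * (x i - (∑ j, q j * x j) / (∑ j, q j)) ^ 2 ≤ 1

namespace RevProof

lemma exists_levels {n : ℕ} (U : Finset (Fin n)) (hU : U.Nonempty) (x : Fin n → ℝ) :
    ∃ (k : ℕ) (s : ℕ → ℝ), k + 1 ≤ U.card ∧ Monotone s ∧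
      (∀ i ∈ U, s 0 ≤ x i ∧ x i ≤ s k) ∧
      (∀ d < k, ∀ i ∈ U, s d < x i → s (d + 1) ≤ x i) ∧
      (∀ d < k, ∃ i ∈ U, x i ≤ s d) ∧ (∀ d < k, ∃ i ∈ U, s d < x i) := by
  classical
  have hne : (U.image x).Nonempty := hU.image x
  obtain ⟨k, hk⟩ : ∃ k, (U.image x).card = k + 1 :=
    ⟨(U.image x).card - 1, by have := hne.card_pos; omega⟩
  let e := (U.image x).orderEmbOfFin hk
  have hmem : ∀ l, ∃ i ∈ U, x i = e l := by
    intro l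
    have := Finset.orderEmbOfFin_mem (U.image x) hk l
    exact Finset.mem_image.1 this
  have hsurj : ∀ i ∈ U, ∃ l, e l = x i := by
    intro i hi
    have h1 : x i ∈ Set.range e := by
      rw [Finset.range_orderEmbOfFin]
      exact_mod_cast Finset.mem_image_of_mem x hi
    exact h1
  refine ⟨k, fun d => e ⟨min d k, by omega⟩, ?_, ?_, ?_, ?_, ?_, ?_⟩
  · rw [← hk]; exact Finset.card_image_le
  · intro a b hab
    apply e.monotone
    simp only [Fin.mk_le_mk]
    omega
  · intro i hi
    obtain ⟨l, hl⟩ := hsurj i hi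
    rw [← hl]
    constructor
    · apply e.monotone
      simp only [Fin.le_def]; omega
    · apply e.monotone
      simp only [Fin.le_def]; omega
  · intro d hd i hi h
    obtain ⟨l, hl⟩ := hsurj i hi
    simp only [← hl] at h ⊢
    rw [e.lt_iff_lt] at h
    apply e.monotone
    simp only [Fin.lt_def, Fin.le_def] at h ⊢
    omega
  · intro d hd
    obtain ⟨i, hi, h⟩ := hmem ⟨min d k, by omega⟩
    exact ⟨i, hi, h.le⟩
  · intro d hd
    obtain ⟨i, hi, h⟩ := hmem ⟨k, by omega⟩
    refine ⟨i, hi, ?_⟩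
    rw [h]
    apply e.strictMono
    simp only [Fin.lt_def]; omega

/-- clamp -/
noncomputable def clp (s : ℕ → ℝ) (d : ℕ) (u : ℝ) : ℝ := min u (s (d + 1)) - min u (s d)

lemma clp_mono (s : ℕ → ℝ) (hs : Monotone s) (d : ℕ) : Monotone (clp s d) := by
  intro u v huv
  have h := hs (Nat.le_succ d)
  simp only [Nat.succ_eq_add_one] at h
  unfold clp
  rcases le_total u (s (d+1)) with h1 | h1 <;> rcases le_total u (s d) with h2 | h2 <;>
  rcases le_total v (s (d+1)) with h3 | h3 <;> rcases le_total v (s d) with h4 | h4 <;>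
  simp only [min_eq_left, min_eq_right, h1, h2, h3, h4] <;> linarith

lemma clp_sum_le (s : ℕ → ℝ) (k : ℕ) {u v : ℝ} (huv : u ≤ v) :
    ∑ d ∈ Finset.range k, (clp s d v - clp s d u) ≤ v - u := by
  have h : ∀ w, ∑ d ∈ Finset.range k, clp s d w = min w (s k) - min w (s 0) := by
    intro w
    exact Finset.sum_range_sub (fun d => min w (s d)) k
  rw [Finset.sum_sub_distrib, h, h]
  have h1 : min u (s 0) ≤ min v (s 0) := min_le_min_right _ huv
  have h2 : min v (s k) - min u (s k) ≤ v - u := by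
    rcases le_total u (s k) with h1 | h1 <;> rcases le_total v (s k) with h2 | h2 <;>
    simp only [min_eq_left, min_eq_right, h1, h2] <;> linarith
  linarith

lemma clp_sq (s : ℕ → ℝ) (hs : Monotone s) (k : ℕ) (C : Finset ℕ) (hC : C ⊆ Finset.range k)
    (u v : ℝ) :
    ∑ d ∈ C, (clp s d v - clp s d u) ^ 2 ≤ (v - u) ^ 2 := by
  wlog huv : u ≤ v with H
  · have := H s hs k C hC v u (le_of_not_ge huv)
    calc _ = ∑ d ∈ C, (clp s d u - clp s d v) ^ 2 := by
          apply Finset.sum_congr rfl; intros; ring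
      _ ≤ _ := this
      _ = _ := by ring
  have h0 : ∀ d, 0 ≤ clp s d v - clp s d u := fun d => sub_nonneg.2 (clp_mono s hs d huv)
  calc _ ≤ (∑ d ∈ C, (clp s d v - clp s d u)) ^ 2 :=
        Finset.sum_sq_le_sq_sum_of_nonneg (fun d _ => h0 d)
    _ ≤ (v - u) ^ 2 := by
        apply pow_le_pow_left₀ (Finset.sum_nonneg (fun d _ => h0 d))
        exact (Finset.sum_le_sum_of_subset_of_nonneg hC (fun d _ _ => h0 d)).trans
          (clp_sum_le s k huv)

/-- weighted variance -/
noncomputable def wv {ι : Type*} (U : Finset ι) (q f : ι → ℝ) : ℝ :=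
  ∑ i ∈ U, q i * f i ^ 2 - (∑ i ∈ U, q i * f i) ^ 2 / ∑ i ∈ U, q i

lemma wv_shift {ι : Type*} (U : Finset ι) (q f : ι → ℝ) (hQ : 0 < ∑ i ∈ U, q i) (c : ℝ) :
    ∑ i ∈ U, q i * (f i - c) ^ 2 =
      wv U q f + (∑ i ∈ U, q i) * (c - (∑ i ∈ U, q i * f i) / ∑ i ∈ U, q i) ^ 2 := by
  have : ∑ i ∈ U, q i * (f i - c) ^ 2 = ∑ i ∈ U, q i * f i ^ 2 - 2 * c * ∑ i ∈ U, q i * f i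
      + c ^ 2 * ∑ i ∈ U, q i := by
    rw [Finset.mul_sum, Finset.mul_sum, ← Finset.sum_sub_distrib, ← Finset.sum_add_distrib]
    apply Finset.sum_congr rfl; intros; ring
  rw [this, wv]
  field_simp
  ring

lemma wv_le {ι : Type*} (U : Finset ι) (q f : ι → ℝ) (hQ : 0 < ∑ i ∈ U, q i) (c : ℝ) :
    wv U q f ≤ ∑ i ∈ U, q i * (f i - c) ^ 2 := by
  rw [wv_shift U q f hQ c]
  have := mul_nonneg hQ.le (sq_nonneg (c - (∑ i ∈ U, q i * f i) / ∑ i ∈ U, q i))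
  linarith

lemma wv_eq {ι : Type*} (U : Finset ι) (q f : ι → ℝ) (hQ : 0 < ∑ i ∈ U, q i) :
    ∃ c, wv U q f = ∑ i ∈ U, q i * (f i - c) ^ 2 :=
  ⟨(∑ i ∈ U, q i * f i) / ∑ i ∈ U, q i, by rw [wv_shift U q f hQ]; simp⟩

lemma wv_pairs {ι : Type*} (U : Finset ι) (q f : ι → ℝ) (hQ : 0 < ∑ i ∈ U, q i) :
    wv U q f = (∑ j ∈ U, ∑ k ∈ U, q j * q k * (f j - f k) ^ 2) / (2 * ∑ i ∈ U, q i) := by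
  have : ∑ j ∈ U, ∑ k ∈ U, q j * q k * (f j - f k) ^ 2 =
      2 * ((∑ i ∈ U, q i) * (∑ i ∈ U, q i * f i ^ 2)) - 2 * (∑ i ∈ U, q i * f i) ^ 2 := by
    have h1 : ∀ j k, q j * q k * (f j - f k) ^ 2 =
      (q j * f j ^ 2) * q k + q j * (q k * f k ^ 2) - 2 * ((q j * f j) * (q k * f k)) := by
      intros; ring
    simp_rw [h1, Finset.sum_sub_distrib, Finset.sum_add_distrib, ← Finset.mul_sum,
      ← Finset.sum_mul]
    
    ring
  rw [this, wv]
  field_simp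

lemma wv_clp {ι : Type*} (U : Finset ι) (q f : ι → ℝ) (hq : ∀ i ∈ U, 0 ≤ q i)
    (hQ : 0 < ∑ i ∈ U, q i)
    (s : ℕ → ℝ) (hs : Monotone s) (k : ℕ) (C : Finset ℕ) (hC : C ⊆ Finset.range k) :
    ∑ d ∈ C, wv U q (fun i => clp s d (f i)) ≤ wv U q f := by
  simp_rw [wv_pairs U q _ hQ, ← Finset.sum_div]
  apply div_le_div_of_nonneg_right _ (by positivity)
  rw [Finset.sum_comm]
  apply Finset.sum_le_sum
  intro j hj
  rw [Finset.sum_comm]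
  apply Finset.sum_le_sum
  intro l hl
  rw [← Finset.mul_sum]
  exact mul_le_mul_of_nonneg_left (clp_sq s hs k C hC _ _) (mul_nonneg (hq j hj) (hq l hl))

lemma wv_nonneg {ι : Type*} (U : Finset ι) (q f : ι → ℝ) (hq : ∀ i ∈ U, 0 ≤ q i)
    (hQ : 0 < ∑ i ∈ U, q i) : 0 ≤ wv U q f := by
  obtain ⟨c, hc⟩ := wv_eq U q f hQ
  rw [hc]
  exact Finset.sum_nonneg (fun i hi => mul_nonneg (hq i hi) (sq_nonneg _))

/-- variance of a two-valued function with both masses at least one -/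
lemma wv_two {ι : Type*} (U : Finset ι) (w f : ι → ℝ) (hw : ∀ i ∈ U, 0 ≤ w i) (g : ℝ)
    (p : ι → Prop) (h0 : ∀ i ∈ U, p i → f i = 0) (h1 : ∀ i ∈ U, ¬ p i → f i = g)
    (i j : ι) (hi : i ∈ U) (hj : j ∈ U) (hpi : p i) (hpj : ¬ p j) (hwi : 1 ≤ w i)
    (hwj : 1 ≤ w j) : g ^ 2 / 2 ≤ wv U w f := by
  classical
  set a := ∑ l ∈ U.filter p, w l
  set b := ∑ l ∈ U.filter (fun l => ¬ p l), w l
  have hab : ∑ l ∈ U, w l = a + b := (Finset.sum_filter_add_sum_filter_not U p w).symm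
  have ha : 1 ≤ a := hwi.trans (Finset.single_le_sum (f := w) (s := U.filter p)
    (fun l hl => hw l (Finset.mem_filter.1 hl).1) (Finset.mem_filter.2 ⟨hi, hpi⟩))
  have hb : 1 ≤ b := hwj.trans (Finset.single_le_sum (f := w) (s := U.filter (fun l => ¬ p l))
    (fun l hl => hw l (Finset.mem_filter.1 hl).1) (Finset.mem_filter.2 ⟨hj, hpj⟩))
  have e1 : ∑ l ∈ U, w l * f l = b * g := by
    rw [← Finset.sum_filter_add_sum_filter_not U p, Finset.sum_mul]
    rw [Finset.sum_eq_zero, zero_add]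
    · apply Finset.sum_congr rfl
      intro l hl
      rw [h1 l (Finset.mem_filter.1 hl).1 (Finset.mem_filter.1 hl).2]
    · intro l hl
      rw [h0 l (Finset.mem_filter.1 hl).1 (Finset.mem_filter.1 hl).2, mul_zero]
  have e2 : ∑ l ∈ U, w l * f l ^ 2 = b * g ^ 2 := by
    rw [← Finset.sum_filter_add_sum_filter_not U p, Finset.sum_mul]
    rw [Finset.sum_eq_zero, zero_add]
    · apply Finset.sum_congr rfl
      intro l hl
      rw [h1 l (Finset.mem_filter.1 hl).1 (Finset.mem_filter.1 hl).2]
    · intro l hl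
      rw [h0 l (Finset.mem_filter.1 hl).1 (Finset.mem_filter.1 hl).2]; simp
  rw [wv, e1, e2, hab]
  have : b * g ^ 2 - (b * g) ^ 2 / (a + b) = g ^ 2 * (a * b / (a + b)) := by
    field_simp; ring
  rw [this]
  have : 1 / 2 ≤ a * b / (a + b) := by
    rw [div_le_div_iff₀ (by norm_num) (by linarith)]
    nlinarith
  nlinarith [sq_nonneg g]

variable {n : ℕ} {ρ : ℝ}

lemma q_ge (S : RevAvgSystem n ρ) (i : Fin n) : 0 < S.q i := by
  have h := S.diagPos 0 i
  rw [S.P_eq] at h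
  have h0 : 0 ≤ S.q i := by
    rw [S.q_def 0 i]; exact Finset.sum_nonneg (fun j _ => S.M_nonneg 0 i j)
  rcases h0.lt_or_eq with h1 | h1
  · exact h1
  · rw [← h1] at h; simp at h

lemma P_ne (S : RevAvgSystem n ρ) (t : ℕ) (i j : Fin n) : S.P t i j ≠ 0 ↔ S.M t i j ≠ 0 := by
  rw [S.P_eq]
  have := (q_ge S i).ne'
  simp [this]

lemma M_diag (S : RevAvgSystem n ρ) (t : ℕ) (i : Fin n) : 1 ≤ S.M t i i :=
  S.M_ge_one t i i ((P_ne S t i i).1 (S.diagPos t i).ne')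

lemma q_one (S : RevAvgSystem n ρ) (i : Fin n) : 1 ≤ S.q i := by
  rw [S.q_def 0 i]
  exact (M_diag S 0 i).trans
    (Finset.single_le_sum (fun j _ => S.M_nonneg 0 i j) (Finset.mem_univ i))

/-- no edge leaves `U` at time `t` -/
def Cl (S : RevAvgSystem n ρ) (U : Finset (Fin n)) (t : ℕ) : Prop :=
  ∀ i ∈ U, ∀ j, j ∉ U → S.M t i j = 0

/-- at most `m` components in `U` -/
def Cm (S : RevAvgSystem n ρ) (U : Finset (Fin n)) (m : ℕ) (t : ℕ) : Prop :=
  ∃ R ⊆ U, R.card ≤ m ∧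
    ∀ i ∈ U, ∃ r ∈ R, Relation.ReflTransGen (fun a b => S.M t a b ≠ 0) i r

/-- long edge in `U` -/
def Lg (S : RevAvgSystem n ρ) (ε : ℝ) (U : Finset (Fin n)) (t : ℕ) : Prop :=
  ∃ i ∈ U, ∃ j ∈ U, S.M t i j ≠ 0 ∧ ε ≤ |S.x t i - S.x t j|

open Classical in
/-- number of long steps -/
noncomputable def cnt (S : RevAvgSystem n ρ) (ε : ℝ) (U : Finset (Fin n)) (a b : ℕ) : ℕ :=
  ((Finset.Ico a b).filter (Lg S ε U)).card

/-- variance in `U` at time `t` -/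
noncomputable def VV (S : RevAvgSystem n ρ) (U : Finset (Fin n)) (t : ℕ) : ℝ :=
  wv U S.q (S.x t)

lemma Q_pos (S : RevAvgSystem n ρ) (U : Finset (Fin n)) (hU : U.Nonempty) :
    0 < ∑ i ∈ U, S.q i := Finset.sum_pos (fun i _ => q_ge S i) hU

lemma q_U (S : RevAvgSystem n ρ) {U : Finset (Fin n)} {t : ℕ} (h : Cl S U t) {i : Fin n}
    (hi : i ∈ U) : ∑ j ∈ U, S.M t i j = S.q i := by
  rw [S.q_def t i]
  exact Finset.sum_subset (Finset.subset_univ U) (fun j _ hj => h i hi j hj)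

lemma x_succ (S : RevAvgSystem n ρ) {U : Finset (Fin n)} {t : ℕ} (h : Cl S U t) {i : Fin n}
    (hi : i ∈ U) : S.x (t + 1) i = (∑ j ∈ U, S.M t i j * S.x t j) / S.q i := by
  rw [S.update t, Matrix.mulVec, dotProduct, Finset.sum_div]
  symm
  trans ∑ j ∈ U, S.P t i j * S.x t j
  · apply Finset.sum_congr rfl
    intro j _
    rw [S.P_eq]; ring
  · apply Finset.sum_subset (Finset.subset_univ U)
    intro j _ hj
    rw [S.P_eq, h i hi j hj]; simp

lemma VV_succ (S : RevAvgSystem n ρ) {U : Finset (Fin n)} {t : ℕ} (h : Cl S U t) :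
    VV S U (t + 1) = VV S U t - ∑ i ∈ U, wv U (S.M t i) (S.x t) := by
  have e0 : ∀ g : Fin n → ℝ, ∑ i ∈ U, ∑ j ∈ U, S.M t i j * g j = ∑ j ∈ U, S.q j * g j := by
    intro g
    rw [Finset.sum_comm]
    apply Finset.sum_congr rfl
    intro j hj
    rw [← q_U S h hj, Finset.sum_mul]
    apply Finset.sum_congr rfl
    intro i _
    rw [S.M_symm]
  have e1 : ∑ i ∈ U, S.q i * S.x (t+1) i = ∑ i ∈ U, S.q i * S.x t i := by
    rw [← e0 (fun j => S.x t j)]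
    apply Finset.sum_congr rfl
    intro i hi
    rw [x_succ S h hi]
    have := (q_ge S i).ne'
    field_simp
  have e2 : ∑ i ∈ U, wv U (S.M t i) (S.x t) =
      ∑ i ∈ U, S.q i * S.x t i ^ 2 - ∑ i ∈ U, S.q i * S.x (t+1) i ^ 2 := by
    rw [← e0 (fun j => S.x t j ^ 2), ← Finset.sum_sub_distrib]
    apply Finset.sum_congr rfl
    intro i hi
    rw [wv, q_U S h hi, x_succ S h hi]
    have := (q_ge S i).ne'
    field_simp
  rw [e2, VV, VV, wv, wv, e1]
  ring

lemma VV_anti (S : RevAvgSystem n ρ) {U : Finset (Fin n)} {a b : ℕ} (hab : a ≤ b)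
    (h : ∀ t ∈ Finset.Ico a b, Cl S U t) : VV S U b ≤ VV S U a := by
  induction b, hab using Nat.le_induction with
  | base => exact le_rfl
  | succ b hb ih =>
    have h1 := ih (fun t ht => h t (by simp at ht ⊢; omega))
    have hc := h b (by simp; omega)
    rw [VV_succ S hc]
    have : 0 ≤ ∑ i ∈ U, wv U (S.M b i) (S.x b) := by
      apply Finset.sum_nonneg
      intro i hi
      apply wv_nonneg _ _ _ (fun j _ => S.M_nonneg b i j)
      rw [q_U S hc hi]; exact q_ge S i
    linarith

/-- cut `p` of `U` is crossed at time `t` -/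
def Xd (S : RevAvgSystem n ρ) (U : Finset (Fin n)) (p : Fin n → Prop) (t : ℕ) : Prop :=
  ∃ i ∈ U, ∃ j ∈ U, p i ∧ ¬ p j ∧ S.M t i j ≠ 0

/-- cut `p` of `U` is crossed in a window -/
def XE (S : RevAvgSystem n ρ) (U : Finset (Fin n)) (p : Fin n → Prop) (a b : ℕ) : Prop :=
  ∃ t ∈ Finset.Ico a b, Xd S U p t

/-- one-step drop -/
lemma drop_ge (S : RevAvgSystem n ρ) {U : Finset (Fin n)} {t : ℕ} (h : Cl S U t)
    (s : ℕ → ℝ) (hs : Monotone s) (k : ℕ) (C : Finset ℕ) (hC : C ⊆ Finset.range k)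
    (p : ℕ → Fin n → Prop)
    (hlo : ∀ d ∈ C, ∀ i ∈ U, p d i → S.x t i ≤ s d)
    (hhi : ∀ d ∈ C, ∀ i ∈ U, ¬ p d i → s (d + 1) ≤ S.x t i)
    (hX : ∀ d ∈ C, Xd S U (p d) t) :
    VV S U (t + 1) + ∑ d ∈ C, (s (d + 1) - s d) ^ 2 ≤ VV S U t := by
  rw [VV_succ S h]
  have hQ : ∀ i ∈ U, 0 < ∑ j ∈ U, S.M t i j := by
    intro i hi; rw [q_U S h hi]; exact q_ge S i
  have h1 : ∑ d ∈ C, ∑ i ∈ U, wv U (S.M t i) (fun j => clp s d (S.x t j)) ≤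
      ∑ i ∈ U, wv U (S.M t i) (S.x t) := by
    rw [Finset.sum_comm]
    apply Finset.sum_le_sum
    intro i hi
    exact wv_clp U _ _ (fun j _ => S.M_nonneg t i j) (hQ i hi) s hs k C hC
  have h2 : ∑ d ∈ C, (s (d + 1) - s d) ^ 2 ≤
      ∑ d ∈ C, ∑ i ∈ U, wv U (S.M t i) (fun j => clp s d (S.x t j)) := by
    apply Finset.sum_le_sum
    intro d hd
    obtain ⟨i, hi, j, hj, pi, pj, hM⟩ := hX d hd
    have hsd := hs (Nat.le_succ d)
    simp only [Nat.succ_eq_add_one] at hsd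
    have f0 : ∀ l ∈ U, p d l → clp s d (S.x t l) = 0 := by
      intro l hl hp
      have := hlo d hd l hl hp
      rw [clp, min_eq_left this, min_eq_left (this.trans hsd), sub_self]
    have f1 : ∀ l ∈ U, ¬ p d l → clp s d (S.x t l) = s (d+1) - s d := by
      intro l hl hp
      have := hhi d hd l hl hp
      rw [clp, min_eq_right this, min_eq_right (hsd.trans this)]
    have hij : i ≠ j := fun e => pj (e ▸ pi)
    have b1 := wv_two U (S.M t i) (fun l => clp s d (S.x t l)) (fun l _ => S.M_nonneg t i l)
      (s (d+1) - s d) (p d) f0 f1 i j hi hj pi pj (M_diag S t i) (S.M_ge_one t i j hM)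
    have b2 := wv_two U (S.M t j) (fun l => clp s d (S.x t l)) (fun l _ => S.M_nonneg t j l)
      (s (d+1) - s d) (p d) f0 f1 i j hi hj pi pj
      (S.M_ge_one t j i (by rwa [S.M_symm])) (M_diag S t j)
    have b3 : ∑ l ∈ ({i, j} : Finset (Fin n)), wv U (S.M t l) (fun j => clp s d (S.x t j)) ≤
        ∑ i ∈ U, wv U (S.M t i) (fun j => clp s d (S.x t j)) := by
      apply Finset.sum_le_sum_of_subset_of_nonneg
      · intro l hl
        simp at hl
        rcases hl with rfl | rfl <;> assumption
      · intro l hl _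
        exact wv_nonneg _ _ _ (fun j _ => S.M_nonneg t l j) (hQ l hl)
    rw [Finset.sum_pair hij] at b3
    linarith
  linarith

/-- separation persists while the cut is uncrossed -/
lemma persist (S : RevAvgSystem n ρ) {U : Finset (Fin n)} {a b : ℕ} (hab : a ≤ b)
    (h : ∀ t ∈ Finset.Ico a b, Cl S U t) (p : Fin n → Prop) (lo hi : ℝ)
    (hlo : ∀ i ∈ U, p i → S.x a i ≤ lo) (hhi : ∀ i ∈ U, ¬ p i → hi ≤ S.x a i)
    (hX : ∀ t ∈ Finset.Ico a b, ¬ Xd S U p t) :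
    (∀ i ∈ U, p i → S.x b i ≤ lo) ∧ (∀ i ∈ U, ¬ p i → hi ≤ S.x b i) := by
  induction b, hab using Nat.le_induction with
  | base => exact ⟨hlo, hhi⟩
  | succ b hb ih =>
    obtain ⟨i1, i2⟩ := ih (fun t ht => h t (by simp at ht ⊢; omega))
      (fun t ht => hX t (by simp at ht ⊢; omega))
    have hc := h b (by simp; omega)
    have hx := hX b (by simp; omega)
    constructor
    · intro i hi pi
      rw [x_succ S hc hi, div_le_iff₀ (q_ge S i), ← q_U S hc hi, Finset.mul_sum]
      apply Finset.sum_le_sum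
      intro j hj
      by_cases hM : S.M b i j = 0
      · simp [hM]
      · have pj : p j := by
          by_contra pj
          exact hx ⟨i, hi, j, hj, pi, pj, hM⟩
        rw [mul_comm]
        exact mul_le_mul_of_nonneg_right (i1 j hj pj) (S.M_nonneg b i j)
    · intro i hi pi
      rw [x_succ S hc hi, le_div_iff₀ (q_ge S i), ← q_U S hc hi, Finset.mul_sum]
      apply Finset.sum_le_sum
      intro j hj
      by_cases hM : S.M b i j = 0
      · simp [hM]
      · have pj : ¬ p j := by
          intro pj
          exact hx ⟨j, hj, i, hi, pj, pi, by rwa [S.M_symm]⟩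
        rw [mul_comm (S.M b i j)]
        exact mul_le_mul_of_nonneg_right (i2 j hj pj) (S.M_nonneg b i j)

open Classical in
/-- total drop over a window -/
lemma total_drop (S : RevAvgSystem n ρ) {U : Finset (Fin n)} {a b : ℕ} (hab : a ≤ b)
    (h : ∀ t ∈ Finset.Ico a b, Cl S U t)
    (s : ℕ → ℝ) (hs : Monotone s) (k : ℕ) (p : ℕ → Fin n → Prop)
    (hlo : ∀ d < k, ∀ i ∈ U, p d i → S.x a i ≤ s d)
    (hhi : ∀ d < k, ∀ i ∈ U, ¬ p d i → s (d + 1) ≤ S.x a i) :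
    VV S U b + ∑ d ∈ (Finset.range k).filter (fun d => XE S U (p d) a b),
      (s (d + 1) - s d) ^ 2 ≤ VV S U a := by
  induction b, hab using Nat.le_induction with
  | base => simp [XE]
  | succ b hb ih =>
    have ih := ih (fun t ht => h t (by simp at ht ⊢; omega))
    have hc := h b (by simp; omega)
    set C := (Finset.range k).filter (fun d => Xd S U (p d) b ∧
      ∀ t ∈ Finset.Ico a b, ¬ Xd S U (p d) t) with hC
    have hp : ∀ d ∈ C, _ := fun d hd => persist S hb (fun t ht => h t (by simp at ht ⊢; omega))
      (p d) (s d) (s (d+1)) (hlo d (by simp [hC] at hd; omega)) (hhi d (by simp [hC] at hd; omega))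
      (Finset.mem_filter.1 hd).2.2
    have hd := drop_ge S hc s hs k C (Finset.filter_subset _ _) p
      (fun d hd => (hp d hd).1) (fun d hd => (hp d hd).2)
      (fun d hd => (Finset.mem_filter.1 hd).2.1)
    have hsub : (Finset.range k).filter (fun d => XE S U (p d) a (b + 1)) ⊆
      (Finset.range k).filter (fun d => XE S U (p d) a b) ∪ C := by
      intro d hd
      simp only [Finset.mem_filter, Finset.mem_union, hC] at hd ⊢
      obtain ⟨hk, t, ht, hx⟩ := hd
      by_cases hh : XE S U (p d) a b
      · exact Or.inl ⟨hk, hh⟩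
      · right
        unfold XE at hh
        push Not at hh
        refine ⟨hk, ?_, hh⟩
        have : t = b := by
          by_contra hne
          exact hh t (by simp at ht ⊢; omega) hx
        exact this ▸ hx
    have h1 := Finset.sum_le_sum_of_subset_of_nonneg (f := fun d => (s (d + 1) - s d) ^ 2) hsub
      (fun d _ _ => sq_nonneg _)
    have h2 := Finset.sum_union_inter (f := fun d => (s (d + 1) - s d) ^ 2)
      (s₁ := (Finset.range k).filter (fun d => XE S U (p d) a b)) (s₂ := C)
    have h3 := Finset.sum_nonneg (s := (Finset.range k).filter
      (fun d => XE S U (p d) a b) ∩ C)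
      (f := fun d => (s (d + 1) - s d) ^ 2) (fun d _ => sq_nonneg _)
    linarith

lemma VV_le_diam (S : RevAvgSystem n ρ) (hρ : 0 < ρ) {U : Finset (Fin n)} (hU : U.Nonempty)
    {t : ℕ} {lo hi : ℝ} (h : ∀ i ∈ U, lo ≤ S.x t i ∧ S.x t i ≤ hi) :
    VV S U t ≤ U.card / ρ * ((hi - lo) ^ 2 / 4) := by
  refine (wv_le U S.q (S.x t) (Q_pos S U hU) ((lo + hi) / 2)).trans ?_
  calc _ ≤ ∑ i ∈ U, 1 / ρ * ((hi - lo) ^ 2 / 4) := by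
        apply Finset.sum_le_sum
        intro i hi'
        apply mul_le_mul (S.q_le i) _ (sq_nonneg _) (by positivity)
        obtain ⟨h1, h2⟩ := h i hi'
        nlinarith
    _ = _ := by rw [Finset.sum_const, nsmul_eq_mul]; ring

lemma long_VV (S : RevAvgSystem n ρ) {ε : ℝ} (hε : 0 < ε) {U : Finset (Fin n)} {t : ℕ}
    (h : Lg S ε U t) : ε ^ 2 / 2 ≤ VV S U t := by
  obtain ⟨i, hi, j, hj, _, hl⟩ := h
  obtain ⟨c, hc⟩ := wv_eq U S.q (S.x t) (Q_pos S U ⟨i, hi⟩)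
  have hij : i ≠ j := by
    rintro rfl
    simp at hl; linarith
  have b3 : ∑ l ∈ ({i, j} : Finset (Fin n)), S.q l * (S.x t l - c) ^ 2 ≤
      ∑ l ∈ U, S.q l * (S.x t l - c) ^ 2 := by
    apply Finset.sum_le_sum_of_subset_of_nonneg
    · intro l hl
      simp at hl
      rcases hl with rfl | rfl <;> assumption
    · intro l hl _
      exact mul_nonneg (q_ge S l).le (sq_nonneg _)
  rw [Finset.sum_pair hij] at b3
  rw [VV, hc]
  have h1 := mul_le_mul_of_nonneg_right (q_one S i) (sq_nonneg (S.x t i - c))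
  have h2 := mul_le_mul_of_nonneg_right (q_one S j) (sq_nonneg (S.x t j - c))
  have h3 : ε ^ 2 ≤ (S.x t i - S.x t j) ^ 2 := by
    rw [← sq_abs (S.x t i - S.x t j)]
    exact pow_le_pow_left₀ hε.le hl 2
  nlinarith [sq_nonneg ((S.x t i - c) + (S.x t j - c))]

lemma VV_sub (S : RevAvgSystem n ρ) {U U' : Finset (Fin n)} (hs : U' ⊆ U) (hU : U'.Nonempty)
    (t : ℕ) : VV S U' t ≤ VV S U t := by
  obtain ⟨c, hc⟩ := wv_eq U S.q (S.x t) (Q_pos S U (hU.mono hs))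
  rw [VV, VV, hc]
  refine (wv_le U' S.q (S.x t) (Q_pos S U' hU) c).trans ?_
  exact Finset.sum_le_sum_of_subset_of_nonneg hs
    (fun l _ _ => mul_nonneg (q_ge S l).le (sq_nonneg _))

lemma cnt_split (S : RevAvgSystem n ρ) (ε : ℝ) (U : Finset (Fin n)) {a b c : ℕ} (h1 : a ≤ b)
    (h2 : b ≤ c) : cnt S ε U a c = cnt S ε U a b + cnt S ε U b c := by
  classical
  unfold cnt
  rw [← Finset.Ico_union_Ico_eq_Ico h1 h2, Finset.filter_union, Finset.card_union_of_disjoint]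
  exact Finset.disjoint_filter_filter (Finset.Ico_disjoint_Ico_consecutive a b c)

lemma cnt_one (S : RevAvgSystem n ρ) (ε : ℝ) (U : Finset (Fin n)) (a : ℕ) :
    cnt S ε U a (a + 1) ≤ 1 := by
  classical
  unfold cnt
  refine (Finset.card_filter_le _ _).trans ?_
  simp

lemma cnt_zero (S : RevAvgSystem n ρ) {ε : ℝ} (hε : 0 < ε) (U : Finset (Fin n)) {a b : ℕ}
    (h : ∀ t ∈ Finset.Ico a b, Cl S U t) (hV : VV S U a < ε ^ 2 / 2) : cnt S ε U a b = 0 := by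
  classical
  unfold cnt
  rw [Finset.card_eq_zero, Finset.filter_eq_empty_iff]
  intro t ht hl
  have h1 := long_VV S hε hl
  have h2 := VV_anti S (a := a) (b := t) (U := U) (by simp at ht; omega)
    (fun u hu => h u (by simp at hu ht ⊢; omega))
  linarith

lemma Cl_sub (S : RevAvgSystem n ρ) {U : Finset (Fin n)} {t : ℕ} (h : Cl S U t)
    (p : Fin n → Prop) [DecidablePred p] (hx : ¬ Xd S U p t) : Cl S (U.filter p) t ∧
    Cl S (U.filter (fun i => ¬ p i)) t := by
  constructor
  · intro i hi j hj
    simp only [Finset.mem_filter] at hi hj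
    by_contra hM
    by_cases hjU : j ∈ U
    · exact hx ⟨i, hi.1, j, hjU, hi.2, fun hp => hj ⟨hjU, hp⟩, hM⟩
    · exact hM (h i hi.1 j hjU)
  · intro i hi j hj
    simp only [Finset.mem_filter] at hi hj
    by_contra hM
    by_cases hjU : j ∈ U
    · refine hx ⟨j, hjU, i, hi.1, ?_, hi.2, by rwa [S.M_symm]⟩
      by_contra hp
      exact hj ⟨hjU, hp⟩
    · exact hM (h i hi.1 j hjU)

lemma Cl_path (S : RevAvgSystem n ρ) {U : Finset (Fin n)} {t : ℕ} (h : Cl S U t) {i r : Fin n}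
    (hi : i ∈ U) (hp : Relation.ReflTransGen (fun a b => S.M t a b ≠ 0) i r) : r ∈ U := by
  induction hp with
  | refl => exact hi
  | tail _ h2 ih =>
    by_contra hn
    exact h2 (h _ ih _ hn)

lemma Cm_sub (S : RevAvgSystem n ρ) {U A B : Finset (Fin n)} {t m : ℕ} (hA : A ⊆ U) (hB : B ⊆ U)
    (hd : Disjoint A B) (hBne : B.Nonempty) (cA : Cl S A t) (cB : Cl S B t)
    (h : Cm S U (m + 1) t) : Cm S A m t := by
  classical
  obtain ⟨R, hR, hc, hr⟩ := h
  refine ⟨R ∩ A, Finset.inter_subset_right, ?_, ?_⟩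
  · obtain ⟨b, hb⟩ := hBne
    obtain ⟨r, hrR, hp⟩ := hr b (hB hb)
    have hrB := Cl_path S cB hb hp
    have : R ∩ A ⊂ R := by
      refine Finset.ssubset_iff_subset_ne.2 ⟨Finset.inter_subset_left, ?_⟩
      intro e
      rw [← e] at hrR
      exact Finset.disjoint_left.1 hd (Finset.mem_inter.1 hrR).2 hrB
    have := Finset.card_lt_card this
    omega
  · intro i hi
    obtain ⟨r, hrR, hp⟩ := hr i (hA hi)
    exact ⟨r, Finset.mem_inter.2 ⟨hrR, Cl_path S cA hi hp⟩, hp⟩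

lemma cnt_sub (S : RevAvgSystem n ρ) (ε : ℝ) {U : Finset (Fin n)} {a b : ℕ}
    (p : Fin n → Prop) [DecidablePred p] (hx : ∀ t ∈ Finset.Ico a b, ¬ Xd S U p t) :
    cnt S ε U a b ≤ cnt S ε (U.filter p) a b + cnt S ε (U.filter (fun i => ¬ p i)) a b := by
  classical
  unfold cnt
  refine le_trans (Finset.card_le_card ?_) (Finset.card_union_le _ _)
  intro t ht
  simp only [Finset.mem_union, Finset.mem_filter] at ht ⊢
  obtain ⟨ht, i, hi, j, hj, hM, hl⟩ := ht
  have hx := hx t ht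
  by_cases pi : p i
  · left
    refine ⟨ht, i, by simp [hi, pi], j, ?_, hM, hl⟩
    simp only [Finset.mem_filter]
    refine ⟨hj, ?_⟩
    by_contra pj
    exact hx ⟨i, hi, j, hj, pi, pj, hM⟩
  · right
    refine ⟨ht, i, by simp [hi, pi], j, ?_, hM, hl⟩
    simp only [Finset.mem_filter]
    refine ⟨hj, ?_⟩
    intro pj
    exact hx ⟨j, hj, i, hi, pj, pi, by rwa [S.M_symm]⟩

/-- inductive claim -/
def Claim (S : RevAvgSystem n ρ) (ε K : ℝ) (m : ℕ) : Prop :=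
  ∀ (U : Finset (Fin n)) (a b : ℕ), U.Nonempty → a ≤ b →
    (∀ t ∈ Finset.Ico a b, Cl S U t) → (∀ t ∈ Finset.Ico a b, Cm S U m t) →
    VV S U a ≤ 1 → (1 + cnt S ε U a b : ℝ) ≤ ((U.card : ℝ) ^ 2 * K) ^ m

lemma claim_zero (S : RevAvgSystem n ρ) (ε K : ℝ) : Claim S ε K 0 := by
  classical
  intro U a b hU hab hcl hcm _
  have : a = b := by
    by_contra hne
    obtain ⟨R, _, hc, hr⟩ := hcm a (by simp; omega)
    obtain ⟨i, hi⟩ := hU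
    obtain ⟨r, hrR, _⟩ := hr i hi
    have : R = ∅ := by simpa using hc
    simp [this] at hrR
  subst this
  simp [cnt]

lemma uncrossed (S : RevAvgSystem n ρ) {ε K : ℝ} (hK : 0 ≤ K) {m : ℕ} (ih : Claim S ε K m)
    {U : Finset (Fin n)} {a b : ℕ} (hab : a ≤ b)
    (hcl : ∀ t ∈ Finset.Ico a b, Cl S U t) (hcm : ∀ t ∈ Finset.Ico a b, Cm S U (m + 1) t)
    (hV : VV S U a ≤ 1) (p : Fin n → Prop) (hp : ∃ i ∈ U, p i) (hnp : ∃ i ∈ U, ¬ p i)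
    (hx : ∀ t ∈ Finset.Ico a b, ¬ Xd S U p t) :
    (1 + cnt S ε U a b : ℝ) ≤ ((U.card : ℝ) ^ 2 * K) ^ m := by
  classical
  set A := U.filter p with hA
  set B := U.filter (fun i => ¬ p i) with hB
  have sA : A ⊆ U := Finset.filter_subset _ _
  have sB : B ⊆ U := Finset.filter_subset _ _
  have dAB : Disjoint A B := Finset.disjoint_filter_filter_not U U p
  have nA : A.Nonempty := by
    obtain ⟨i, hi, h⟩ := hp; exact ⟨i, by simp [hA, hi, h]⟩
  have nB : B.Nonempty := by
    obtain ⟨i, hi, h⟩ := hnp; exact ⟨i, by simp [hB, hi, h]⟩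
  have cl : ∀ t ∈ Finset.Ico a b, Cl S A t ∧ Cl S B t := fun t ht =>
    Cl_sub S (hcl t ht) p (hx t ht)
  have h1 := ih A a b nA hab (fun t ht => (cl t ht).1)
    (fun t ht => Cm_sub S sA sB dAB nB (cl t ht).1 (cl t ht).2 (hcm t ht))
    ((VV_sub S sA nA a).trans hV)
  have h2 := ih B a b nB hab (fun t ht => (cl t ht).2)
    (fun t ht => Cm_sub S sB sA dAB.symm nA (cl t ht).2 (cl t ht).1 (hcm t ht))
    ((VV_sub S sB nB a).trans hV)
  have h3 : (cnt S ε U a b : ℝ) ≤ cnt S ε A a b + cnt S ε B a b := by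
    exact_mod_cast cnt_sub S ε p hx
  have hcard : (U.card : ℝ) = A.card + B.card := by
    exact_mod_cast (Finset.card_filter_add_card_filter_not (s := U) p).symm
  rcases Nat.eq_zero_or_pos m with rfl | hm
  · simp only [pow_zero] at *
    linarith
  · have h4 : ((A.card : ℝ) ^ 2 * K) ^ m + ((B.card : ℝ) ^ 2 * K) ^ m ≤
        ((U.card : ℝ) ^ 2 * K) ^ m := by
      refine (pow_add_pow_le (by positivity) (by positivity) hm.ne').trans ?_
      apply pow_le_pow_left₀ (by positivity)
      rw [← add_mul]
      apply mul_le_mul_of_nonneg_right _ hK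
      rw [hcard]
      nlinarith [Nat.cast_nonneg (α := ℝ) A.card, Nat.cast_nonneg (α := ℝ) B.card,
        mul_nonneg (Nat.cast_nonneg (α := ℝ) A.card) (Nat.cast_nonneg (α := ℝ) B.card)]
    linarith

set_option maxHeartbeats 1000000 in
lemma phases (S : RevAvgSystem n ρ) (hρ : 0 < ρ) (hρ2 : ρ ≤ 1 / 2) {ε K : ℝ} (hε : 0 < ε)
    (hK : 0 ≤ K) {m : ℕ}
    (ih : Claim S ε K m) (U : Finset (Fin n)) (hU : U.Nonempty) (b k : ℕ) :
    ∀ a ≤ b, (∀ t ∈ Finset.Ico a b, Cl S U t) → (∀ t ∈ Finset.Ico a b, Cm S U (m + 1) t) →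
    VV S U a ≤ 1 → VV S U a * (1 - 4 * ρ / (U.card : ℝ) ^ 2) ^ k < ε ^ 2 / 2 →
    (cnt S ε U a b : ℝ) ≤ k * ((U.card : ℝ) ^ 2 * K) ^ m := by
  classical
  induction k with
  | zero =>
    intro a hab hcl hcm _ hV
    rw [cnt_zero S hε U hcl (by simpa using hV)]
    simp
  | succ k ihk =>
    intro a hab hcl hcm hV1 hV
    set G := ((U.card : ℝ) ^ 2 * K) ^ m with hG
    have hG0 : 0 ≤ G := by positivity
    obtain ⟨l, s, hl, hs, hbd, hgap, hne1, hne2⟩ := exists_levels U hU (S.x a)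
    rcases Nat.eq_zero_or_pos l with rfl | hlpos
    · have hd := VV_le_diam S hρ hU hbd
      rw [cnt_zero S hε U hcl]
      · push_cast; positivity
      · have : 0 < ε ^ 2 / 2 := by positivity
        simp at hd
        linarith
    have hcardN : 2 ≤ U.card := by omega
    have hcard : (2 : ℝ) ≤ U.card := by exact_mod_cast hcardN
    have hr : 0 ≤ 1 - 4 * ρ / (U.card : ℝ) ^ 2 := by
      rw [sub_nonneg, div_le_one (by positivity)]
      nlinarith
    let p : ℕ → Fin n → Prop := fun d i => S.x a i ≤ s d
    have key : ∀ c, a ≤ c → c ≤ b → (∃ d < l, ∀ t ∈ Finset.Ico a c, ¬ Xd S U (p d) t) →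
        (1 + cnt S ε U a c : ℝ) ≤ G := by
      rintro c hac hcb ⟨d, hd, hx⟩
      refine uncrossed S hK ih hac (fun t ht => hcl t (by simp at ht ⊢; omega))
        (fun t ht => hcm t (by simp at ht ⊢; omega)) hV1 (p d) (hne1 d hd) ?_ hx
      obtain ⟨i, hi, h⟩ := hne2 d hd
      exact ⟨i, hi, not_le.2 h⟩
    by_cases hall : ∃ d < l, ∀ t ∈ Finset.Ico a b, ¬ Xd S U (p d) t
    · have := key b hab le_rfl hall
      push_cast
      have : 0 ≤ (k : ℝ) * G := by positivity
      linarith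
    · -- find first time all are crossed
      let Pr : ℕ → Prop := fun c => a ≤ c ∧ ¬ ∃ d < l, ∀ t ∈ Finset.Ico a c, ¬ Xd S U (p d) t
      have hex : ∃ c, Pr c := ⟨b, hab, hall⟩
      set c := Nat.find hex with hc
      have hPc : Pr c := Nat.find_spec hex
      have hcb : c ≤ b := Nat.find_min' hex ⟨hab, hall⟩
      have hac : a < c := by
        rcases hPc.1.lt_or_eq with h | h
        · exact h
        · exfalso
          apply hPc.2
          rw [← h]
          exact ⟨0, hlpos, by simp⟩
      obtain ⟨c', hc'⟩ : ∃ c', c = c' + 1 := ⟨c - 1, by omega⟩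
      have hnot : ¬ Pr c' := Nat.find_min hex (by omega)
      have hac' : a ≤ c' := by omega
      have hun : ∃ d < l, ∀ t ∈ Finset.Ico a c', ¬ Xd S U (p d) t := by
        by_contra hh
        exact hnot ⟨hac', hh⟩
      have hk1 := key c' hac' (by omega) hun
      have hcl' : ∀ t ∈ Finset.Ico a c, Cl S U t := fun t ht => hcl t (by simp at ht ⊢; omega)
      have htd := total_drop S hac.le hcl' s hs l p (fun d _ i _ h => h)
        (fun d hd i hi h => hgap d hd i hi (not_le.1 h))
      rw [Finset.filter_true_of_mem] at htd
      swap
      · intro d hd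
        by_contra hh
        unfold XE at hh
        push Not at hh
        exact hPc.2 ⟨d, by simpa using hd, hh⟩
      have hcs := sq_sum_le_card_mul_sum_sq (s := Finset.range l) (f := fun d => s (d+1) - s d)
      rw [Finset.sum_range_sub, Finset.card_range] at hcs
      have hdm := VV_le_diam S hρ hU hbd
      set D := ∑ d ∈ Finset.range l, (s (d+1) - s d) ^ 2
      have hD : 0 ≤ D := Finset.sum_nonneg (fun d _ => sq_nonneg _)
      have hlc : (l : ℝ) ≤ U.card := by exact_mod_cast (by omega : l ≤ U.card)
      have hVD : VV S U a * (4 * ρ / (U.card : ℝ) ^ 2) ≤ D := by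
        have h1 : VV S U a ≤ U.card / ρ * (U.card * D / 4) := by
          refine hdm.trans ?_
          apply mul_le_mul_of_nonneg_left _ (by positivity)
          nlinarith
        calc _ ≤ U.card / ρ * (U.card * D / 4) * (4 * ρ / (U.card : ℝ) ^ 2) :=
              mul_le_mul_of_nonneg_right h1 (by positivity)
          _ = D := by
            have hc0 : (U.card : ℝ) ≠ 0 := by positivity
            clear_value D
            generalize (U.card : ℝ) = N at hc0
            field_simp
      have hVc : VV S U c ≤ VV S U a * (1 - 4 * ρ / (U.card : ℝ) ^ 2) := by
        rw [mul_sub, mul_one]; linarith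
      have hrest := ihk c hcb (fun t ht => hcl t (by simp at ht ⊢; omega))
        (fun t ht => hcm t (by simp at ht ⊢; omega)) ((VV_anti S hac.le hcl').trans hV1) (by
          refine lt_of_le_of_lt (mul_le_mul_of_nonneg_right hVc (pow_nonneg hr k)) ?_
          rw [mul_assoc, ← pow_succ']
          exact hV)
      have e1 := cnt_split S ε U hac.le hcb
      have e2 := cnt_split S ε U hac' (by omega : c' ≤ c)
      have e3 := cnt_one S ε U c'
      rw [← hc'] at e3
      have e4 : (cnt S ε U a b : ℝ) ≤ cnt S ε U a c' + 1 + cnt S ε U c b := by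
        exact_mod_cast (by omega : cnt S ε U a b ≤ cnt S ε U a c' + 1 + cnt S ε U c b)
      push_cast
      linarith

lemma claim_succ (S : RevAvgSystem n ρ) (hρ : 0 < ρ) (hρ2 : ρ ≤ 1 / 2) {ε : ℝ} (hε : 0 < ε)
    (hL : 1 ≤ Real.log (1 / ε)) {m : ℕ}
    (ih : Claim S ε (Real.log (1 / ε) / ρ) m) : Claim S ε (Real.log (1 / ε) / ρ) (m + 1) := by
  intro U a b hU hab hcl hcm hV
  set L := Real.log (1 / ε) with hLdef
  have hK : 2 ≤ L / ρ := by
    rw [le_div_iff₀ hρ]; linarith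
  have hN : (1 : ℝ) ≤ U.card := by exact_mod_cast hU.card_pos
  have hN2 : (1 : ℝ) ≤ (U.card : ℝ) ^ 2 := one_le_pow₀ hN
  have hB1 : 1 ≤ (U.card : ℝ) ^ 2 * (L / ρ) := by nlinarith
  rcases hN.lt_or_eq with hlt | heq
  swap
  · -- singleton
    have hc1 : U.card = 1 := by exact_mod_cast heq.symm
    obtain ⟨u, rfl⟩ := Finset.card_eq_one.1 hc1
    have : cnt S ε {u} a b = 0 := by
      classical
      unfold cnt
      rw [Finset.card_eq_zero, Finset.filter_eq_empty_iff]
      rintro t _ ⟨i, hi, j, hj, _, h⟩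
      simp at hi hj
      subst hi; subst hj
      simp at h; linarith
    rw [this]
    simpa using one_le_pow₀ hB1
  have hcN : 2 ≤ U.card := by
    have : 1 < U.card := by exact_mod_cast hlt
    omega
  have hc2 : (2 : ℝ) ≤ U.card := by exact_mod_cast hcN
  have hc4 : (4 : ℝ) ≤ (U.card : ℝ) ^ 2 := by nlinarith
  set N2 := (U.card : ℝ) ^ 2 with hN2def
  set A := N2 / (4 * ρ) * (Real.log 2 + 2 * L) with hA
  have hlog2 : Real.log 2 ≤ 0.7 := Real.log_two_lt_d9.le.trans (by norm_num)
  have hlog2' : 0 ≤ Real.log 2 := Real.log_nonneg (by norm_num)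
  have hA0 : 0 ≤ A := by
    apply mul_nonneg <;> positivity
  set k := ⌊A⌋₊ + 1 with hk
  have hkA : A < k := by rw [hk]; push_cast; exact Nat.lt_floor_add_one A
  have hkA2 : (k : ℝ) ≤ A + 1 := by
    rw [hk]; push_cast; linarith [Nat.floor_le hA0]
  have hr : 0 ≤ 1 - 4 * ρ / N2 := by
    rw [sub_nonneg, div_le_one (by positivity)]
    linarith
  have hexp : (1 - 4 * ρ / N2) ^ k < ε ^ 2 / 2 := by
    have h1 : 1 - 4 * ρ / N2 ≤ Real.exp (-(4 * ρ / N2)) := by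
      have := Real.add_one_le_exp (-(4 * ρ / N2)); linarith
    calc _ ≤ Real.exp (-(4 * ρ / N2)) ^ k := pow_le_pow_left₀ hr h1 k
      _ = Real.exp (k * (-(4 * ρ / N2))) := (Real.exp_nat_mul _ k).symm
      _ < Real.exp (-(Real.log 2 + 2 * L)) := by
          apply Real.exp_lt_exp.2
          have h2 : A * (4 * ρ / N2) = Real.log 2 + 2 * L := by
            rw [hA]; field_simp
          have h3 : A * (4 * ρ / N2) < k * (4 * ρ / N2) :=
            mul_lt_mul_of_pos_right hkA (by positivity)
          linarith
      _ = ε ^ 2 / 2 := by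
          have : -(Real.log 2 + 2 * L) = Real.log (ε ^ 2 / 2) := by
            rw [Real.log_div (by positivity) (by norm_num), Real.log_pow, hLdef, one_div,
              Real.log_inv]
            push_cast; ring
          rw [this, Real.exp_log (by positivity)]
  have hV0 : 0 ≤ VV S U a := wv_nonneg _ _ _ (fun i _ => (q_ge S i).le) (Q_pos S U hU)
  have hph := phases S hρ hρ2 hε (by linarith : 0 ≤ L / ρ) ih U hU b k a hab hcl hcm hV (by
    refine lt_of_le_of_lt ?_ hexp
    have := mul_le_mul_of_nonneg_right hV (pow_nonneg hr k)
    simpa using this)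
  have hkB : (k : ℝ) ≤ N2 * (L / ρ) - 1 := by
    have h1 : A = N2 / ρ * ((Real.log 2 + 2 * L) / 4) := by rw [hA]; field_simp
    have h2 : N2 * (L / ρ) = N2 / ρ * L := by field_simp
    have h3 : 8 ≤ N2 / ρ := by rw [le_div_iff₀ hρ]; linarith
    rw [h2]
    nlinarith
  have hG1 : 1 ≤ (N2 * (L / ρ)) ^ m := one_le_pow₀ hB1
  rw [pow_succ]
  nlinarith

end RevProof

open RevProof in
/-- There is an absolute constant `c > 0` such that for every `n ≥ 2`,
`ρ ∈ (0,1/2]`, `m` with `1 ≤ m ≤ n−1`, and all sufficiently small `ε > 0`, reversible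
averaging systems (with at most `m` connected components and initial scaled variance
at most 1) satisfy `T^rev_{m,ε} ≤ c·((n²/ρ)·log(1/ε))^m`. -/
theorem revConvergenceTime_le :
    ∃ c : ℝ, 0 < c ∧
      ∀ (n m : ℕ) (ρ : ℝ), 2 ≤ n → 0 < ρ → ρ ≤ 1 / 2 → 1 ≤ m → m ≤ n - 1 →
        ∃ ε₀ : ℝ, 0 < ε₀ ∧
          ∀ ε : ℝ, 0 < ε → ε ≤ ε₀ →
            ∀ S : RevAvgSystem n ρ,
              S.toAvgSystem.componentsLE m →
              initVarLEOne S.q (S.x 0) →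
              ((S.toAvgSystem.longTimes ε).encard : ℝ≥0∞) ≤
                ENNReal.ofReal (c * ((n ^ 2 / ρ) * Real.log (1 / ε)) ^ m) := by
  refine ⟨1, one_pos, ?_⟩
  intro n m ρ hn hρ hρ2 hm hmn
  refine ⟨Real.exp (-1), Real.exp_pos _, ?_⟩
  intro ε hε hε0 S hcomp hvar
  have hL : 1 ≤ Real.log (1 / ε) := by
    rw [one_div, Real.log_inv]
    have := Real.log_le_log hε hε0
    rw [Real.log_exp] at this
    linarith
  have hclaim : ∀ m, Claim S ε (Real.log (1 / ε) / ρ) m := by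
    intro m
    induction m with
    | zero => exact claim_zero S ε _
    | succ m ih => exact claim_succ S hρ hρ2 hε hL ih
  have hne : (Finset.univ : Finset (Fin n)).Nonempty := ⟨⟨0, by omega⟩, Finset.mem_univ _⟩
  have hcm : ∀ t, Cm S Finset.univ m t := by
    classical
    intro t
    obtain ⟨c, hc1, hc2⟩ := hcomp t
    have hex : ∀ v : Fin m, ∃ r : Fin n, (∃ i, c i = v) → c r = v := by
      intro v
      by_cases h : ∃ i, c i = v
      · obtain ⟨i, hi⟩ := h
        exact ⟨i, fun _ => hi⟩
      · exact ⟨⟨0, by omega⟩, fun h' => absurd h' h⟩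
    choose r hr using hex
    refine ⟨Finset.univ.image r, Finset.subset_univ _, ?_, ?_⟩
    · exact Finset.card_image_le.trans (by simp)
    · intro i _
      refine ⟨r (c i), by simp, ?_⟩
      have := hc2 i (r (c i)) (hr (c i) ⟨i, rfl⟩).symm
      exact Relation.ReflTransGen.mono (fun a b h => (P_ne S t a b).1 h) _ _ this
  have hV : VV S Finset.univ 0 ≤ 1 :=
    (wv_le _ _ _ (Q_pos S _ hne) _).trans hvar
  have hb : ∀ b, (1 + cnt S ε Finset.univ 0 b : ℝ) ≤
      ((n : ℝ) ^ 2 * (Real.log (1 / ε) / ρ)) ^ m := by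
    intro b
    have := hclaim m Finset.univ 0 b hne (Nat.zero_le b)
      (fun t _ i _ j hj => absurd (Finset.mem_univ j) hj) (fun t _ => hcm t) hV
    simpa using this
  have hBe : (1 : ℝ) * (((n : ℝ) ^ 2 / ρ) * Real.log (1 / ε)) ^ m =
      ((n : ℝ) ^ 2 * (Real.log (1 / ε) / ρ)) ^ m := by
    rw [one_mul]; congr 1; ring
  rw [hBe]
  set B := ((n : ℝ) ^ 2 * (Real.log (1 / ε) / ρ)) ^ m with hB
  have hB0 : 0 ≤ B := by
    have := hb 0
    have h2 : (0 : ℝ) ≤ cnt S ε Finset.univ 0 0 := Nat.cast_nonneg _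
    linarith
  have henc : (S.toAvgSystem.longTimes ε).encard ≤ (⌊B⌋₊ : ℕ∞) := by
    classical
    by_contra hlt
    push Not at hlt
    have hle : ((⌊B⌋₊ + 1 : ℕ) : ℕ∞) ≤ (S.toAvgSystem.longTimes ε).encard := by
      push_cast
      exact Order.add_one_le_of_lt hlt
    obtain ⟨T, hT, hTc⟩ := Set.exists_subset_encard_eq hle
    have hfin : T.Finite := Set.finite_of_encard_eq_coe hTc
    obtain ⟨b, hbT⟩ := hfin.bddAbove
    have hsub : hfin.toFinset ⊆ (Finset.Ico 0 (b + 1)).filter (Lg S ε Finset.univ) := by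
      intro t ht
      have htT : t ∈ T := by simpa using ht
      have h1 := hbT htT
      obtain ⟨i, j, hP, hl⟩ := hT htT
      simp only [Finset.mem_filter, Finset.mem_Ico]
      exact ⟨⟨Nat.zero_le _, by omega⟩, i, Finset.mem_univ _, j, Finset.mem_univ _,
        (P_ne S t i j).1 hP, hl⟩
    have hcard := Finset.card_le_card hsub
    have hTcard : hfin.toFinset.card = ⌊B⌋₊ + 1 := by
      rw [hfin.encard_eq_coe_toFinset_card] at hTc
      exact_mod_cast hTc
    have h2 : ⌊B⌋₊ + 1 ≤ cnt S ε Finset.univ 0 (b + 1) := by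
      rw [← hTcard]
      unfold cnt
      convert hcard
    have h3 : ((⌊B⌋₊ + 1 : ℕ) : ℝ) ≤ cnt S ε Finset.univ 0 (b + 1) := by exact_mod_cast h2
    have h4 := hb (b + 1)
    have h5 := Nat.lt_floor_add_one B
    push_cast at h3
    linarith
  calc ((S.toAvgSystem.longTimes ε).encard : ℝ≥0∞) ≤ ((⌊B⌋₊ : ℕ∞) : ℝ≥0∞) := by
        exact_mod_cast henc
    _ = ENNReal.ofReal (⌊B⌋₊ : ℝ) := by simp
    _ ≤ ENNReal.ofReal B := ENNReal.ofReal_le_ofReal (Nat.floor_le hB0)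
end

section
/- In the bird flocking model with at most m flocks at every time, there is a constant c = c(ε_o) such that for every bird i and every integer t > 1: ‖ v_i(t) − (1/t)·(x_i(t) − x_i(0)) ‖ ≤ c · n^{2(m+2)} · (1/ρ)^{m+1} · (log t)/t. -/
open scoped BigOperators

/-- The Vicsek–Cucker–Smale bird flocking model with hysteresis: `n` birds with
positions `x t i` and velocities `v t i` in `ℝ³`, interaction radius `r`, hysteresis
threshold `εo`, and influence weights `a i`.  `N t i` is the set of neighbors of bird
`i` in the flocking network `G t`. -/
structure Flock (n : ℕ) (r εo : ℝ) (a : Fin n → ℝ) where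
  x : ℕ → Fin n → EuclideanSpace ℝ (Fin 3)
  v : ℕ → Fin n → EuclideanSpace ℝ (Fin 3)
  N : ℕ → Fin n → Finset (Fin n)
  network_symm : ∀ t i j, j ∈ N t i ↔ i ∈ N t j
  network_irrefl : ∀ t i, i ∉ N t i
  weight_pos : ∀ i, 0 < a i
  weight_le : ∀ t i, a i ≤ 1 / ((N t i).card + 1)
  radius : ∀ t i j, j ∈ N t i → dist (x t i) (x t j) ≤ r
  /-- An edge persists as long as the two birds stay within distance `r`. -/
  persist : ∀ t i j, j ∈ N t i → dist (x (t + 1) i) (x (t + 1) j) ≤ r → j ∈ N (t + 1) i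
  /-- A new edge appears exactly when the birds are within distance `r` and their
  velocities differ by more than `εo`. -/
  newEdge : ∀ t i j, i ≠ j → j ∉ N t i →
    (j ∈ N (t + 1) i ↔
      dist (x (t + 1) i) (x (t + 1) j) ≤ r ∧ εo < ‖v (t + 1) i - v (t + 1) j‖)
  updateV : ∀ t i, v (t + 1) i = v t i + a i • ∑ j ∈ N t i, (v t j - v t i)
  updateX : ∀ t i, x (t + 1) i = x t i + v (t + 1) i

/-- The flocking network has at most `m` flocks (connected components) at every time. -/
def Flock.flocksLE {n : ℕ} {r εo : ℝ} {a : Fin n → ℝ} (S : Flock n r εo a) (m : ℕ) :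
    Prop :=
  ∀ t : ℕ, ∃ c : Fin n → Fin m,
    (∀ i j, j ∈ S.N t i → c i = c j) ∧
    (∀ i j, c i = c j → Relation.ReflTransGen (fun p q => q ∈ S.N t p) i j)

abbrev E3 := EuclideanSpace ℝ (Fin 3)

/-- Local variance estimate at a single vertex. -/
lemma local_drop {n : ℕ} (N : Finset (Fin n)) (a : ℝ) (ha : 0 < a)
    (hle : a ≤ 1 / ((N.card : ℝ) + 1)) (y : Fin n → E3) (j : Fin n) (hj : j ∈ N) :
    a * ‖∑ k ∈ N, y k‖ ^ 2 + (1 / 2) * ‖y j‖ ^ 2 ≤ ∑ k ∈ N, ‖y k‖ ^ 2 := by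
  classical
  have h1 : ‖∑ k ∈ N, y k‖ ≤ ∑ k ∈ N, ‖y k‖ := norm_sum_le _ _
  have hg : ∑ k ∈ N, (if k = j then (2 : ℝ) else 1) = N.card + 1 := by
    have : ∀ k ∈ N, (if k = j then (2 : ℝ) else 1) = 1 + (if k = j then (1 : ℝ) else 0) := by
      intro k _; split_ifs <;> norm_num
    rw [Finset.sum_congr rfl this, Finset.sum_add_distrib]
    simp [hj]
  have h2 := Finset.sq_sum_div_le_sum_sq_div N (fun k => ‖y k‖)
    (g := fun k => if k = j then (2 : ℝ) else 1) (by intro k _; split_ifs <;> norm_num)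
  rw [hg] at h2
  have h3 : ∑ k ∈ N, ‖y k‖ ^ 2 / (if k = j then (2 : ℝ) else 1)
      = ∑ k ∈ N, ‖y k‖ ^ 2 - (1 / 2) * ‖y j‖ ^ 2 := by
    have : ∀ k ∈ N, ‖y k‖ ^ 2 / (if k = j then (2 : ℝ) else 1)
        = ‖y k‖ ^ 2 - (if k = j then (1 / 2) * ‖y k‖ ^ 2 else 0) := by
      intro k _; split_ifs <;> ring
    rw [Finset.sum_congr rfl this, Finset.sum_sub_distrib]
    simp [hj]
  rw [h3] at h2
  have h4 : a * ‖∑ k ∈ N, y k‖ ^ 2 ≤ (∑ k ∈ N, ‖y k‖) ^ 2 / ((N.card : ℝ) + 1) := by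
    have : ‖∑ k ∈ N, y k‖ ^ 2 ≤ (∑ k ∈ N, ‖y k‖) ^ 2 := by gcongr
    calc a * ‖∑ k ∈ N, y k‖ ^ 2 ≤ (1 / ((N.card : ℝ) + 1)) * (∑ k ∈ N, ‖y k‖) ^ 2 := by
          gcongr
      _ = _ := by ring
  linarith

lemma local_drop0 {n : ℕ} (N : Finset (Fin n)) (a : ℝ) (ha : 0 < a)
    (hle : a ≤ 1 / ((N.card : ℝ) + 1)) (y : Fin n → E3) :
    a * ‖∑ k ∈ N, y k‖ ^ 2 ≤ ∑ k ∈ N, ‖y k‖ ^ 2 := by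
  rcases N.eq_empty_or_nonempty with h | ⟨j, hj⟩
  · simp [h]
  · have := local_drop N a ha hle y j hj
    nlinarith [sq_nonneg ‖y j‖]

/-- Per-vertex expansion. -/
lemma vertex_expand {n : ℕ} (N : Finset (Fin n)) (a : ℝ) (ha : 0 < a) (w : Fin n → E3)
    (i : Fin n) :
    (1 / a) * ‖w i + a • ∑ j ∈ N, (w j - w i)‖ ^ 2 =
      (1 / a) * ‖w i‖ ^ 2 + ∑ j ∈ N, (‖w j‖ ^ 2 - ‖w i‖ ^ 2)
        - (∑ j ∈ N, ‖w j - w i‖ ^ 2 - a * ‖∑ j ∈ N, (w j - w i)‖ ^ 2) := by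
  have h1 : ∀ j, ‖w j‖ ^ 2 - ‖w i‖ ^ 2 = ‖w j - w i‖ ^ 2 + 2 * inner ℝ (w i) (w j - w i) := by
    intro j
    have := norm_add_sq_real (w i) (w j - w i)
    rw [add_sub_cancel] at this
    linarith
  rw [norm_add_sq_real, inner_smul_right, norm_smul, inner_sum]
  simp only [h1, Finset.sum_add_distrib, ← Finset.mul_sum]
  rw [Real.norm_of_nonneg ha.le]
  field_simp
  ring

lemma energy_drop {n : ℕ} (N : Fin n → Finset (Fin n)) (hs : ∀ i j, j ∈ N i ↔ i ∈ N j)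
    (a : Fin n → ℝ) (ha : ∀ i, 0 < a i) (hle : ∀ i, a i ≤ 1 / (((N i).card : ℝ) + 1))
    (w : Fin n → E3) (i₀ j₀ : Fin n) (h₀ : j₀ ∈ N i₀) :
    ∑ i, (1 / a i) * ‖w i + a i • ∑ j ∈ N i, (w j - w i)‖ ^ 2 + (1 / 2) * ‖w i₀ - w j₀‖ ^ 2
      ≤ ∑ i, (1 / a i) * ‖w i‖ ^ 2 := by
  classical
  have hz : ∑ i, ∑ j ∈ N i, (‖w j‖ ^ 2 - ‖w i‖ ^ 2) = 0 := by
    have e : ∑ i, ∑ j ∈ N i, ‖w j‖ ^ 2 = ∑ j, ∑ i ∈ N j, ‖w j‖ ^ 2 := by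
      apply Finset.sum_comm'
      intro x y; simp [hs x y]
    simp only [Finset.sum_sub_distrib]
    rw [e, sub_self]
  have hv : ∀ i, (1 / a i) * ‖w i + a i • ∑ j ∈ N i, (w j - w i)‖ ^ 2
      + (if i = i₀ then (1 / 2) * ‖w i₀ - w j₀‖ ^ 2 else 0) ≤
      (1 / a i) * ‖w i‖ ^ 2 + ∑ j ∈ N i, (‖w j‖ ^ 2 - ‖w i‖ ^ 2) := by
    intro i
    rw [vertex_expand (N i) (a i) (ha i)]
    split_ifs with h
    · subst h
      have := local_drop (N i) (a i) (ha i) (hle i) (fun j => w j - w i) j₀ h₀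
      rw [norm_sub_rev (w i) (w j₀)]
      linarith
    · have := local_drop0 (N i) (a i) (ha i) (hle i) (fun j => w j - w i)
      linarith
  have := Finset.sum_le_sum (s := Finset.univ) (fun i _ => hv i)
  simp only [Finset.sum_add_distrib, hz] at this
  simpa using this

lemma energy_drop0 {n : ℕ} (N : Fin n → Finset (Fin n)) (hs : ∀ i j, j ∈ N i ↔ i ∈ N j)
    (a : Fin n → ℝ) (ha : ∀ i, 0 < a i) (hle : ∀ i, a i ≤ 1 / (((N i).card : ℝ) + 1))
    (w : Fin n → E3) :
    ∑ i, (1 / a i) * ‖w i + a i • ∑ j ∈ N i, (w j - w i)‖ ^ 2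
      ≤ ∑ i, (1 / a i) * ‖w i‖ ^ 2 := by
  by_cases h : ∃ i j, j ∈ N i
  · obtain ⟨i, j, hij⟩ := h
    have := energy_drop N hs a ha hle w i j hij
    nlinarith [sq_nonneg ‖w i - w j‖]
  · push Not at h
    have : ∀ i, N i = ∅ := fun i => Finset.eq_empty_of_forall_notMem (h i)
    simp [this]

lemma reach_le {n : ℕ} (G : SimpleGraph (Fin n)) (v : Fin n → E3) (b : ℝ) (hb : 0 ≤ b)
    (h : ∀ i j, G.Adj i j → ‖v i - v j‖ ≤ b) (i j : Fin n) (hr : G.Reachable i j) :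
    ‖v i - v j‖ ≤ n * b := by
  classical
  obtain ⟨p, hp⟩ := hr.exists_isPath
  have hl : p.length < n := by simpa using hp.length_lt
  have key : ∀ (x y : Fin n) (q : G.Walk x y), ‖v x - v y‖ ≤ q.length * b := by
    intro x y q
    induction q with
    | nil => simp
    | @cons x y z hxy q ih =>
      have : v x - v z = (v x - v y) + (v y - v z) := by abel
      rw [this, SimpleGraph.Walk.length_cons]
      push_cast
      have := norm_add_le (v x - v y) (v y - v z)
      have := h _ _ hxy
      linarith
  refine (key i j p).trans ?_
  have : (p.length : ℝ) ≤ n := by exact_mod_cast hl.le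
  gcongr

lemma sum_half (f : ℕ → ℝ) (hf : ∀ s, 0 ≤ f s) (L T : ℕ) (B : ℝ)
    (hB : ∀ s, s < T → f s ≤ B) (hB0 : 0 ≤ B)
    (hh : ∀ s, s + L < T → f (s + L) ≤ f s / 2) :
    ∑ s ∈ Finset.range T, f s ≤ 2 * L * B := by
  have hfirst : ∀ M, M ≤ L → M ≤ T → ∑ s ∈ Finset.range M, f s ≤ L * B := by
    intro M hM hT
    have := Finset.sum_le_card_nsmul (Finset.range M) f B
      (fun s hs => hB s (by have := Finset.mem_range.1 hs; omega))
    rw [Finset.card_range, nsmul_eq_mul] at this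
    refine this.trans ?_
    gcongr
  rcases le_total T L with h | h
  · have := hfirst T h le_rfl
    have : (0 : ℝ) ≤ L * B := by positivity
    linarith
  · obtain ⟨M, rfl⟩ := Nat.exists_eq_add_of_le h
    have h1 := hfirst L le_rfl h
    have h2 : ∑ s ∈ Finset.range M, f (L + s) ≤ (∑ s ∈ Finset.range M, f s) / 2 := by
      rw [Finset.sum_div]
      apply Finset.sum_le_sum
      intro s hs
      have := Finset.mem_range.1 hs
      rw [add_comm L s]
      exact hh s (by omega)
    have h3 : ∑ s ∈ Finset.range M, f s ≤ ∑ s ∈ Finset.range (L + M), f s := by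
      apply Finset.sum_le_sum_of_subset_of_nonneg
      · intro x hx; simp at *; omega
      · intros; exact hf _
    have h4 := Finset.sum_range_add f L M
    linarith

namespace Flock

variable {n : ℕ} {r εo : ℝ} {a : Fin n → ℝ} (S : Flock n r εo a)

/-- The flocking network as a simple graph. -/
def gr (t : ℕ) : SimpleGraph (Fin n) where
  Adj i j := j ∈ S.N t i
  symm := ⟨fun i j h => (S.network_symm t i j).1 h⟩
  loopless := ⟨fun i h => S.network_irrefl t i h⟩

/-- Weighted energy relative to `u`. -/
noncomputable def en (u : Fin n → E3) (t : ℕ) : ℝ := ∑ i, (1 / a i) * ‖S.v t i - u i‖ ^ 2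

lemma en_nonneg (u : Fin n → E3) (t : ℕ) : 0 ≤ S.en u t :=
  Finset.sum_nonneg fun i _ => by have := S.weight_pos i; positivity

lemma en_step (u : Fin n → E3) (t : ℕ) (hu : ∀ i j, (S.gr t).Adj i j → u i = u j) :
    S.en u (t + 1) = ∑ i, (1 / a i) * ‖(S.v t i - u i) +
      a i • ∑ j ∈ S.N t i, ((S.v t j - u j) - (S.v t i - u i))‖ ^ 2 := by
  unfold en
  refine Finset.sum_congr rfl fun i _ => ?_
  have : ∑ j ∈ S.N t i, ((S.v t j - u j) - (S.v t i - u i)) = ∑ j ∈ S.N t i, (S.v t j - S.v t i) := by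
    refine Finset.sum_congr rfl fun j hj => ?_
    rw [hu i j hj]; abel
  rw [this, S.updateV]
  congr 3
  abel

lemma en_mono (u : Fin n → E3) (t : ℕ) (hu : ∀ i j, (S.gr t).Adj i j → u i = u j) :
    S.en u (t + 1) ≤ S.en u t := by
  rw [S.en_step u t hu]
  exact energy_drop0 (S.N t) (S.network_symm t) a S.weight_pos (S.weight_le t) _

lemma en_drop (u : Fin n → E3) (t : ℕ) (hu : ∀ i j, (S.gr t).Adj i j → u i = u j)
    (i j : Fin n) (h : (S.gr t).Adj i j) :
    S.en u (t + 1) + (1 / 2) * ‖S.v t i - S.v t j‖ ^ 2 ≤ S.en u t := by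
  rw [S.en_step u t hu]
  have := energy_drop (S.N t) (S.network_symm t) a S.weight_pos (S.weight_le t)
    (fun i => S.v t i - u i) i j h
  rw [show S.v t i - u i - (S.v t j - u j) = S.v t i - S.v t j by rw [hu i j h]; abel] at this
  exact this

lemma avg_ball (t : ℕ) (j : Fin n) (c : E3) (R : ℝ) (hj : ‖S.v t j - c‖ ≤ R)
    (hk : ∀ k ∈ S.N t j, ‖S.v t k - c‖ ≤ R) : ‖S.v (t + 1) j - c‖ ≤ R := by
  have ha := S.weight_pos j
  have hle := S.weight_le t j
  have had : a j * (S.N t j).card ≤ 1 := by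
    have h1 : (0 : ℝ) < (S.N t j).card + 1 := by positivity
    rw [le_div_iff₀ h1] at hle
    nlinarith
  have e : S.v (t + 1) j - c = (1 - a j * (S.N t j).card) • (S.v t j - c)
      + a j • ∑ k ∈ S.N t j, (S.v t k - c) := by
    rw [S.updateV]
    simp only [Finset.sum_sub_distrib, Finset.sum_const, ← Nat.cast_smul_eq_nsmul ℝ]
    module
  rw [e]
  have h2 : ‖∑ k ∈ S.N t j, (S.v t k - c)‖ ≤ (S.N t j).card * R := by
    have := norm_sum_le_of_le (S.N t j) hk
    simpa using this
  calc _ ≤ ‖(1 - a j * (S.N t j).card) • (S.v t j - c)‖ + ‖a j • ∑ k ∈ S.N t j, (S.v t k - c)‖ :=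
        norm_add_le _ _
    _ = (1 - a j * (S.N t j).card) * ‖S.v t j - c‖ + a j * ‖∑ k ∈ S.N t j, (S.v t k - c)‖ := by
        rw [norm_smul, norm_smul, Real.norm_of_nonneg ha.le, Real.norm_of_nonneg (by linarith)]
    _ ≤ (1 - a j * (S.N t j).card) * R + a j * ((S.N t j).card * R) := by
        have : 0 ≤ 1 - a j * (S.N t j).card := by linarith
        gcongr
    _ = R := by ring

lemma v_bound (R : ℝ) (h0 : ∀ i, ‖S.v 0 i‖ ≤ R) (t : ℕ) : ∀ i, ‖S.v t i‖ ≤ R := by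
  induction t with
  | zero => exact h0
  | succ t ih =>
    intro i
    have := S.avg_ball t i 0 R (by simpa using ih i) (fun k _ => by simpa using ih k)
    simpa using this

/-- No new edge appears during the times `p+1, …, q`. -/
def Ph (p q : ℕ) : Prop := ∀ s, p ≤ s → s < q → S.gr (s + 1) ≤ S.gr s

variable {S}

lemma Ph.le {p q : ℕ} (h : S.Ph p q) {s s' : ℕ} (h1 : p ≤ s) (h2 : s ≤ s') (h3 : s' ≤ q) :
    S.gr s' ≤ S.gr s := by
  induction s', h2 using Nat.le_induction with
  | base => exact le_rfl
  | succ k hk ih => exact (h k (by omega) (by omega)).trans (ih (by omega))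

variable (S)

open Classical in
/-- The largest velocity diameter of a flock. -/
noncomputable def D (t : ℕ) : ℝ :=
  ⨆ p : Fin n × Fin n, if (S.gr t).Reachable p.1 p.2 then ‖S.v t p.1 - S.v t p.2‖ else 0

lemma D_nonneg (t : ℕ) : 0 ≤ S.D t := by
  apply Real.iSup_nonneg
  intro p; split_ifs <;> positivity

lemma le_D (t : ℕ) (i j : Fin n) (h : (S.gr t).Reachable i j) : ‖S.v t i - S.v t j‖ ≤ S.D t := by
  classical
  have := le_ciSup (f := fun p : Fin n × Fin n =>
    if (S.gr t).Reachable p.1 p.2 then ‖S.v t p.1 - S.v t p.2‖ else 0)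
    (Set.finite_range _).bddAbove (i, j)
  simp only [h, if_true] at this
  refine this.trans (le_of_eq ?_)
  unfold D
  congr!

lemma D_le (t : ℕ) (B : ℝ) (hB : 0 ≤ B)
    (h : ∀ i j, (S.gr t).Reachable i j → ‖S.v t i - S.v t j‖ ≤ B) : S.D t ≤ B := by
  apply Real.iSup_le _ hB
  intro p
  split_ifs with hp
  · exact h _ _ hp
  · exact hB

lemma stay_ball {p q : ℕ} (h : S.Ph p q) (c : E3) (R : ℝ) (s : ℕ) (hps : p ≤ s) (i : Fin n)
    (hb : ∀ j, (S.gr s).Reachable i j → ‖S.v s j - c‖ ≤ R) (s' : ℕ) (h1 : s ≤ s')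
    (h2 : s' ≤ q + 1) : ∀ j, (S.gr s).Reachable i j → ‖S.v s' j - c‖ ≤ R := by
  induction s', h1 using Nat.le_induction with
  | base => exact hb
  | succ k hk ih =>
    intro j hj
    have ih := ih (by omega)
    apply S.avg_ball k j c R (ih j hj)
    intro l hl
    apply ih
    have : (S.gr s).Adj j l := h.le hps hk (by omega) hl
    exact hj.trans this.reachable

lemma v_diff {p q : ℕ} (h : S.Ph p q) (s s' : ℕ) (hps : p ≤ s) (h1 : s ≤ s') (h2 : s' ≤ q + 1)
    (i : Fin n) : ‖S.v s' i - S.v s i‖ ≤ S.D s :=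
  S.stay_ball h (S.v s i) (S.D s) s hps i (fun j hj => S.le_D s j i hj.symm) s' h1 h2 i
    (SimpleGraph.Reachable.refl i)

lemma D_anti {p q : ℕ} (h : S.Ph p q) (s s' : ℕ) (hps : p ≤ s) (h1 : s ≤ s') (h2 : s' ≤ q) :
    S.D s' ≤ S.D s := by
  apply S.D_le _ _ (S.D_nonneg s)
  intro i j hij
  have hij' : (S.gr s).Reachable i j := hij.mono (h.le hps h1 h2)
  have key : ∀ k, (S.gr s).Reachable i k → ‖S.v s k - S.v s' j‖ ≤ S.D s := by
    intro k hk
    rw [norm_sub_rev]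
    exact S.stay_ball h (S.v s k) (S.D s) s hps i
      (fun l hl => S.le_D s l k (hl.symm.trans hk)) s' h1 (by omega) j hij'
  exact S.stay_ball h (S.v s' j) (S.D s) s hps i key s' h1 (by omega) i
    (SimpleGraph.Reachable.refl i)

lemma D_sq (u : Fin n → E3) (t : ℕ) (hu : ∀ i j, (S.gr t).Adj i j → u i = u j) :
    S.D t ^ 2 ≤ 2 * (n : ℝ) ^ 2 * (S.en u t - S.en u (t + 1)) := by
  have hm := S.en_mono u t hu
  have h0 : 0 ≤ 2 * (S.en u t - S.en u (t + 1)) := by linarith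
  have hD : S.D t ≤ n * Real.sqrt (2 * (S.en u t - S.en u (t + 1))) := by
    apply S.D_le _ _ (by positivity)
    intro i j hij
    apply reach_le (S.gr t) _ _ (Real.sqrt_nonneg _) _ i j hij
    intro i j hij
    apply Real.le_sqrt_of_sq_le
    have := S.en_drop u t hu i j hij
    linarith
  calc S.D t ^ 2 ≤ (n * Real.sqrt (2 * (S.en u t - S.en u (t + 1)))) ^ 2 := by
        have := S.D_nonneg t
        gcongr
    _ = _ := by rw [mul_pow, Real.sq_sqrt h0]; ring

lemma D_half {p q : ℕ} (h : S.Ph p q) (ρ : ℝ) (hρ : 0 < ρ) (hρa : ∀ i, ρ ≤ a i) (L : ℕ)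
    (hL : 8 * (n : ℝ) ^ 3 / ρ ≤ L) (hL1 : 1 ≤ L) (s : ℕ) (hps : p ≤ s) (hq : s + L ≤ q) :
    S.D (s + L) ≤ S.D s / 2 := by
  classical
  let u : Fin n → E3 := fun i => S.v s ((S.gr s).connectedComponentMk i).out
  have hout : ∀ i, (S.gr s).Reachable i ((S.gr s).connectedComponentMk i).out := by
    intro i
    apply SimpleGraph.ConnectedComponent.exact
    exact (Quot.out_eq ((S.gr s).connectedComponentMk i)).symm
  have hu : ∀ t, s ≤ t → t ≤ q → ∀ i j, (S.gr t).Adj i j → u i = u j := by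
    intro t h1 h2 i j hij
    have : (S.gr s).connectedComponentMk i = (S.gr s).connectedComponentMk j :=
      SimpleGraph.ConnectedComponent.sound (h.le hps h1 h2 hij).reachable
    simp only [u, this]
  have hen : S.en u s ≤ n * ((1 / ρ) * S.D s ^ 2) := by
    unfold en
    have : ∀ i ∈ (Finset.univ : Finset (Fin n)),
        (1 / a i) * ‖S.v s i - u i‖ ^ 2 ≤ (1 / ρ) * S.D s ^ 2 := by
      intro i _
      have h1 := S.le_D s i _ (hout i)
      have h2 := one_div_le_one_div_of_le hρ (hρa i)
      have h3 := S.D_nonneg s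
      have : 0 ≤ 1 / ρ := by positivity
      gcongr
    have := Finset.sum_le_card_nsmul _ _ _ this
    simpa using this
  have htel : ∀ M, M ≤ L → (M : ℝ) * S.D (s + L) ^ 2 ≤
      2 * (n : ℝ) ^ 2 * (S.en u s - S.en u (s + M)) := by
    intro M
    induction M with
    | zero => intro _; simp
    | succ M ih =>
      intro hM
      have ih := ih (by omega)
      have h1 := S.D_sq u (s + M) (hu _ (by omega) (by omega))
      have h2 := S.D_anti h (s + M) (s + L) (by omega) (by omega) (by omega)
      have h3 : S.D (s + L) ^ 2 ≤ S.D (s + M) ^ 2 := by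
        have := S.D_nonneg (s + L)
        gcongr
      push_cast
      rw [← add_assoc]
      linarith
  have hfin := htel L le_rfl
  have hnn := S.en_nonneg u (s + L)
  have hLpos : (0 : ℝ) < L := by exact_mod_cast hL1
  have h5 : (L : ℝ) * S.D (s + L) ^ 2 ≤ 2 * (n : ℝ) ^ 3 / ρ * S.D s ^ 2 := by
    calc (L : ℝ) * S.D (s + L) ^ 2 ≤ 2 * (n : ℝ) ^ 2 * (S.en u s - S.en u (s + L)) := hfin
      _ ≤ 2 * (n : ℝ) ^ 2 * (n * ((1 / ρ) * S.D s ^ 2)) := by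
          gcongr; linarith
      _ = _ := by ring
  have h6 : 2 * (n : ℝ) ^ 3 / ρ * S.D s ^ 2 ≤ L * (S.D s / 2) ^ 2 := by
    have : 2 * (n : ℝ) ^ 3 / ρ = (8 * (n : ℝ) ^ 3 / ρ) / 4 := by ring
    rw [this]
    nlinarith [sq_nonneg (S.D s)]
  have h7 : S.D (s + L) ^ 2 ≤ (S.D s / 2) ^ 2 := le_of_mul_le_mul_left (h5.trans h6) hLpos
  exact le_of_sq_le_sq h7 (by have := S.D_nonneg s; linarith)

lemma sum_D {p q : ℕ} (h : S.Ph p q) (ρ : ℝ) (hρ : 0 < ρ) (hρa : ∀ i, ρ ≤ a i) (L : ℕ)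
    (hL : 8 * (n : ℝ) ^ 3 / ρ ≤ L) (hL1 : 1 ≤ L) (hv : ∀ t i, ‖S.v t i‖ ≤ 1 / 2)
    (T : ℕ) (hT : p + T ≤ q + 1) :
    ∑ s ∈ Finset.range T, S.D (p + s) ≤ 2 * L := by
  have := sum_half (fun s => S.D (p + s)) (fun s => S.D_nonneg _) L T 1 ?_ (by norm_num) ?_
  · simpa using this
  · intro s _
    apply S.D_le _ _ (by norm_num)
    intro i j _
    have := norm_sub_le (S.v (p + s) i) (S.v (p + s) j)
    have := hv (p + s) i
    have := hv (p + s) j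
    linarith
  · intro s hs
    have := S.D_half h ρ hρ hρa L hL hL1 (p + s) (by omega) (by omega)
    rwa [add_assoc] at this

lemma x_sum (p T : ℕ) (i : Fin n) :
    S.x (p + T) i = S.x p i + ∑ s ∈ Finset.range T, S.v (p + s + 1) i := by
  induction T with
  | zero => simp
  | succ T ih => rw [← add_assoc, S.updateX, ih, Finset.sum_range_succ, add_assoc]

/-- Deviation from straight flight over a phase. -/
lemma dev {p q : ℕ} (h : S.Ph p q) (ρ : ℝ) (hρ : 0 < ρ) (hρa : ∀ i, ρ ≤ a i) (L : ℕ)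
    (hL : 8 * (n : ℝ) ^ 3 / ρ ≤ L) (hL1 : 1 ≤ L) (hv : ∀ t i, ‖S.v t i‖ ≤ 1 / 2)
    (T : ℕ) (hT : p + T ≤ q + 1) (i : Fin n) :
    ‖(T : ℝ) • S.v (p + T) i - (S.x (p + T) i - S.x p i)‖ ≤ 2 * L := by
  rw [S.x_sum p T i]
  have e : (T : ℝ) • S.v (p + T) i
      - (S.x p i + ∑ s ∈ Finset.range T, S.v (p + s + 1) i - S.x p i)
      = ∑ s ∈ Finset.range T, (S.v (p + T) i - S.v (p + s + 1) i) := by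
    rw [Finset.sum_sub_distrib, Finset.sum_const, Finset.card_range, ← Nat.cast_smul_eq_nsmul ℝ]
    abel
  rw [e]
  refine le_trans (norm_sum_le_of_le (f := fun s => S.v (p + T) i - S.v (p + s + 1) i)
    (n := fun s => S.D (p + s)) _ ?_)
    (S.sum_D h ρ hρ hρa L hL hL1 hv T hT)
  intro s hs
  have hs := Finset.mem_range.1 hs
  rcases Nat.lt_or_ge (s + 1) T with h1 | h1
  · refine (S.v_diff h (p + s + 1) (p + T) (by omega) (by omega) hT i).trans ?_
    exact S.D_anti h (p + s) (p + s + 1) (by omega) (by omega) (by omega)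
  · have : p + s + 1 = p + T := by omega
    rw [this, sub_self, norm_zero]
    exact S.D_nonneg _

lemma x_bound (hx : ∀ i, ‖S.x 0 i‖ ≤ 1) (hv : ∀ t i, ‖S.v t i‖ ≤ 1 / 2) (t : ℕ) (i : Fin n) :
    ‖S.x t i‖ ≤ 1 + t / 2 := by
  induction t with
  | zero => simpa using hx i
  | succ t ih =>
    rw [S.updateX]
    have := norm_add_le (S.x t i) (S.v (t + 1) i)
    have := hv (t + 1) i
    push_cast
    linarith

lemma new_time {p t : ℕ} (hpt : p ≤ t) (h : S.Ph p t) (hr : r ≤ 1) (hε : 0 < εo)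
    (ρ : ℝ) (hρ : 0 < ρ)
    (hρa : ∀ i, ρ ≤ a i) (L : ℕ)
    (hL : 8 * (n : ℝ) ^ 3 / ρ ≤ L) (hL1 : 1 ≤ L) (hx : ∀ i, ‖S.x 0 i‖ ≤ 1)
    (hv : ∀ t i, ‖S.v t i‖ ≤ 1 / 2)
    (i j : Fin n) (hd : dist (S.x (t + 1) i) (S.x (t + 1) j) ≤ r)
    (hvd : εo < ‖S.v (t + 1) i - S.v (t + 1) j‖) :
    ((t + 1 : ℕ) : ℝ) + L ≤ (1 + 7 / εo) * (p + L) := by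
  obtain ⟨T, hT⟩ : ∃ T, t + 1 = p + T := ⟨t + 1 - p, by omega⟩
  rw [hT] at hd hvd ⊢
  have d1 := S.dev h ρ hρ hρa L hL hL1 hv T (by omega) i
  have d2 := S.dev h ρ hρ hρa L hL hL1 hv T (by omega) j
  have x1 := S.x_bound hx hv p i
  have x2 := S.x_bound hx hv p j
  rw [dist_eq_norm] at hd
  set A := (T : ℝ) • S.v (p + T) i - (S.x (p + T) i - S.x p i) with hA
  set B := (T : ℝ) • S.v (p + T) j - (S.x (p + T) j - S.x p j) with hB
  have e : (T : ℝ) • (S.v (p + T) i - S.v (p + T) j)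
      = (A - B) + (S.x (p + T) i - S.x (p + T) j) - (S.x p i - S.x p j) := by
    rw [hA, hB]; module
  have hn : (T : ℝ) * ‖S.v (p + T) i - S.v (p + T) j‖ ≤ 3 + p + 4 * L := by
    have h0 := norm_smul (T : ℝ) (S.v (p + T) i - S.v (p + T) j)
    rw [Real.norm_of_nonneg (Nat.cast_nonneg T), e] at h0
    rw [← h0]
    have := norm_sub_le ((A - B) + (S.x (p + T) i - S.x (p + T) j)) (S.x p i - S.x p j)
    have := norm_add_le (A - B) (S.x (p + T) i - S.x (p + T) j)
    have := norm_sub_le A B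
    have := norm_sub_le (S.x p i) (S.x p j)
    linarith
  have hTε : (T : ℝ) * εo ≤ 7 * (p + L) := by
    have h1 : (T : ℝ) * εo ≤ T * ‖S.v (p + T) i - S.v (p + T) j‖ := by gcongr
    have h2 : (1 : ℝ) ≤ L := by exact_mod_cast hL1
    have h3 : (0 : ℝ) ≤ p := Nat.cast_nonneg p
    linarith
  have : (T : ℝ) ≤ 7 * (p + L) / εo := by rwa [le_div_iff₀ hε]
  push_cast
  have e2 : (1 + 7 / εo) * ((p : ℝ) + L) = p + L + 7 * (p + L) / εo := by ring
  rw [e2]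
  linarith

lemma phases (hr : r ≤ 1) (hε : 0 < εo) (ρ : ℝ) (hρ : 0 < ρ)
    (hρa : ∀ i, ρ ≤ a i) (L : ℕ)
    (hL : 8 * (n : ℝ) ^ 3 / ρ ≤ L) (hL1 : 1 ≤ L) (hx : ∀ i, ‖S.x 0 i‖ ≤ 1)
    (hv : ∀ t i, ‖S.v t i‖ ≤ 1 / 2) (t : ℕ) :
    ∃ p k : ℕ, p ≤ t ∧ S.Ph p t ∧ (p : ℝ) + L ≤ (1 + 7 / εo) ^ k * L ∧
      (k : ℝ) * (εo ^ 2 / 2) ≤ S.en 0 0 - S.en 0 (p + 1) := by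
  have hanti : Antitone (S.en 0) := antitone_nat_of_succ_le fun t => S.en_mono 0 t (by simp)
  induction t with
  | zero =>
    refine ⟨0, 0, le_rfl, fun s _ h => by omega, by simp, ?_⟩
    have := hanti (Nat.zero_le 1)
    simpa using this
  | succ t ih =>
    obtain ⟨p, k, hpt, hph, hp, hk⟩ := ih
    by_cases hnew : S.gr (t + 1) ≤ S.gr t
    · refine ⟨p, k, by omega, ?_, hp, hk⟩
      intro s h1 h2
      rcases Nat.lt_or_ge s t with h3 | h3
      · exact hph s h1 h3
      · have : s = t := by omega
        subst this; exact hnew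
    · have : ∃ i j, (S.gr (t + 1)).Adj i j ∧ ¬ (S.gr t).Adj i j := by
        by_contra hcon
        push Not at hcon
        exact hnew fun i j hij => hcon i j hij
      obtain ⟨i, j, h1, h2⟩ := this
      have hne : i ≠ j := h1.ne
      obtain ⟨hd, hvd⟩ := (S.newEdge t i j hne h2).1 h1
      have hb := S.new_time hpt hph hr hε ρ hρ hρa L hL hL1 hx hv i j hd hvd
      refine ⟨t + 1, k + 1, le_rfl, fun s _ _ => by omega, ?_, ?_⟩
      · refine hb.trans ?_
        have : 0 ≤ 1 + 7 / εo := by positivity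
        calc (1 + 7 / εo) * ((p : ℝ) + L) ≤ (1 + 7 / εo) * ((1 + 7 / εo) ^ k * L) := by gcongr
          _ = _ := by ring
      · have h3 := S.en_drop 0 (t + 1) (by simp) i j h1
        have h4 : S.en 0 (t + 1) ≤ S.en 0 (p + 1) := hanti (by omega)
        have h5 : εo ^ 2 ≤ ‖S.v (t + 1) i - S.v (t + 1) j‖ ^ 2 := by gcongr
        push_cast
        linarith

lemma en_init (ρ : ℝ) (hρ : 0 < ρ) (hn : 0 < n) (hρa : ∀ i, ρ ≤ a i)
    (h0 : ∀ i, ‖S.v 0 i‖ ≤ (1 / 2) * Real.sqrt (ρ / n)) : S.en 0 0 ≤ 1 / 4 := by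
  have hn' : (0 : ℝ) < n := by exact_mod_cast hn
  have : ∀ i ∈ (Finset.univ : Finset (Fin n)),
      (1 / a i) * ‖S.v 0 i - (0 : Fin n → E3) i‖ ^ 2 ≤ 1 / (4 * n) := by
    intro i _
    have h2 := one_div_le_one_div_of_le hρ (hρa i)
    have h3 : ‖S.v 0 i‖ ^ 2 ≤ (1 / 4) * (ρ / n) := by
      calc ‖S.v 0 i‖ ^ 2 ≤ ((1 / 2) * Real.sqrt (ρ / n)) ^ 2 := by gcongr; exact h0 i
        _ = _ := by rw [mul_pow, Real.sq_sqrt (by positivity)]; ring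
    simp only [Pi.zero_apply, sub_zero]
    calc (1 / a i) * ‖S.v 0 i‖ ^ 2 ≤ (1 / ρ) * ((1 / 4) * (ρ / n)) := by gcongr
      _ = _ := by field_simp
  have := Finset.sum_le_card_nsmul _ _ _ this
  unfold en
  refine this.trans (le_of_eq ?_)
  simp
  field_simp

end Flock

/-- line-of-sight lemma. In the bird flocking model with at most `m`
flocks at every time, there is a constant `c = c(εo)` such that for every bird `i` and
every integer `t > 1`:
`‖v_i(t) − (1/t)(x_i(t) − x_i(0))‖ ≤ c · n^(2(m+2)) · (1/ρ)^(m+1) · (log t)/t`. -/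
theorem flock_lineOfSight (εo : ℝ) (hεo : 0 < εo) :
    ∃ c : ℝ, 0 < c ∧
      ∀ (n m : ℕ) (r ρ : ℝ) (a : Fin n → ℝ),
        0 < r → r ≤ 1 → 1 ≤ m → m ≤ n → 0 < ρ → ρ ≤ 1 / 2 → (∀ i, ρ ≤ a i) →
        ∀ S : Flock n r εo a,
          (∀ i, ‖S.x 0 i‖ ≤ 1) →
          (∀ i, ‖S.v 0 i‖ ≤ (1 / 2) * Real.sqrt (ρ / n)) →
          S.flocksLE m →
          ∀ (i : Fin n) (t : ℕ), 1 < t →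
            ‖S.v t i - (1 / (t : ℝ)) • (S.x t i - S.x 0 i)‖ ≤
              c * (n : ℝ) ^ (2 * (m + 2)) * (1 / ρ) ^ (m + 1) *
                (Real.log t / t) := by
  set K : ℕ := ⌈1 / (2 * εo ^ 2)⌉₊ with hK
  have hC1 : 1 ≤ 1 + 7 / εo := by
    have : 0 < 7 / εo := by positivity
    linarith
  refine ⟨36 * (1 + 7 / εo) ^ K, by positivity, ?_⟩
  intro n m r ρ a hr0 hr1 hm hmn hρ hρ2 hρa S hx hv0 _ i t ht
  have hn : 0 < n := by omega
  have hn1 : (1 : ℝ) ≤ n := by exact_mod_cast hn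
  have hρ1 : 1 ≤ 1 / ρ := by rw [le_div_iff₀ hρ]; linarith
  have hv : ∀ t i, ‖S.v t i‖ ≤ 1 / 2 := by
    apply S.v_bound
    intro i
    refine (hv0 i).trans ?_
    have : Real.sqrt (ρ / n) ≤ 1 := by
      rw [Real.sqrt_le_left (by norm_num), one_pow, div_le_one (by linarith)]
      linarith
    linarith
  set L : ℕ := ⌈8 * (n : ℝ) ^ 3 / ρ⌉₊ with hLdef
  have hL : 8 * (n : ℝ) ^ 3 / ρ ≤ L := Nat.le_ceil _
  have hn3 : 1 ≤ (n : ℝ) ^ 3 * (1 / ρ) := one_le_mul_of_one_le_of_one_le (one_le_pow₀ hn1) hρ1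
  have hL1 : 1 ≤ L := Nat.one_le_ceil_iff.2 (by positivity)
  have hLu : (L : ℝ) ≤ 9 * ((n : ℝ) ^ 3 * (1 / ρ)) := by
    have h := Nat.ceil_lt_add_one (a := 8 * (n : ℝ) ^ 3 / ρ) (by positivity)
    have e : 8 * (n : ℝ) ^ 3 / ρ = 8 * ((n : ℝ) ^ 3 * (1 / ρ)) := by ring
    rw [← hLdef] at h
    linarith
  obtain ⟨p, k, hpt, hph, hp, hk⟩ := S.phases hr1 hεo ρ hρ hρa L hL hL1 hx hv t
  have hkK : k ≤ K := by
    have h1 := S.en_init ρ hρ hn hρa hv0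
    have h2 := S.en_nonneg 0 (p + 1)
    have h3 : (k : ℝ) ≤ 1 / (2 * εo ^ 2) := by
      rw [le_div_iff₀ (by positivity)]
      linarith
    exact_mod_cast h3.trans (Nat.le_ceil _)
  have hpL : (p : ℝ) + L ≤ (1 + 7 / εo) ^ K * L := by
    refine hp.trans ?_
    gcongr
  obtain ⟨T, rfl⟩ := Nat.exists_eq_add_of_le hpt
  have hdev := S.dev hph ρ hρ hρa L hL hL1 hv T (by omega) i
  have hfirst : ‖(p : ℝ) • S.v (p + T) i - (S.x p i - S.x 0 i)‖ ≤ p := by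
    have hs := S.x_sum 0 p i
    simp only [zero_add] at hs
    rw [hs]
    have e : (p : ℝ) • S.v (p + T) i
        - (S.x 0 i + ∑ s ∈ Finset.range p, S.v (s + 1) i - S.x 0 i)
        = ∑ s ∈ Finset.range p, (S.v (p + T) i - S.v (s + 1) i) := by
      rw [Finset.sum_sub_distrib, Finset.sum_const, Finset.card_range, ← Nat.cast_smul_eq_nsmul ℝ]
      abel
    rw [e]
    have := norm_sum_le_of_le (f := fun s => S.v (p + T) i - S.v (s + 1) i)
      (n := fun _ => (1 : ℝ)) (Finset.range p) (by
        intro s _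
        have := norm_sub_le (S.v (p + T) i) (S.v (s + 1) i)
        have := hv (p + T) i
        have := hv (s + 1) i
        linarith)
    simpa using this
  set t := p + T with htdef
  have ht0 : (0 : ℝ) < t := by exact_mod_cast (by omega : 0 < t)
  have htc : (t : ℝ) = p + T := by rw [htdef]; push_cast; ring
  have htot : ‖(t : ℝ) • S.v t i - (S.x t i - S.x 0 i)‖ ≤ p + 2 * L := by
    have e : (t : ℝ) • S.v t i - (S.x t i - S.x 0 i)
        = ((p : ℝ) • S.v t i - (S.x p i - S.x 0 i)) + ((T : ℝ) • S.v t i - (S.x t i - S.x p i)) := by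
      rw [htc]; module
    rw [e]
    exact (norm_add_le _ _).trans (add_le_add hfirst hdev)
  have hlog : 1 / 2 ≤ Real.log t := by
    have h2 : Real.log 2 ≤ Real.log t := Real.log_le_log (by norm_num) (by exact_mod_cast ht)
    have := Real.log_two_gt_d9
    linarith
  have e : S.v t i - (1 / (t : ℝ)) • (S.x t i - S.x 0 i)
      = (1 / (t : ℝ)) • ((t : ℝ) • S.v t i - (S.x t i - S.x 0 i)) := by
    rw [smul_sub (1 / (t : ℝ)) ((t : ℝ) • S.v t i), smul_smul, one_div_mul_cancel ht0.ne', one_smul]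
  rw [e, norm_smul, Real.norm_of_nonneg (by positivity)]
  have hCK : 1 ≤ (1 + 7 / εo) ^ K := one_le_pow₀ hC1
  have hpow1 : (n : ℝ) ^ 3 ≤ (n : ℝ) ^ (2 * (m + 2)) := pow_le_pow_right₀ hn1 (by omega)
  have hpow2 : 1 / ρ ≤ (1 / ρ) ^ (m + 1) := le_self_pow₀ hρ1 (by omega)
  have hmain : (p : ℝ) + 2 * L ≤
      36 * (1 + 7 / εo) ^ K * (n : ℝ) ^ (2 * (m + 2)) * (1 / ρ) ^ (m + 1) * Real.log t := by
    have hLp : (0 : ℝ) ≤ L := Nat.cast_nonneg L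
    calc (p : ℝ) + 2 * L ≤ 2 * ((1 + 7 / εo) ^ K * L) := by nlinarith
      _ ≤ 2 * ((1 + 7 / εo) ^ K * (9 * ((n : ℝ) ^ 3 * (1 / ρ)))) := by gcongr
      _ ≤ 2 * ((1 + 7 / εo) ^ K * (9 * ((n : ℝ) ^ (2 * (m + 2)) * (1 / ρ) ^ (m + 1)))) := by gcongr
      _ = 36 * (1 + 7 / εo) ^ K * (n : ℝ) ^ (2 * (m + 2)) * (1 / ρ) ^ (m + 1) * (1 / 2) := by ring
      _ ≤ _ := by gcongr
  calc 1 / (t : ℝ) * ‖(t : ℝ) • S.v t i - (S.x t i - S.x 0 i)‖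
      ≤ 1 / (t : ℝ) * (36 * (1 + 7 / εo) ^ K * (n : ℝ) ^ (2 * (m + 2)) * (1 / ρ) ^ (m + 1)
          * Real.log t) := by
        gcongr
        exact htot.trans hmain
    _ = _ := by ring
end
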